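/- arXiv:1012.0534 — 4 statements merged into one kernel-verified Lean document; each statement's English description precedes it below -/
import Mathlib

section
/- Let C be a finite-dimensional local symmetric k-algebra and n ≥ 1 a natural number such that dim_k(J(C)^n / J(C)^{n+1}) = 1. Then J(C)^{n−1} is contained in the center Z(C). -/
open Module

noncomputable section

def IsSymmAlg (k : Type) [Field k] (C : Type) [Ring C] [Algebra k C] : Prop :=
  ∃ s : C →ₗ[k] k, (∀ x y : C, s (x * y) = s (y * x)) ∧
    ∀ I : Ideal C, (∀ x ∈ I, s x = 0) → I = ⊥

def radSub (k : Type) [Field k] (C : Type) [Ring C] [Algebra k C] : Submodule k C :=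
  Submodule.span k {a : C | ¬ IsUnit a}

def socSub (k : Type) [Field k] (C : Type) [Ring C] [Algebra k C] : Submodule k C where
  carrier := {a : C | ∀ b : C, ¬ IsUnit b → b * a = 0 ∧ a * b = 0}
  add_mem' := by
    intro a b ha hb c hc
    obtain ⟨h1, h2⟩ := ha c hc
    obtain ⟨h3, h4⟩ := hb c hc
    constructor
    · rw [mul_add, h1, h3, add_zero]
    · rw [add_mul, h2, h4, add_zero]
  zero_mem' := by
    intro b hb
    constructor <;> simp
  smul_mem' := by
    intro r a ha c hc
    obtain ⟨h1, h2⟩ := ha c hc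
    constructor
    · rw [Algebra.mul_smul_comm, h1, smul_zero]
    · rw [Algebra.smul_mul_assoc, h2, smul_zero]

section helpers
variable {k : Type} [Field k] {C : Type} [Ring C] [Algebra k C]

lemma isUnit_of_mul [FiniteDimensional k C] {a b : C} (h : IsUnit (a * b)) :
    IsUnit a ∧ IsUnit b := by
  haveI : IsNoetherianRing C := isNoetherian_of_tower k inferInstance
  obtain ⟨u, hu⟩ := h
  have h1 : a * (b * ((u⁻¹ : Cˣ) : C)) = 1 := by rw [← mul_assoc, ← hu, Units.mul_inv]
  have h2 : (((u⁻¹ : Cˣ) : C) * a) * b = 1 := by rw [mul_assoc, ← hu, Units.inv_mul]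
  exact ⟨IsUnit.of_mul_eq_one _ h1, IsUnit.of_mul_eq_one_right _ h2⟩

lemma mem_rad [FiniteDimensional k C] [IsLocalRing C] {a : C} :
    a ∈ radSub k C ↔ ¬ IsUnit a := by
  constructor
  · intro h
    unfold radSub at h
    induction h using Submodule.span_induction with
    | mem x hx => exact hx
    | zero => exact not_isUnit_zero
    | add x y _ _ hx hy =>
      rintro ⟨u, hu⟩
      have h1 : ((u⁻¹ : Cˣ) : C) * x + ((u⁻¹ : Cˣ) : C) * y = 1 := by
        rw [← mul_add, ← hu, Units.inv_mul]
      rcases IsLocalRing.isUnit_or_isUnit_of_add_one h1 with h | h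
      · exact hx (isUnit_of_mul (k := k) h).2
      · exact hy (isUnit_of_mul (k := k) h).2
    | smul r x _ hx =>
      intro h
      rw [Algebra.smul_def] at h
      exact hx (isUnit_of_mul (k := k) h).2
  · intro h
    exact Submodule.subset_span h

lemma rad_mul_left [FiniteDimensional k C] [IsLocalRing C] {a : C} (c : C)
    (h : a ∈ radSub k C) : c * a ∈ radSub k C := by
  rw [mem_rad] at *
  exact fun h' => h (isUnit_of_mul (k := k) h').2

lemma rad_mul_right [FiniteDimensional k C] [IsLocalRing C] {a : C} (c : C)
    (h : a ∈ radSub k C) : a * c ∈ radSub k C := by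
  rw [mem_rad] at *
  exact fun h' => h (isUnit_of_mul (k := k) h').1

lemma rad_nilp [FiniteDimensional k C] [IsLocalRing C] : ∃ N, radSub k C ^ N = ⊥ := by
  haveI : IsArtinianRing C := isArtinian_of_tower k inferInstance
  obtain ⟨N, hN⟩ := IsArtinianRing.isNilpotent_jacobson_bot (R := C)
  refine ⟨N, ?_⟩
  have h1 : ∀ a ∈ radSub k C, a ∈ Ideal.jacobson (⊥ : Ideal C) := by
    intro a ha
    rw [Ideal.mem_jacobson_iff]
    intro c
    have h2 : IsUnit (c * a + 1) := by
      by_contra h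
      have h3 := (radSub k C).sub_mem ((mem_rad (k := k)).2 h) (rad_mul_left c ha)
      rw [add_sub_cancel_left, mem_rad] at h3
      exact h3 isUnit_one
    obtain ⟨u, hu⟩ := h2
    refine ⟨((u⁻¹ : Cˣ) : C), ?_⟩
    have : ((u⁻¹ : Cˣ) : C) * c * a + ((u⁻¹ : Cˣ) : C) = 1 := by
      rw [mul_assoc, ← mul_add_one, ← hu, Units.inv_mul]
    rw [this]; simp
  have h2 : ∀ m, ∀ a ∈ radSub k C ^ (m+1), a ∈ (Ideal.jacobson (⊥ : Ideal C)) ^ (m+1) := by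
    intro m
    induction m with
    | zero => simpa [Submodule.pow_one] using h1
    | succ m ih =>
      intro a ha
      rw [pow_succ] at ha
      rw [Submodule.pow_succ]
      induction ha using Submodule.mul_induction_on' with
      | mem_mul_mem x hx y hy => exact Ideal.mul_mem_mul (ih x hx) (h1 y hy)
      | add x _ y _ hx hy => exact Submodule.add_mem _ hx hy
  rcases N with _ | m
  · rw [Submodule.pow_zero] at hN
    have : (1 : C) ∈ (0 : Ideal C) := by rw [← hN]; simp
    simp at this
  · rw [eq_bot_iff]
    intro a ha
    have := h2 m a ha
    rw [hN] at this
    simpa using this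

lemma rad_pow_left [FiniteDimensional k C] [IsLocalRing C] (m : ℕ) {a : C} (c : C)
    (h : a ∈ radSub k C ^ (m+1)) : c * a ∈ radSub k C ^ (m+1) := by
  rw [pow_succ'] at *
  induction h using Submodule.mul_induction_on' with
  | mem_mul_mem x hx y hy => rw [← mul_assoc]; exact Submodule.mul_mem_mul (rad_mul_left c hx) hy
  | add x _ y _ hx hy => rw [mul_add]; exact Submodule.add_mem _ hx hy

lemma le_of_nilp {J M : Submodule k C} {N : ℕ} (hN : J ^ N = ⊥) (n : ℕ)
    (h : ∀ i, J ^ (n + i) ≤ M ⊔ J ^ (n + i + 1)) : J ^ n ≤ M := by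
  have h1 : ∀ i, J ^ n ≤ M ⊔ J ^ (n + i) := by
    intro i
    induction i with
    | zero => exact le_sup_right
    | succ i ih => exact ih.trans (sup_le le_sup_left (h i))
  refine (h1 N).trans (sup_le le_rfl ?_)
  rw [pow_add, hN]; simp

end helpers

/-- If dim J^n/J^{n+1} = 1 then J^{n-1} ⊆ Z(C). -/
theorem stmt7 (k : Type) [Field k] (C : Type) [Ring C] [Algebra k C]
    [FiniteDimensional k C] [IsLocalRing C] (hsym : IsSymmAlg k C)
    (n : ℕ) (hn : 1 ≤ n)
    (hdim : finrank k
      ((radSub k C ^ n : Submodule k C) ⧸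
        (Submodule.comap (radSub k C ^ n : Submodule k C).subtype
          (radSub k C ^ (n + 1)))) = 1) :
    ∀ a ∈ radSub k C ^ (n - 1), a ∈ Subalgebra.center k C := by
  obtain ⟨m, rfl⟩ : ∃ m, n = m + 1 := ⟨n - 1, by omega⟩
  rw [Nat.add_sub_cancel]
  obtain ⟨s, hs, hI⟩ := hsym
  obtain ⟨N, hN⟩ := rad_nilp (k := k) (C := C)
  have hJl : ∀ (c : C) {a : C}, a ∈ radSub k C → c * a ∈ radSub k C := fun c _ h => rad_mul_left c h
  have hJr : ∀ (c : C) {a : C}, a ∈ radSub k C → a * c ∈ radSub k C := fun c _ h => rad_mul_right c h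
  have hPl : ∀ (c : C) {a : C}, a ∈ radSub k C ^ (m+1+1) → c * a ∈ radSub k C ^ (m+1+1) :=
    fun c _ h => rad_pow_left _ c h
  have hPl' : ∀ (c : C) {a : C}, a ∈ radSub k C ^ (m+1) → c * a ∈ radSub k C ^ (m+1) :=
    fun c _ h => rad_pow_left _ c h
  have hmem : ∀ a : C, a ∈ radSub k C ↔ ¬ IsUnit a := fun a => mem_rad
  generalize radSub k C = J at *
  -- choose the generator
  obtain ⟨w, hw, y, hy, hx⟩ : ∃ w ∈ J ^ m, ∃ y ∈ J, w * y ∉ J ^ (m+1+1) := by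
    by_contra! hcon
    have hle : J ^ (m+1) ≤ J ^ (m+1+1) := by
      conv_lhs => rw [pow_succ]
      exact Submodule.mul_le.2 hcon
    have : Submodule.comap (J ^ (m+1)).subtype (J ^ (m+1+1)) = ⊤ := by
      rw [eq_top_iff]; intro z _; exact hle z.2
    rw [this] at hdim
    have h0 := Module.finrank_zero_of_subsingleton (R := k)
      (M := (J ^ (m+1) : Submodule k C) ⧸ (⊤ : Submodule k (J ^ (m+1) : Submodule k C)))
    omega
  have hxn : w * y ∈ J ^ (m+1) := by rw [pow_succ]; exact Submodule.mul_mem_mul hw hy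
  have hgen : ∀ z ∈ J ^ (m+1), ∃ r : k, z - r • (w * y) ∈ J ^ (m+1+1) := by
    intro z hz
    have hne : (Submodule.Quotient.mk ⟨w * y, hxn⟩ : (J ^ (m+1) : Submodule k C) ⧸
        (Submodule.comap (J ^ (m+1) : Submodule k C).subtype (J ^ (m + 1+1)))) ≠ 0 := by
      intro h
      rw [Submodule.Quotient.mk_eq_zero] at h
      exact hx h
    obtain ⟨r, hr⟩ := (finrank_eq_one_iff_of_nonzero' _ hne).1 hdim (Submodule.Quotient.mk ⟨z, hz⟩)
    refine ⟨r, ?_⟩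
    rw [← Submodule.Quotient.mk_smul, eq_comm, Submodule.Quotient.eq] at hr
    exact hr
  have hgen' : J ^ (m+1) ≤ Submodule.span k {w * y} ⊔ J ^ (m+1+1) := by
    intro z hz
    obtain ⟨r, hr⟩ := hgen z hz
    have : z = r • (w * y) + (z - r • (w * y)) := by abel
    rw [this]
    exact Submodule.add_mem_sup (Submodule.smul_mem _ _ (Submodule.mem_span_singleton_self _)) hr
  -- C = k + J
  have hdec : ∀ b : C, ∃ r : k, b - algebraMap k C r ∈ J := by
    intro b
    obtain ⟨r, hr⟩ := hgen _ (hPl' b hxn)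
    refine ⟨r, ?_⟩
    rw [hmem]
    rintro ⟨u, hu⟩
    rw [Algebra.smul_def, ← sub_mul, ← hu] at hr
    have := hPl ((u⁻¹ : Cˣ) : C) hr
    rw [Units.inv_mul_cancel_left] at this
    exact hx this
  -- left generation
  have hL : J ^ (m+1) ≤ ⊤ * Submodule.span k {w * y} := by
    refine le_of_nilp hN _ fun i => ?_
    calc J ^ (m+1+i) = J ^ i * J ^ (m+1) := by rw [← pow_add, add_comm]
      _ ≤ J ^ i * (Submodule.span k {w * y} ⊔ J ^ (m+1+1)) := mul_le_mul' le_rfl hgen'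
      _ = J ^ i * Submodule.span k {w * y} ⊔ J ^ (m+1+i+1) := by
        rw [Submodule.mul_sup, ← pow_add]; congr 2; omega
      _ ≤ _ := sup_le_sup_right (mul_le_mul' le_top le_rfl) _
  -- right generation
  set A := Subalgebra.toSubmodule (Algebra.adjoin k {y}) with hA
  have hy1 : Submodule.span k {y} ≤ A := by
    rw [Submodule.span_le]; simpa [hA] using Algebra.self_mem_adjoin_singleton k y
  have h1A : (1 : Submodule k C) ≤ A := by
    rw [Submodule.one_le]; exact (Algebra.adjoin k {y}).one_mem
  have hAA : A * A ≤ A := by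
    rw [Submodule.mul_le]; intro p hp q hq; exact (Algebra.adjoin k {y}).mul_mem hp hq
  have hstep : ∀ i, J ^ (m+1+1+i) ≤ J ^ (m+1+i) * Submodule.span k {y} ⊔ J ^ (m+1+1+i+1) := by
    intro i
    calc J ^ (m+1+1+i) = J ^ (i+1) * J ^ (m+1) := by rw [← pow_add]; congr 1; omega
      _ ≤ J ^ (i+1) * (Submodule.span k {w * y} ⊔ J ^ (m+1+1)) := mul_le_mul' le_rfl hgen'
      _ = J ^ (i+1) * Submodule.span k {w * y} ⊔ J ^ (m+1+1+i+1) := by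
        rw [Submodule.mul_sup, ← pow_add]; congr 2; omega
      _ ≤ _ := by
        refine sup_le_sup_right ?_ _
        have : J ^ (m+1+i) = J ^ (i+1) * J ^ m := by rw [← pow_add]; congr 1; omega
        rw [this, mul_assoc]
        refine mul_le_mul' le_rfl ?_
        rw [Submodule.span_le, Set.singleton_subset_iff]
        exact Submodule.mul_mem_mul hw (Submodule.mem_span_singleton_self _)
  have hyJ : Submodule.span k {y} ≤ J := by
    rw [Submodule.span_le]; simpa using hy
  have hR : J ^ (m+1+1) ≤ Submodule.span k {w * y * y} * A := by
    refine le_of_nilp hN _ fun i => ?_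
    induction i with
    | zero =>
      refine (hstep 0).trans (sup_le ?_ le_sup_right)
      refine (mul_le_mul' hgen' le_rfl).trans ?_
      rw [Submodule.sup_mul]
      refine sup_le_sup ?_ ?_
      · rw [Submodule.span_mul_span, Set.singleton_mul_singleton]
        conv_lhs => rw [← mul_one (Submodule.span k _)]
        exact mul_le_mul' le_rfl h1A
      · rw [pow_succ _ (m+1+1+0)]
        exact mul_le_mul' le_rfl hyJ
    | succ i ih =>
      refine (hstep (i+1)).trans (sup_le ?_ le_sup_right)
      have e : m+1+(i+1) = m+1+1+i := by omega
      rw [e]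
      refine (mul_le_mul' ih le_rfl).trans ?_
      rw [Submodule.sup_mul]
      refine sup_le_sup ?_ ?_
      · rw [mul_assoc]
        exact mul_le_mul' le_rfl ((mul_le_mul' le_rfl hy1).trans hAA)
      · rw [pow_succ _ (m+1+1+(i+1))]
        exact mul_le_mul' le_rfl hyJ
  -- decomposition of J
  have hB : ∀ b ∈ J, ∃ p ∈ Algebra.adjoin k {y}, p ∈ J ∧ ∀ z ∈ J ^ (m+1), z * (b - p) = 0 := by
    intro b hb
    have h1 : w * y * b ∈ J ^ (m+1+1) := by
      rw [pow_succ _ (m+1)]; exact Submodule.mul_mem_mul hxn hb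
    obtain ⟨q, hq, hqe⟩ := Submodule.mem_span_singleton_mul.1 (hR h1)
    refine ⟨y * q, (Algebra.adjoin k {y}).mul_mem (Algebra.self_mem_adjoin_singleton k y) hq,
      hJr q hy, ?_⟩
    intro z hz
    obtain ⟨t, _, rfl⟩ := Submodule.mem_mul_span_singleton.1 (hL hz)
    rw [mul_assoc, mul_sub, ← hqe]
    simp [mul_assoc]
  have hcomm : ∀ p ∈ Algebra.adjoin k {y}, ∀ q ∈ Algebra.adjoin k {y}, p * q = q * p := by
    intro p hp q hq
    exact Algebra.commute_of_mem_adjoin_singleton_of_commute hq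
      (Algebra.commute_of_mem_adjoin_singleton_of_commute hp (Commute.refl y)).symm |>.symm.symm
  have key : ∀ a ∈ J ^ m, ∀ b ∈ J, ∀ c ∈ J, s (a * b * c) = s (a * c * b) := by
    intro a ha b hb c hc
    obtain ⟨p, hp, hpJ, hpb⟩ := hB b hb
    obtain ⟨q, hq, hqJ, hqc⟩ := hB c hc
    have hr : ∀ c ∈ J, a * c ∈ J ^ (m+1) := fun c hc => by
      rw [pow_succ]; exact Submodule.mul_mem_mul ha hc
    have hl : ∀ c ∈ J, c * a ∈ J ^ (m+1) := fun c hc => by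
      rw [pow_succ']; exact Submodule.mul_mem_mul hc ha
    have e1 : a * c * b = a * c * p := by
      have := hpb _ (hr c hc); rwa [mul_sub, sub_eq_zero] at this
    have e2 : c * a * b = c * a * p := by
      have := hpb _ (hl c hc); rwa [mul_sub, sub_eq_zero] at this
    have e3 : a * p * c = a * p * q := by
      have := hqc _ (hr p hpJ); rwa [mul_sub, sub_eq_zero] at this
    have e4 : p * a * c = p * a * q := by
      have := hqc _ (hl p hpJ); rwa [mul_sub, sub_eq_zero] at this
    calc s (a * b * c) = s (c * a * b) := by rw [hs, mul_assoc]
      _ = s (a * p * c) := by rw [e2, mul_assoc, hs]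
      _ = s (a * q * p) := by rw [e3, mul_assoc, hcomm p hp q hq, mul_assoc]
      _ = s (p * a * q) := by rw [hs, mul_assoc]
      _ = s (a * c * p) := by rw [← e4, mul_assoc, hs]
      _ = s (a * c * b) := by rw [e1]
  have key2 : ∀ a ∈ J ^ m, ∀ b c : C, s (a * b * c) = s (a * c * b) := by
    intro a ha b c
    obtain ⟨r, hr⟩ := hdec b
    obtain ⟨t, ht⟩ := hdec c
    have h := key a ha _ hr _ ht
    simp only [Algebra.algebraMap_eq_smul_one, mul_sub, sub_mul, map_sub, mul_smul_comm,
      smul_mul_assoc, mul_one, map_smul] at h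
    linear_combination h
  intro a ha
  rw [Subalgebra.mem_center_iff]
  intro b
  have hz : Ideal.span {b * a - a * b} = ⊥ := by
    apply hI
    intro z hz
    obtain ⟨c, rfl⟩ := Ideal.mem_span_singleton'.1 hz
    rw [mul_sub, map_sub, sub_eq_zero, ← mul_assoc, hs, ← mul_assoc, key2 a ha c b, hs c]
  rw [Ideal.span_singleton_eq_bot, sub_eq_zero] at hz
  exact hz
end
end

section
/- Let k be a field of characteristic 3 and B = k⟨X,Y⟩/⟨X³, Y³, XY+YX⟩ with x, y the images of X, Y. Then the center Z(B) has k-basis {1, x², y², xy², yx², x²y²}, and in particular dim_k Z(B) = 6. -/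
open Module FreeAlgebra

noncomputable section

/-- The relations X³ = 0, Y³ = 0, XY + YX = 0 in the free algebra on two
generators. -/
def Brel (k : Type) [Field k] :
    FreeAlgebra k (Fin 2) → FreeAlgebra k (Fin 2) → Prop := fun a b =>
  b = 0 ∧ (a = ι k (0 : Fin 2) ^ 3 ∨ a = ι k (1 : Fin 2) ^ 3 ∨
    a = ι k (0 : Fin 2) * ι k (1 : Fin 2) + ι k (1 : Fin 2) * ι k (0 : Fin 2))

/-- The quantum complete intersection B = k⟨X,Y⟩/⟨X³, Y³, XY+YX⟩. -/
abbrev Balg (k : Type) [Field k] := RingQuot (Brel k)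

/-- The image of X in B. -/
def xB (k : Type) [Field k] : Balg k := RingQuot.mkAlgHom k (Brel k) (ι k 0)

/-- The image of Y in B. -/
def yB (k : Type) [Field k] : Balg k := RingQuot.mkAlgHom k (Brel k) (ι k 1)


theorem xB_cube (k : Type) [Field k] : xB k ^ 3 = 0 := by
  have := RingQuot.mkAlgHom_rel k (s := Brel k) (x := ι k (0 : Fin 2) ^ 3) (y := 0)
    ⟨rfl, Or.inl rfl⟩
  simpa [xB] using this

theorem yB_cube (k : Type) [Field k] : yB k ^ 3 = 0 := by
  have := RingQuot.mkAlgHom_rel k (s := Brel k) (x := ι k (1 : Fin 2) ^ 3) (y := 0)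
    ⟨rfl, Or.inr (Or.inl rfl)⟩
  simpa [yB] using this

theorem eq_smul_aux {k M : Type} [Field k] [AddCommMonoid M] [Module k M] (a b : M)
    (h : a + b = 0) : b = (-1 : k) • a := by
  have h1 : (-1 : k) • a + a = 0 := by
    have h2 : (-1 : k) • a + (1 : k) • a = 0 := by
      rw [← add_smul, neg_add_cancel, zero_smul]
    rwa [one_smul] at h2
  calc b = ((-1 : k) • a + a) + b := by rw [h1, zero_add]
    _ = (-1 : k) • a + (a + b) := by rw [add_assoc]
    _ = _ := by rw [h, add_zero]

theorem yB_mul_xB (k : Type) [Field k] : yB k * xB k = (-1 : k) • (xB k * yB k) := by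
  have := RingQuot.mkAlgHom_rel k (s := Brel k)
    (x := ι k (0 : Fin 2) * ι k (1 : Fin 2) + ι k (1 : Fin 2) * ι k (0 : Fin 2)) (y := 0)
    ⟨rfl, Or.inr (Or.inr rfl)⟩
  simp only [map_add, map_mul, map_zero] at this
  exact eq_smul_aux _ _ this

theorem B_ind (k : Type) [Field k] (P : Balg k → Prop)
    (hc : ∀ r, P (algebraMap k _ r)) (hx : P (xB k)) (hy : P (yB k))
    (hm : ∀ a b, P a → P b → P (a * b)) (ha : ∀ a b, P a → P b → P (a + b)) (b : Balg k) :
    P b := by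
  obtain ⟨a, rfl⟩ := RingQuot.mkAlgHom_surjective k (Brel k) b
  induction a using FreeAlgebra.induction with
  | grade0 r => simpa using hc r
  | grade1 i =>
    fin_cases i
    · exact hx
    · exact hy
  | mul a b h1 h2 => rw [map_mul]; exact hm _ _ h1 h2
  | add a b h1 h2 => rw [map_add]; exact ha _ _ h1 h2

/-- left multiplication by x in coordinates (index 3a+b for x^a y^b) -/
def opX (k : Type) [Field k] : Module.End k (Fin 9 → k) where
  toFun v := ![0, 0, 0, v 0, v 1, v 2, v 3, v 4, v 5]
  map_add' u v := by ext i; fin_cases i <;> simp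
  map_smul' r v := by ext i; fin_cases i <;> simp

/-- left multiplication by y in coordinates -/
def opY (k : Type) [Field k] : Module.End k (Fin 9 → k) where
  toFun v := ![0, v 0, v 1, 0, -v 3, -v 4, 0, v 6, v 7]
  map_add' u v := by ext i; fin_cases i <;> simp [add_comm]
  map_smul' r v := by ext i; fin_cases i <;> simp

theorem opX_apply (k : Type) [Field k] (v : Fin 9 → k) :
    opX k v = ![0, 0, 0, v 0, v 1, v 2, v 3, v 4, v 5] := rfl

theorem opY_apply (k : Type) [Field k] (v : Fin 9 → k) :
    opY k v = ![0, v 0, v 1, 0, -v 3, -v 4, 0, v 6, v 7] := rfl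

/-- the regular representation -/
def rho (k : Type) [Field k] : Balg k →ₐ[k] Module.End k (Fin 9 → k) :=
  RingQuot.liftAlgHom k ⟨FreeAlgebra.lift k ![opX k, opY k], by
    rintro a b ⟨rfl, rfl | rfl | rfl⟩
    · ext v i
      fin_cases i <;> simp [pow_succ, opX_apply, Pi.single_apply]
    · ext v i
      fin_cases i <;> simp [pow_succ, opY_apply, Pi.single_apply]
    · ext v i
      fin_cases i <;> simp [opX_apply, opY_apply, Pi.single_apply]⟩

theorem rho_x (k : Type) [Field k] : rho k (xB k) = opX k := by
  simp [rho, xB]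

theorem rho_y (k : Type) [Field k] : rho k (yB k) = opY k := by
  simp [rho, yB]

/-- the linear combination of monomials -/
def psi (k : Type) [Field k] (v : Fin 9 → k) : Balg k :=
  v 0 • 1 + v 1 • yB k + v 2 • yB k ^ 2 + v 3 • xB k + v 4 • (xB k * yB k)
    + v 5 • (xB k * yB k ^ 2) + v 6 • xB k ^ 2 + v 7 • (xB k ^ 2 * yB k)
    + v 8 • (xB k ^ 2 * yB k ^ 2)

theorem psi_add (k : Type) [Field k] (u v : Fin 9 → k) : psi k (u + v) = psi k u + psi k v := by
  simp only [psi, Pi.add_apply, add_smul]; abel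

theorem psi_smul (k : Type) [Field k] (r : k) (v : Fin 9 → k) :
    psi k (r • v) = r • psi k v := by
  simp only [psi, Pi.smul_apply, smul_add, smul_smul, smul_eq_mul]

theorem mul_facts (k : Type) [Field k] :
    (∀ a, yB k * (xB k * a) = (-1 : k) • (xB k * (yB k * a))) ∧
    (∀ a, xB k * (xB k * (xB k * a)) = 0) ∧ xB k * (xB k * xB k) = 0 ∧
    (∀ a, yB k * (yB k * (yB k * a)) = 0) ∧ yB k * (yB k * yB k) = 0 := by
  have hx := xB_cube k
  have hy := yB_cube k
  simp only [pow_succ, pow_zero, one_mul, mul_assoc] at hx hy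
  refine ⟨fun a => ?_, fun a => ?_, hx, fun a => ?_, hy⟩
  · rw [← mul_assoc, yB_mul_xB, smul_mul_assoc, mul_assoc]
  · rw [← mul_assoc, ← mul_assoc, mul_assoc (xB k), hx, zero_mul]
  · rw [← mul_assoc, ← mul_assoc, mul_assoc (yB k), hy, zero_mul]

theorem x_psi (k : Type) [Field k] (v : Fin 9 → k) : xB k * psi k v = psi k (opX k v) := by
  obtain ⟨h1, h2, h3, h4, h5⟩ := mul_facts k
  simp [psi, opX_apply, mul_add, mul_assoc, pow_two, h1, h2, h3, h4, h5, yB_mul_xB, smul_smul, -neg_smul]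

theorem y_psi (k : Type) [Field k] (v : Fin 9 → k) : yB k * psi k v = psi k (opY k v) := by
  obtain ⟨h1, h2, h3, h4, h5⟩ := mul_facts k
  simp [psi, opY_apply, mul_add, mul_assoc, pow_two, h1, h2, h3, h4, h5, yB_mul_xB, smul_smul, -neg_smul]

theorem psi_x (k : Type) [Field k] (v : Fin 9 → k) : psi k v * xB k =
    psi k ![0, 0, 0, v 0, -v 1, v 2, v 3, -v 4, v 5] := by
  obtain ⟨h1, h2, h3, h4, h5⟩ := mul_facts k
  simp [psi, add_mul, mul_assoc, pow_two, h1, h2, h3, h4, h5, yB_mul_xB, smul_smul, -neg_smul]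

theorem psi_y (k : Type) [Field k] (v : Fin 9 → k) : psi k v * yB k =
    psi k ![0, v 0, v 1, 0, v 3, v 4, 0, v 6, v 7] := by
  obtain ⟨h1, h2, h3, h4, h5⟩ := mul_facts k
  simp [psi, add_mul, mul_assoc, pow_two, h1, h2, h3, h4, h5, yB_mul_xB, smul_smul, -neg_smul]

theorem psi_rho (k : Type) [Field k] (b : Balg k) : ∀ v, psi k (rho k b v) = b * psi k v := by
  induction b using B_ind with
  | hc r => intro v; rw [AlgHom.commutes, Module.algebraMap_end_apply, psi_smul, Algebra.smul_def]
  | hx => intro v; rw [rho_x, x_psi]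
  | hy => intro v; rw [rho_y, y_psi]
  | hm a b h1 h2 => intro v; rw [map_mul, Module.End.mul_apply, h1, h2, mul_assoc]
  | ha a b h1 h2 => intro v; rw [map_add, LinearMap.add_apply, psi_add, h1, h2, add_mul]

/-- the vector of 1 -/
def e0 (k : Type) [Field k] : Fin 9 → k := ![1, 0, 0, 0, 0, 0, 0, 0, 0]

theorem psi_surj (k : Type) [Field k] (b : Balg k) : ∃ v, psi k v = b :=
  ⟨rho k b (e0 k), by rw [psi_rho]; simp [psi, e0]⟩

theorem rho_psi (k : Type) [Field k] (v : Fin 9 → k) : rho k (psi k v) (e0 k) = v := by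
  ext i
  fin_cases i <;> simp [psi, rho_x, rho_y, opX_apply, opY_apply, pow_two, e0]

theorem psi_inj (k : Type) [Field k] : Function.Injective (psi k) :=
  Function.LeftInverse.injective (g := fun b => rho k b (e0 k)) (rho_psi k)

theorem mem_center_psi (k : Type) [Field k] [CharP k 3] (v : Fin 9 → k) :
    psi k v ∈ Subalgebra.center k (Balg k) ↔ v 1 = 0 ∧ v 3 = 0 ∧ v 4 = 0 := by
  have h2 : (2 : k) ≠ 0 := by
    intro h
    have := (CharP.cast_eq_zero_iff k 3 2).1 (by exact_mod_cast h)
    omega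
  have key : ∀ a : k, a = -a → a = 0 := by
    intro a ha
    have : (2 : k) * a = 0 := by linear_combination ha
    exact (mul_eq_zero.1 this).resolve_left h2
  rw [Subalgebra.mem_center_iff]
  constructor
  · intro h
    have hx := h (xB k)
    have hy := h (yB k)
    rw [x_psi, psi_x, opX_apply] at hx
    rw [y_psi, psi_y, opY_apply] at hy
    have hx := psi_inj k hx
    have hy := psi_inj k hy
    have a := congrFun hx 4
    have b := congrFun hx 7
    have c := congrFun hy 4
    simp at a b c
    exact ⟨key _ a, key _ c.symm, key _ b⟩
  · rintro ⟨h1, h3, h4⟩ b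
    induction b using B_ind with
    | hc r => exact Algebra.commutes _ _
    | hx => rw [x_psi, psi_x, opX_apply, h1, h4]; simp
    | hy => rw [y_psi, psi_y, opY_apply, h3, h4]; simp
    | hm a b h1 h2 => rw [mul_assoc, h2, ← mul_assoc, h1, mul_assoc]
    | ha a b h1 h2 => rw [add_mul, mul_add, h1, h2]

/-- coordinates of the center -/
def emb (k : Type) [Field k] (g : Fin 6 → k) : Fin 9 → k :=
  ![g 0, 0, g 2, 0, 0, g 3, g 1, g 4, g 5]

theorem center_sum (k : Type) [Field k] (g : Fin 6 → k) :
    psi k (emb k g) = ∑ i, g i • (![1, xB k ^ 2, yB k ^ 2, xB k * yB k ^ 2, yB k * xB k ^ 2,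
          xB k ^ 2 * yB k ^ 2] : Fin 6 → Balg k) i := by
  obtain ⟨h1, h2, h3, h4, h5⟩ := mul_facts k
  simp [psi, emb, Fin.sum_univ_succ, pow_two, mul_assoc, h1, yB_mul_xB, smul_smul, -neg_smul]
  abel

theorem center_mem (k : Type) [Field k] [CharP k 3] (i : Fin 6) :
    (![1, xB k ^ 2, yB k ^ 2, xB k * yB k ^ 2, yB k * xB k ^ 2,
          xB k ^ 2 * yB k ^ 2] : Fin 6 → Balg k) i ∈ Subalgebra.center k (Balg k) := by
  have h := center_sum k (Pi.single i 1)
  have h' : psi k (emb k (Pi.single i 1)) ∈ Subalgebra.center k (Balg k) := by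
    rw [mem_center_psi]; simp [emb]
  rw [h] at h'
  simpa [Pi.single_apply, ite_smul] using h'

/-- The center of B has basis {1, x², y², xy², yx², x²y²}; in particular it is
6-dimensional. -/
theorem stmt10 (k : Type) [Field k] [CharP k 3] :
    finrank k (Subalgebra.center k (Balg k)) = 6 ∧
      ∃ b : Basis (Fin 6) k (Subalgebra.center k (Balg k)), ∀ i, (b i : Balg k) =
        ![1, xB k ^ 2, yB k ^ 2, xB k * yB k ^ 2, yB k * xB k ^ 2,
          xB k ^ 2 * yB k ^ 2] i := by
  have hc : ∀ g : Fin 6 → k, ((∑ i, g i • (⟨_, center_mem k i⟩ :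
      Subalgebra.center k (Balg k)) : Subalgebra.center k (Balg k)) : Balg k)
      = psi k (emb k g) := by
    intro g
    rw [center_sum, AddSubmonoidClass.coe_finsetSum]
    rfl
  have hb : ∃ b : Basis (Fin 6) k (Subalgebra.center k (Balg k)), ∀ i, (b i : Balg k) =
        (![1, xB k ^ 2, yB k ^ 2, xB k * yB k ^ 2, yB k * xB k ^ 2,
          xB k ^ 2 * yB k ^ 2] : Fin 6 → Balg k) i := by
    refine ⟨Basis.mk (v := fun i => ⟨_, center_mem k i⟩) ?_ ?_, fun i => ?_⟩
    · rw [Fintype.linearIndependent_iffₛ]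
      intro g g' hg
      have hg := congrArg (fun z : Subalgebra.center k (Balg k) => (z : Balg k)) hg
      have h0 := psi_inj k ((hc g).symm.trans (hg.trans (hc g')))
      intro i
      fin_cases i
      · exact congrFun h0 0
      · exact congrFun h0 6
      · exact congrFun h0 2
      · exact congrFun h0 5
      · exact congrFun h0 7
      · exact congrFun h0 8
    · rintro ⟨z, hz⟩ -
      obtain ⟨v, rfl⟩ := psi_surj k z
      have hv := (mem_center_psi k v).1 hz
      have he : v = emb k ![v 0, v 6, v 2, v 5, v 7, v 8] := by
        ext i
        fin_cases i <;> simp [emb, hv]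
      rw [Submodule.mem_span_range_iff_exists_fun]
      refine ⟨![v 0, v 6, v 2, v 5, v 7, v 8], ?_⟩
      apply Subtype.ext
      exact (hc _).trans (congrArg (psi k) he.symm)
    · rw [Basis.mk_apply]
  obtain ⟨b, hb⟩ := hb
  exact ⟨by rw [Module.finrank_eq_card_basis b, Fintype.card_fin], b, hb⟩
end
end

section
/- Let A be a finite-dimensional local symmetric algebra over an algebraically closed field k of characteristic 3 with dim_k A = 9 and Z(A) ≅ Z(B) where B = k⟨X,Y⟩/⟨X³,Y³,XY+YX⟩. Then for all u, v ∈ J(A), uv + vu lies in Z(A) ∩ J(A)². -/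
open Module FreeAlgebra

noncomputable section

section core
variable {k : Type} [Field k] {A : Type} [Ring A] [Algebra k A]

theorem c_ml {P Q R : Submodule k A} (h : P ≤ Q) : P * R ≤ Q * R :=
  mul_le_mul' h le_rfl

theorem c_mr {P Q R : Submodule k A} (h : P ≤ Q) : R * P ≤ R * Q :=
  mul_le_mul' le_rfl h

theorem c_ext_one [FiniteDimensional k A] (U V : Submodule k A) (h : U ≤ V)
    (hd : finrank k V ≤ finrank k U + 1) :
    ∃ x ∈ V, V ≤ Submodule.span k {x} ⊔ U := by
  by_cases hUV : V ≤ U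
  · exact ⟨0, V.zero_mem, hUV.trans le_sup_right⟩
  · obtain ⟨x, hxV, hxU⟩ := Set.not_subset.mp hUV
    refine ⟨x, hxV, ?_⟩
    have hle : Submodule.span k {x} ⊔ U ≤ V := by
      refine sup_le ?_ h
      rw [Submodule.span_singleton_le_iff_mem]; exact hxV
    have hlt : U < Submodule.span k {x} ⊔ U := by
      refine lt_of_le_of_ne le_sup_right ?_
      intro he
      apply hxU
      have : x ∈ Submodule.span k {x} ⊔ U :=
        Submodule.mem_sup_left (Submodule.mem_span_singleton_self x)
      rw [← he] at this; exact this
    have := Submodule.finrank_lt_finrank_of_lt hlt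
    exact (Submodule.eq_of_le_of_finrank_le hle (by omega)).ge

theorem c_ext_two [FiniteDimensional k A] (U V : Submodule k A) (h : U ≤ V)
    (hd : finrank k V ≤ finrank k U + 2) :
    ∃ x ∈ V, ∃ y ∈ V, V ≤ Submodule.span k {x} ⊔ (Submodule.span k {y} ⊔ U) := by
  by_cases hUV : V ≤ U
  · exact ⟨0, V.zero_mem, 0, V.zero_mem, hUV.trans (le_sup_right.trans le_sup_right)⟩
  · obtain ⟨y, hyV, hyU⟩ := Set.not_subset.mp hUV
    have hle : Submodule.span k {y} ⊔ U ≤ V := by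
      refine sup_le ?_ h
      rw [Submodule.span_singleton_le_iff_mem]; exact hyV
    have hlt : U < Submodule.span k {y} ⊔ U := by
      refine lt_of_le_of_ne le_sup_right ?_
      intro he
      apply hyU
      have : y ∈ Submodule.span k {y} ⊔ U :=
        Submodule.mem_sup_left (Submodule.mem_span_singleton_self y)
      rw [← he] at this; exact this
    have := Submodule.finrank_lt_finrank_of_lt hlt
    obtain ⟨x, hx, hx'⟩ := c_ext_one _ _ hle (by omega)
    exact ⟨x, hx, y, hyV, hx'⟩

/-- Nakayama for a submodule `M` with cube zero. -/
theorem c_nak (M P : Submodule k A) (hM : M * M * M = ⊥) (hP : M * P ≤ P)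
    (h : ⊤ ≤ P ⊔ M * ⊤) : P = ⊤ := by
  have h1 : M * (⊤ : Submodule k A) ≤ P ⊔ M * M * ⊤ := by
    calc M * (⊤ : Submodule k A) ≤ M * (P ⊔ M * ⊤) := c_mr h
      _ = M * P ⊔ M * M * ⊤ := by rw [Submodule.mul_sup, mul_assoc]
      _ ≤ _ := sup_le_sup_right hP _
  have h2 : M * M * (⊤ : Submodule k A) ≤ P := by
    calc M * M * (⊤ : Submodule k A) = M * (M * ⊤) := mul_assoc _ _ _
      _ ≤ M * (P ⊔ M * M * ⊤) := c_mr h1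
      _ = M * P ⊔ M * M * M * ⊤ := by rw [Submodule.mul_sup, ← mul_assoc, ← mul_assoc]
      _ ≤ _ := by rw [hM, Submodule.bot_mul]; exact sup_le hP bot_le
  rw [eq_top_iff]
  exact h.trans (sup_le le_rfl (h1.trans (sup_le le_rfl h2)))

/-- if `J^m ≤ J^(m+1) ⊔ N` and `J` is nilpotent. -/
theorem c_nil_chain (J P : Submodule k A) (n m : ℕ) (hn : J ^ n = ⊥)
    (h : ∀ i, m ≤ i → J ^ i ≤ J ^ (i + 1) ⊔ P) : J ^ m ≤ P := by
  have key : ∀ d, J ^ m ≤ J ^ (m + d) ⊔ P := by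
    intro d
    induction d with
    | zero => exact le_sup_left
    | succ d ih =>
      exact ih.trans (sup_le (h (m + d) (by omega)) le_sup_right)
  refine (key n).trans (sup_le ?_ le_rfl)
  rw [pow_add, hn, Submodule.mul_bot]; exact bot_le

theorem c_comm (J M N : Submodule k A) (n : ℕ) (hn : J ^ n = ⊥)
    (htop : ∀ a : A, ∃ c : k, a - algebraMap k A c ∈ J)
    (hMc : ∀ z ∈ M, ∀ a, z * a = a * z)
    (hM3 : M * M * M = ⊥) (hN : N = M * ⊤) (hNl : ⊤ * N ≤ N)
    (x : A) (hxJ : x ∈ J) (hx : J ≤ Submodule.span k {x} ⊔ (J * J ⊔ N)) :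
    ∀ a b : A, a * b = b * a := by
  have hNr : N * ⊤ ≤ N := by
    rw [hN, mul_assoc]; exact c_mr le_top
  have step : ∀ m, J ^ (m + 1) ≤ Submodule.span k {x ^ (m + 1)} ⊔ (J ^ (m + 2) ⊔ N) := by
    intro m
    induction m with
    | zero => simpa [pow_two] using hx
    | succ m ih =>
      have hxm : Submodule.span k {x ^ (m + 1)} ≤ J ^ (m + 1) := by
        rw [Submodule.span_singleton_le_iff_mem]; exact Submodule.pow_mem_pow J hxJ _
      calc J ^ (m + 1 + 1) = J ^ (m + 1) * J := pow_succ _ _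
        _ ≤ (Submodule.span k {x ^ (m + 1)} ⊔ (J ^ (m + 2) ⊔ N)) * J :=
            c_ml ih
        _ = Submodule.span k {x ^ (m + 1)} * J ⊔ (J ^ (m + 2) * J ⊔ N * J) := by
            rw [Submodule.sup_mul, Submodule.sup_mul]
        _ ≤ _ := by
          refine sup_le ?_ (sup_le ?_ ?_)
          · refine (c_mr hx).trans ?_
            rw [Submodule.mul_sup, Submodule.mul_sup]
            refine sup_le ?_ (sup_le ?_ ?_)
            · rw [Submodule.span_mul_span, Set.singleton_mul_singleton, ← pow_succ]
              exact le_sup_left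
            · refine le_trans (c_ml hxm) ?_
              rw [← pow_two, ← pow_add]
              exact le_sup_left.trans le_sup_right
            · exact (c_ml le_top).trans
                (hNl.trans (le_sup_right.trans le_sup_right))
          · rw [← pow_succ]; exact le_sup_left.trans le_sup_right
          · exact (c_mr le_top).trans
                (hNr.trans (le_sup_right.trans le_sup_right))
  have gen : ∀ P : Submodule k A, (∀ m, x ^ m ∈ P) → M * P ≤ P → P = ⊤ := by
    intro P hP hMP
    refine c_nak M P hM3 hMP ?_
    have hJ : J ^ 1 ≤ P ⊔ N := by
      refine c_nil_chain J (P ⊔ N) n 1 hn ?_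
      intro i hi
      obtain ⟨m, rfl⟩ : ∃ m, i = m + 1 := ⟨i - 1, by omega⟩
      refine (step m).trans ?_
      refine sup_le ?_ (sup_le le_sup_left (le_sup_right.trans le_sup_right))
      rw [Submodule.span_singleton_le_iff_mem]
      exact Submodule.mem_sup_right (Submodule.mem_sup_left (hP _))
    rw [pow_one] at hJ
    intro a _
    obtain ⟨c, hc⟩ := htop a
    have h1 : algebraMap k A c ∈ P ⊔ N := by
      rw [Algebra.algebraMap_eq_smul_one]
      exact Submodule.mem_sup_left (P.smul_mem _ (by simpa using hP 0))
    rw [← hN]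
    have := (P ⊔ N).add_mem (hJ hc) h1
    simpa using this
  have hxc : ∀ a, x * a = a * x := by
    have := gen (Subalgebra.toSubmodule (Subalgebra.centralizer k {x})) ?_ ?_
    · intro a
      have ha : a ∈ Subalgebra.toSubmodule (Subalgebra.centralizer k {x}) := by
        rw [this]; trivial
      rw [Subalgebra.mem_toSubmodule, Subalgebra.mem_centralizer_iff] at ha
      exact ha x rfl
    · intro m
      rw [Subalgebra.mem_toSubmodule, Subalgebra.mem_centralizer_iff]
      rintro g rfl
      exact (Commute.self_pow g m).eq
    · rw [Submodule.mul_le]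
      intro z hz p hp
      rw [Subalgebra.mem_toSubmodule] at *
      refine Subalgebra.mul_mem _ ?_ hp
      rw [Subalgebra.mem_centralizer_iff]
      rintro g rfl
      exact (hMc z hz g).symm
  have := gen (Subalgebra.toSubmodule (Subalgebra.center k A)) ?_ ?_
  · intro a b
    have ha : a ∈ Subalgebra.toSubmodule (Subalgebra.center k A) := by
      rw [this]; trivial
    rw [Subalgebra.mem_toSubmodule, Subalgebra.mem_center_iff] at ha
    exact (ha b).symm
  · intro m
    rw [Subalgebra.mem_toSubmodule]
    refine Subalgebra.pow_mem _ ?_ m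
    rw [Subalgebra.mem_center_iff]
    exact fun b => (hxc b).symm
  · rw [Submodule.mul_le]
    intro z hz p hp
    rw [Subalgebra.mem_toSubmodule] at *
    refine Subalgebra.mul_mem _ ?_ hp
    rw [Subalgebra.mem_center_iff]
    exact fun b => (hMc z hz b).symm

theorem c_beta {V : Type} [AddCommGroup V] [Module k V] (α β γ δ : k) (hγ : γ = β - 1)
    (p q r t : V)
    (h1 : β • p = α • t) (h2 : α • p = α • r) (h3 : γ • p = β • r) (h4 : δ • p = β • t)
    (h5 : α • q = γ • r) (h6 : β • q = γ • t) (h7 : γ • q = δ • r) (h8 : δ • q = δ • t) :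
    p = 0 ∧ q = 0 := by
  have cancel : ∀ (c : k) (v : V), c ≠ 0 → c • v = 0 → v = 0 := by
    intro c v hc h; exact (smul_eq_zero.mp h).resolve_left hc
  by_cases hα : α = 0
  · by_cases hδ : δ = 0
    · subst hα hδ
      simp only [zero_smul] at *
      by_cases hβ : β = 0
      · subst hβ
        have : γ ≠ 0 := by rw [hγ]; simp
        rw [zero_smul] at h3
        exact ⟨cancel _ _ this h3, cancel _ _ this h7⟩
      · refine ⟨cancel _ _ hβ h1, ?_⟩
        have ht : t = 0 := cancel _ _ hβ h4.symm
        rw [ht, smul_zero] at h6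
        exact cancel _ _ hβ h6
    · have hq : q = t := by
        have : δ • (q - t) = 0 := by rw [smul_sub, h8, sub_self]
        exact sub_eq_zero.mp (cancel _ _ hδ this)
      have hq0 : q = 0 := by
        rw [← hq, hγ, sub_smul, one_smul] at h6
        have := sub_eq_zero.mpr h6
        simpa using this
      refine ⟨?_, hq0⟩
      rw [← hq, hq0, smul_zero] at h4
      exact cancel _ _ hδ h4
  · have hp : p = r := by
      have : α • (p - r) = 0 := by rw [smul_sub, h2, sub_self]
      exact sub_eq_zero.mp (cancel _ _ hα this)
    have hp0 : p = 0 := by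
      rw [← hp, hγ, sub_smul, one_smul] at h3
      have := sub_eq_zero.mpr h3
      simpa using this
    refine ⟨hp0, ?_⟩
    rw [← hp, hp0, smul_zero] at h5
    exact cancel _ _ hα h5

end core

section core
variable {k : Type} [Field k] {A : Type} [Ring A] [Algebra k A]

theorem c_dec (J Q : Submodule k A) (x y : A)
    (hJ : J ≤ Submodule.span k {x} ⊔ (Submodule.span k {y} ⊔ Q)) (j : A) (hj : j ∈ J) :
    ∃ α β : k, ∃ q ∈ Q, j = α • x + β • y + q := by
  obtain ⟨a, ha, b, hb, rfl⟩ := Submodule.mem_sup.mp (hJ hj)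
  obtain ⟨c, hc, q, hq, rfl⟩ := Submodule.mem_sup.mp hb
  obtain ⟨α, rfl⟩ := Submodule.mem_span_singleton.mp ha
  obtain ⟨β, rfl⟩ := Submodule.mem_span_singleton.mp hc
  exact ⟨α, β, q, hq, (add_assoc _ _ _).symm⟩

theorem c_dec_one (Q : Submodule k A) (x j : A)
    (hj : j ∈ Submodule.span k {x} ⊔ Q) :
    ∃ α : k, j - α • x ∈ Q := by
  obtain ⟨a, ha, b, hb, rfl⟩ := Submodule.mem_sup.mp hj
  obtain ⟨α, rfl⟩ := Submodule.mem_span_singleton.mp ha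
  exact ⟨α, by simpa using hb⟩

/-- The commutator space. -/
def cK (k : Type) [Field k] (A : Type) [Ring A] [Algebra k A] : Submodule k A :=
  Submodule.span k {c | ∃ a b : A, c = a * b - b * a}

theorem c_two (J N : Submodule k A) (n : ℕ) (hn : J ^ n = ⊥)
    (hNl : ∀ a : A, ∀ b ∈ N, a * b ∈ N) (hNr : ∀ a : A, ∀ b ∈ N, b * a ∈ N)
    (htop : ∀ a : A, ∃ c : k, a - algebraMap k A c ∈ J)
    (x y : A) (hx : x ∈ J) (hy : y ∈ J)
    (hJ : J ≤ Submodule.span k {x} ⊔ (Submodule.span k {y} ⊔ (J ^ 2 ⊔ N)))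
    (hJ2 : J ^ 2 ≤ cK k A ⊔ N) :
    J ^ 3 ≤ N ∧ J ^ 2 ≤ Submodule.span k {x * y - y * x} ⊔ N := by
  have hl : ∀ m, ∀ j ∈ J, ∀ q ∈ J ^ m ⊔ N, j * q ∈ J ^ (m + 1) ⊔ N := by
    intro m j hj q hq
    obtain ⟨a, ha, b, hb, rfl⟩ := Submodule.mem_sup.mp hq
    rw [mul_add]
    refine Submodule.add_mem_sup ?_ (hNl _ _ hb)
    rw [pow_succ']; exact Submodule.mul_mem_mul hj ha
  have hr : ∀ m, ∀ j ∈ J, ∀ q ∈ J ^ m ⊔ N, q * j ∈ J ^ (m + 1) ⊔ N := by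
    intro m j hj q hq
    obtain ⟨a, ha, b, hb, rfl⟩ := Submodule.mem_sup.mp hq
    rw [add_mul]
    refine Submodule.add_mem_sup ?_ (hNr _ _ hb)
    rw [pow_succ]; exact Submodule.mul_mem_mul ha hj
  set w := x * y - y * x with hw
  have hK : cK k A ≤ Submodule.span k {w} ⊔ (J ^ 3 ⊔ N) := by
    rw [cK, Submodule.span_le]
    rintro _ ⟨a, b, rfl⟩
    obtain ⟨c, hc⟩ := htop a
    obtain ⟨c', hc'⟩ := htop b
    obtain ⟨α, β, q, hq, h1⟩ := c_dec J _ x y hJ _ hc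
    obtain ⟨α', β', q', hq', h2⟩ := c_dec J _ x y hJ _ hc'
    have e1 : a * b - b * a = (a - algebraMap k A c) * (b - algebraMap k A c')
        - (b - algebraMap k A c') * (a - algebraMap k A c) := by
      have := Algebra.commutes c b
      have := Algebra.commutes c' a
      have h3 := Algebra.commutes c (algebraMap k A c')
      simp only [mul_sub, sub_mul]
      grind
    have hp : α • x + β • y ∈ J := J.add_mem (J.smul_mem _ hx) (J.smul_mem _ hy)
    have hp' : α' • x + β' • y ∈ J := J.add_mem (J.smul_mem _ hx) (J.smul_mem _ hy)
    have e2 : a * b - b * a = (α * β' - β * α') • w +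
        (((α • x + β • y) * q' + q * (b - algebraMap k A c'))
          - ((α' • x + β' • y) * q + q' * (a - algebraMap k A c))) := by
      rw [e1, h1, h2, hw]
      simp only [mul_add, add_mul, smul_mul_smul_comm, smul_sub]
      module
    rw [e2]
    refine Submodule.add_mem_sup (Submodule.smul_mem _ _ (Submodule.mem_span_singleton_self w)) ?_
    exact sub_mem (add_mem (hl 2 _ hp _ hq') (hr 2 _ hc' _ hq))
      (add_mem (hl 2 _ hp' _ hq) (hr 2 _ hc _ hq'))
  have hJ2' : J ^ 2 ≤ Submodule.span k {w} ⊔ (J ^ 3 ⊔ N) :=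
    hJ2.trans (sup_le hK (le_sup_right.trans le_sup_right))
  have hw2 : w ∈ J ^ 2 := by
    rw [pow_two]
    exact sub_mem (Submodule.mul_mem_mul hx hy) (Submodule.mul_mem_mul hy hx)
  have hmul : ∀ a ∈ J, ∀ b ∈ J, ∃ α : k, a * b - α • w ∈ J ^ 3 ⊔ N := by
    intro a ha b hb
    refine c_dec_one _ w _ (hJ2' ?_)
    rw [pow_two]; exact Submodule.mul_mem_mul ha hb
  -- reduce to the case that x*w and y*w lie in J^4 + N
  have main : x * w ∈ J ^ 4 ⊔ N ∧ y * w ∈ J ^ 4 ⊔ N := by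
    by_cases hw3 : w ∈ J ^ 3 ⊔ N
    · exact ⟨hl 3 _ hx _ hw3, hl 3 _ hy _ hw3⟩
    obtain ⟨α, hα⟩ := hmul x hx x hx
    obtain ⟨β, hβ⟩ := hmul x hx y hy
    obtain ⟨δ, hδ⟩ := hmul y hy y hy
    have hγ : y * x - (β - 1) • w ∈ J ^ 3 ⊔ N := by
      have : y * x - (β - 1) • w = x * y - β • w := by
        rw [hw]; module
      rw [this]; exact hβ
    have assoc : ∀ a ∈ J, ∀ b ∈ J, ∀ c ∈ J, ∀ μ ν : k, a * b - μ • w ∈ J ^ 3 ⊔ N →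
        b * c - ν • w ∈ J ^ 3 ⊔ N →
        ν • (J ^ 4 ⊔ N).mkQ (a * w) = μ • (J ^ 4 ⊔ N).mkQ (w * c) := by
      intro a ha b hb c hc μ ν h1 h2
      rw [← map_smul, ← map_smul, ← sub_eq_zero, ← map_sub, Submodule.mkQ_apply,
        Submodule.Quotient.mk_eq_zero]
      have h3 := hr 3 _ hc _ h1
      have h4 := hl 3 _ ha _ h2
      have h5 := sub_mem h3 h4
      convert h5 using 1
      simp only [sub_mul, mul_sub, smul_mul_assoc, mul_smul_comm, mul_assoc]
      abel
    have := c_beta α β (β - 1) δ rfl ((J ^ 4 ⊔ N).mkQ (x * w)) ((J ^ 4 ⊔ N).mkQ (y * w))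
      ((J ^ 4 ⊔ N).mkQ (w * x)) ((J ^ 4 ⊔ N).mkQ (w * y))
      (assoc x hx x hx y hy _ _ hα hβ) (assoc x hx x hx x hx _ _ hα hα)
      (assoc x hx y hy x hx _ _ hβ hγ) (assoc x hx y hy y hy _ _ hβ hδ)
      (assoc y hy x hx x hx _ _ hγ hα) (assoc y hy x hx y hy _ _ hγ hβ)
      (assoc y hy y hy x hx _ _ hδ hγ) (assoc y hy y hy y hy _ _ hδ hδ)
    simpa [Submodule.Quotient.mk_eq_zero] using this
  have hJ3 : J ^ 3 ≤ J ^ 4 ⊔ N := by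
    rw [pow_succ' J 2, Submodule.mul_le]
    intro j hj a ha
    obtain ⟨c, hc⟩ := c_dec_one _ _ _ (hJ2' ha)
    obtain ⟨α, β, q, hq, rfl⟩ := c_dec J _ x y hJ _ hj
    have hqw : q * w ∈ J ^ 4 ⊔ N := by
      obtain ⟨a, ha, b, hb, rfl⟩ := Submodule.mem_sup.mp hq
      rw [add_mul]
      refine Submodule.add_mem_sup ?_ (hNr _ _ hb)
      rw [show 4 = 2 + 2 from rfl, pow_add]; exact Submodule.mul_mem_mul ha hw2
    have h1 := hl 3 _ hj _ hc
    have h2 : (α • x + β • y + q) * (a - c • w) + c • (α • (x * w) + β • (y * w) + q * w) ∈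
        J ^ 4 ⊔ N :=
      add_mem h1 (Submodule.smul_mem _ _ (add_mem (add_mem (Submodule.smul_mem _ _ main.1)
        (Submodule.smul_mem _ _ main.2)) hqw))
    convert h2 using 1
    simp only [mul_sub, add_mul, smul_add, mul_smul_comm, smul_mul_assoc]
    abel
  have hJ3N : J ^ 3 ≤ N := by
    refine c_nil_chain J N n 3 hn ?_
    intro i hi
    obtain ⟨d, rfl⟩ : ∃ d, i = d + 3 := ⟨i - 3, by omega⟩
    calc J ^ (d + 3) = J ^ d * J ^ 3 := pow_add _ _ _
      _ ≤ J ^ d * (J ^ 4 ⊔ N) := c_mr hJ3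
      _ = J ^ (d + 4) ⊔ J ^ d * N := by rw [Submodule.mul_sup, pow_add]
      _ ≤ _ := sup_le_sup_left (Submodule.mul_le.mpr fun a _ b hb => hNl a b hb) _
  exact ⟨hJ3N, hJ2'.trans (sup_le le_sup_left ((sup_le hJ3N le_rfl).trans le_sup_right))⟩

end core

section core
variable {k : Type} [Field k] {A : Type} [Ring A] [Algebra k A]

theorem c_core [FiniteDimensional k A] (J M Z : Submodule k A) (n : ℕ) (hn : J ^ n = ⊥)
    (hJl : ∀ a : A, ∀ b ∈ J, a * b ∈ J) (hJr : ∀ a : A, ∀ b ∈ J, b * a ∈ J)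
    (htop : ∀ a : A, ∃ c : k, a - algebraMap k A c ∈ J) (h1J : (1 : A) ∉ J)
    (hMJ : M ≤ J) (hZ : Z = Subalgebra.toSubmodule (Subalgebra.center k A))
    (hMZ : M ≤ Z) (hZM : ∀ z ∈ Z, ∃ c : k, z - algebraMap k A c ∈ M)
    (hM3 : M * M * M = ⊥) (t : A) (hM2 : M * M ≤ Submodule.span k {t})
    (hdim : finrank k A = 9) (hZdim : finrank k Z = 6) (hKdim : finrank k (cK k A) = 3)
    (hUdim : 6 ≤ finrank k (cK k A ⊔ M * ⊤ : Submodule k A)) :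
    ∀ u ∈ J, u * u ∈ Z := by
  have memZ : ∀ z, z ∈ Z ↔ ∀ a, a * z = z * a := by
    intro z; rw [hZ, Subalgebra.mem_toSubmodule, Subalgebra.mem_center_iff]
  have hMc : ∀ z ∈ M, ∀ a, z * a = a * z := fun z hz a => ((memZ z).mp (hMZ hz) a).symm
  obtain ⟨N, hN⟩ : ∃ N : Submodule k A, N = M * ⊤ := ⟨_, rfl⟩
  rw [← hN] at hUdim
  have hNr' : N * ⊤ ≤ N := by
    rw [hN, mul_assoc]; exact c_mr le_top
  have hMtop : ⊤ * M ≤ M * ⊤ := by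
    rw [Submodule.mul_le]
    intro a _ z hz
    rw [← hMc z hz a]; exact Submodule.mul_mem_mul hz trivial
  have hNl' : ⊤ * N ≤ N := by
    rw [hN, ← mul_assoc]
    refine (c_ml hMtop).trans ?_
    rw [mul_assoc]; exact c_mr le_top
  have hNl : ∀ a : A, ∀ b ∈ N, a * b ∈ N := fun a b hb =>
    hNl' (Submodule.mul_mem_mul trivial hb)
  have hNr : ∀ a : A, ∀ b ∈ N, b * a ∈ N := fun a b hb =>
    hNr' (Submodule.mul_mem_mul hb trivial)
  have hMN : M ≤ N := by
    intro z hz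
    rw [hN, ← mul_one z]; exact Submodule.mul_mem_mul hz trivial
  have hNJ : N ≤ J := by
    rw [hN, Submodule.mul_le]
    exact fun z hz a _ => hJr a z (hMJ hz)
  have hZJ : ∀ z ∈ Z, z ∈ J → z ∈ M := by
    intro z hz hzJ
    obtain ⟨c, hc⟩ := hZM z hz
    have h2 : algebraMap k A c ∈ J := by
      have := sub_mem hzJ (hMJ hc)
      simpa using this
    have hc0 : c = 0 := by
      by_contra hc0
      apply h1J
      rw [Algebra.algebraMap_eq_smul_one] at h2
      have := J.smul_mem c⁻¹ h2
      rwa [smul_smul, inv_mul_cancel₀ hc0, one_smul] at this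
    simpa [hc0] using hc
  have hJJ : J ^ 2 ≤ J := by
    rw [pow_two, Submodule.mul_le]; exact fun a _ b hb => hJl a b hb
  -- the algebra is not generated by one element over its center
  have nocomm : ∀ x ∈ J, ¬ J ≤ Submodule.span k {x} ⊔ (J ^ 2 ⊔ N) := by
    intro x hx hxJ
    rw [pow_two] at hxJ
    have hc := c_comm J M N n hn htop hMc hM3 hN hNl' x hx hxJ
    have : Z = ⊤ := by
      rw [eq_top_iff]
      exact fun z _ => (memZ z).mpr fun a => hc a z
    rw [this, finrank_top, hdim] at hZdim
    omega
  have hKJ : cK k A ≤ J ^ 2 := by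
    rw [cK, Submodule.span_le]
    rintro _ ⟨a, b, rfl⟩
    obtain ⟨c, hc⟩ := htop a
    obtain ⟨c', hc'⟩ := htop b
    have e1 : a * b - b * a = (a - algebraMap k A c) * (b - algebraMap k A c')
        - (b - algebraMap k A c') * (a - algebraMap k A c) := by
      have := Algebra.commutes c b
      have := Algebra.commutes c' a
      have h3 := Algebra.commutes c (algebraMap k A c')
      simp only [mul_sub, sub_mul]
      grind
    rw [e1, pow_two]
    exact sub_mem (Submodule.mul_mem_mul hc hc') (Submodule.mul_mem_mul hc' hc)
  have hJfin : finrank k J ≤ 8 := by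
    have : J < ⊤ := lt_of_le_of_ne le_top (fun h => h1J (h ▸ trivial))
    have := Submodule.finrank_lt_finrank_of_lt this
    rw [finrank_top, hdim] at this
    omega
  have hJ2U : J ^ 2 ≤ cK k A ⊔ N := by
    by_contra hcon
    have hlt : cK k A ⊔ N < J ^ 2 ⊔ N := by
      refine lt_of_le_of_ne (sup_le_sup_right hKJ _) ?_
      intro he
      exact hcon (he ▸ le_sup_left)
    have := Submodule.finrank_lt_finrank_of_lt hlt
    obtain ⟨x, hx, hx'⟩ := c_ext_one (J ^ 2 ⊔ N) J (sup_le hJJ hNJ) (by omega)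
    exact nocomm x hx hx'
  obtain ⟨x, hx, y, hy, hxy⟩ := c_ext_two (cK k A ⊔ N) J (sup_le (hKJ.trans hJJ) hNJ) (by omega)
  have hxy2 : J ≤ Submodule.span k {x} ⊔ (Submodule.span k {y} ⊔ (J ^ 2 ⊔ N)) :=
    hxy.trans (sup_le_sup_left (sup_le_sup_left (sup_le_sup_right hKJ _) _) _)
  obtain ⟨hJ3, hJ2⟩ := c_two J N n hn hNl hNr htop x y hx hy hxy2 hJ2U
  obtain ⟨w, hw⟩ : ∃ w, w = x * y - y * x := ⟨_, rfl⟩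
  rw [← hw] at hJ2
  have hwJ2 : w ∈ J ^ 2 := by
    rw [hw, pow_two]
    exact sub_mem (Submodule.mul_mem_mul hx hy) (Submodule.mul_mem_mul hy hx)
  have hwJ : w ∈ J := hJJ hwJ2
  have hdecJ : ∀ j ∈ J, ∃ α β γ : k, ∃ m ∈ N, j = α • x + β • y + γ • w + m := by
    intro j hj
    obtain ⟨α, β, q, hq, rfl⟩ := c_dec J _ x y hxy2 j hj
    have hq2 : q ∈ Submodule.span k {w} ⊔ N := (sup_le hJ2 le_sup_right) hq
    obtain ⟨γ, hγ⟩ := c_dec_one _ _ _ hq2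
    exact ⟨α, β, γ, _, hγ, by abel⟩
  have hw2 : w * w ∈ N := by
    apply hJ3
    have : J ^ 3 = J ^ 2 * J := pow_succ _ _
    rw [this]; exact Submodule.mul_mem_mul hwJ2 hwJ
  have hone : (1 : A) ∈ Z := (memZ 1).mpr (by simp)
  have halg : ∀ c : k, algebraMap k A c ∈ Z := by
    intro c; rw [Algebra.algebraMap_eq_smul_one]; exact Z.smul_mem _ hone
  by_cases hNZ : N ≤ Z
  · -- case I
    have hK3 : cK k A ≤ Submodule.span k (Set.range ![w, x * w - w * x, y * w - w * y]) := by
      rw [cK, Submodule.span_le]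
      rintro _ ⟨a, b, rfl⟩
      obtain ⟨c, hc⟩ := htop a
      obtain ⟨c', hc'⟩ := htop b
      obtain ⟨α, β, γ, m, hm, h1⟩ := hdecJ _ hc
      obtain ⟨α', β', γ', m', hm', h2⟩ := hdecJ _ hc'
      have hz : m + algebraMap k A c ∈ Z := add_mem (hNZ hm) (halg c)
      have hz' : m' + algebraMap k A c' ∈ Z := add_mem (hNZ hm') (halg c')
      obtain ⟨z, hzz⟩ : ∃ z, z = m + algebraMap k A c := ⟨_, rfl⟩
      obtain ⟨z', hzz'⟩ : ∃ z, z = m' + algebraMap k A c' := ⟨_, rfl⟩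
      rw [← hzz] at hz
      rw [← hzz'] at hz'
      have ea : a = α • x + β • y + γ • w + z := by
        rw [hzz, ← add_assoc, ← h1]; abel
      have eb : b = α' • x + β' • y + γ' • w + z' := by
        rw [hzz', ← add_assoc, ← h2]; abel
      have e : a * b - b * a = (α * β' - β * α') • w + (α * γ' - γ * α') • (x * w - w * x)
          + (β * γ' - γ * β') • (y * w - w * y) := by
        have e1 : a * b - b * a = (α • x + β • y + γ • w) * (α' • x + β' • y + γ' • w)
            - (α' • x + β' • y + γ' • w) * (α • x + β • y + γ • w) := by
          have c1 := (memZ z).mp hz (α' • x + β' • y + γ' • w)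
          have c2 := (memZ z').mp hz' (α • x + β • y + γ • w)
          have c3 := (memZ z').mp hz' z
          rw [ea, eb]
          generalize α • x + β • y + γ • w = p at *
          generalize α' • x + β' • y + γ' • w = p' at *
          rw [add_mul, mul_add, mul_add, add_mul, mul_add, mul_add, c1, c2, c3]
          abel
        rw [e1]
        have hw' : (α * β' - β * α') • w = (α * β' - β * α') • (x * y - y * x) := by rw [hw]
        rw [hw']
        simp only [mul_add, add_mul, smul_mul_smul_comm]
        module
      rw [e]
      refine add_mem (add_mem ?_ ?_) ?_
      · exact Submodule.smul_mem _ _ (Submodule.subset_span ⟨0, rfl⟩)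
      · exact Submodule.smul_mem _ _ (Submodule.subset_span ⟨1, rfl⟩)
      · exact Submodule.smul_mem _ _ (Submodule.subset_span ⟨2, rfl⟩)
    have hli : LinearIndependent k ![w, x * w - w * x, y * w - w * y] := by
      rw [linearIndependent_iff_card_le_finrank_span]
      have := Submodule.finrank_mono hK3
      rw [hKdim] at this
      simpa [Set.finrank] using this
    intro u hu
    have huu : u * u ∈ J ^ 2 := by rw [pow_two]; exact Submodule.mul_mem_mul hu hu
    obtain ⟨c, hc⟩ := c_dec_one _ _ _ (hJ2 huu)
    obtain ⟨α, β, γ, m, hm, h1⟩ := hdecJ _ hu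
    by_cases hc0 : c = 0
    · apply hNZ; simpa [hc0] using hc
    have hcomm := (memZ _).mp (hNZ hc) u
    have h3 : u * w - w * u = 0 := by
      have : c • (u * w - w * u) = 0 := by
        simp only [mul_sub, sub_mul, mul_smul_comm, smul_mul_assoc, mul_assoc] at hcomm
        rw [smul_sub]
        have := sub_right_injective hcomm
        rw [this, sub_self]
      exact (smul_eq_zero.mp this).resolve_left hc0
    have h4 : α • (x * w - w * x) + β • (y * w - w * y) = 0 := by
      rw [← h3, h1]
      have := (memZ _).mp (hNZ hm) w
      simp only [mul_add, add_mul, smul_mul_assoc, mul_smul_comm, this]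
      module
    have h5 := Fintype.linearIndependent_iff.mp hli ![0, α, β] (by
      simpa [Fin.sum_univ_three] using h4)
    have hα : α = 0 := h5 1
    have hβ : β = 0 := h5 2
    apply hNZ
    have e : u * u = (γ * γ) • (w * w) + γ • (w * m) + γ • (m * w) + m * m := by
      rw [h1, hα, hβ]
      simp only [mul_add, add_mul, smul_mul_assoc, mul_smul_comm, zero_smul, zero_add]
      module
    rw [e]
    exact add_mem (add_mem (add_mem (N.smul_mem _ hw2) (N.smul_mem _ (hNl _ _ hm)))
      (N.smul_mem _ (hNr _ _ hm))) (hNl _ _ hm)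
  · -- case II
    exfalso
    have hlt : Z < Z ⊔ N := by
      refine lt_of_le_of_ne le_sup_left ?_
      intro he
      exact hNZ (he ▸ le_sup_right)
    have hfin7 := Submodule.finrank_lt_finrank_of_lt hlt
    rw [hZdim] at hfin7
    have big : ∀ V : Submodule k A, Z ⊔ N ≤ V → (∀ v ∈ V, v ∈ J → v ∈ J ^ 2 ⊔ N) →
        finrank k V ≤ 7 := by
      intro V hV hVJ
      by_contra hcon
      obtain ⟨v, _, hv⟩ := c_ext_one V ⊤ le_top (by rw [finrank_top, hdim]; omega)
      obtain ⟨c, hc⟩ := htop v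
      apply nocomm _ hc
      intro j hj
      obtain ⟨d, hd⟩ := c_dec_one _ _ _ (hv (show j ∈ ⊤ from trivial))
      have h1 : j - d • (v - algebraMap k A c) ∈ V := by
        have : j - d • (v - algebraMap k A c) = (j - d • v) + d • algebraMap k A c := by
          rw [smul_sub]; abel
        rw [this]
        exact add_mem hd (V.smul_mem _ (hV (Submodule.mem_sup_left (halg c))))
      have h2 := hVJ _ h1 (sub_mem hj (J.smul_mem _ hc))
      have : j = d • (v - algebraMap k A c) + (j - d • (v - algebraMap k A c)) := by abel
      rw [this]
      exact Submodule.add_mem_sup (Submodule.smul_mem _ _ (Submodule.mem_span_singleton_self _)) h2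
    have hZNJ : ∀ v ∈ Z ⊔ N, v ∈ J → v ∈ N := by
      intro v hv hvJ
      obtain ⟨z, hz, m, hm, rfl⟩ := Submodule.mem_sup.mp hv
      have : z ∈ J := by simpa using sub_mem hvJ (hNJ hm)
      exact add_mem (hMN (hZJ z hz this)) hm
    have hZN7 : finrank k (Z ⊔ N : Submodule k A) ≤ 7 :=
      big _ le_rfl fun v hv hvJ => Submodule.mem_sup_right (hZNJ v hv hvJ)
    have hwN : w ∈ N := by
      by_contra hwN
      have hwZN : w ∉ Z ⊔ N := fun h => hwN (hZNJ w h hwJ)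
      have hlt2 : Z ⊔ N < Submodule.span k {w} ⊔ (Z ⊔ N) := by
        refine lt_of_le_of_ne le_sup_right ?_
        intro he
        apply hwZN
        rw [he]
        exact Submodule.mem_sup_left (Submodule.mem_span_singleton_self w)
      have h8 := Submodule.finrank_lt_finrank_of_lt hlt2
      have := big _ hlt2.le ?_
      · omega
      · intro v hv hvJ
        obtain ⟨d, hd⟩ := c_dec_one _ _ _ hv
        have h1 := hZNJ _ hd (sub_mem hvJ (J.smul_mem _ hwJ))
        have : v = d • w + (v - d • w) := by abel
        rw [this]
        exact Submodule.add_mem_sup (Submodule.smul_mem _ _ hwJ2) h1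
    -- A = Z + Zx + Zy
    have hZZ : Z * Z ≤ Z := by
      rw [Submodule.mul_le, hZ]
      intro a ha b hb
      exact Subalgebra.mul_mem _ ha hb
    have hMZM : M * Z ≤ M := by
      rw [Submodule.mul_le]
      intro a ha b hb
      exact hZJ _ (hZZ (Submodule.mul_mem_mul (hMZ ha) hb)) (hJr _ _ (hMJ ha))
    have hA : Z * (Submodule.span k {1} ⊔ (Submodule.span k {x} ⊔ Submodule.span k {y})) = ⊤ := by
      refine c_nak M _ hM3 ?_ ?_
      · rw [← mul_assoc]
        exact c_ml (hMZM.trans hMZ)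
      · intro a _
        rw [← hN]
        obtain ⟨c, hc⟩ := htop a
        obtain ⟨α, β, γ, m, hm, h1⟩ := hdecJ _ hc
        have : a = 1 * (c • 1 + (α • x + β • y)) + (γ • w + m) := by
          rw [one_mul, ← Algebra.algebraMap_eq_smul_one]
          rw [sub_eq_iff_eq_add] at h1
          rw [h1]; abel
        rw [this]
        refine Submodule.add_mem_sup (Submodule.mul_mem_mul hone ?_)
          (add_mem (N.smul_mem _ hwN) hm)
        exact Submodule.add_mem_sup (Submodule.smul_mem _ _ (Submodule.mem_span_singleton_self _))
          (Submodule.add_mem_sup (Submodule.smul_mem _ _ (Submodule.mem_span_singleton_self _))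
          (Submodule.smul_mem _ _ (Submodule.mem_span_singleton_self _)))
    have dec3 : ∀ P : Submodule k A, ∀ a ∈
        P * (Submodule.span k {1} ⊔ (Submodule.span k {x} ⊔ Submodule.span k {y})),
        ∃ z0 ∈ P, ∃ z1 ∈ P, ∃ z2 ∈ P, a = z0 + z1 * x + z2 * y := by
      intro P a ha
      rw [Submodule.mul_sup, Submodule.mul_sup] at ha
      obtain ⟨b, hb, c, hc, rfl⟩ := Submodule.mem_sup.mp ha
      obtain ⟨d, hd, e, he, rfl⟩ := Submodule.mem_sup.mp hc
      obtain ⟨z0, h0, rfl⟩ := Submodule.mem_mul_span_singleton.mp hb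
      obtain ⟨z1, h1, rfl⟩ := Submodule.mem_mul_span_singleton.mp hd
      obtain ⟨z2, h2, rfl⟩ := Submodule.mem_mul_span_singleton.mp he
      exact ⟨z0, h0, z1, h1, z2, h2, by rw [mul_one, add_assoc]⟩
    have hwM : ∃ z0 ∈ M, ∃ z1 ∈ M, ∃ z2 ∈ M, w = z0 + z1 * x + z2 * y := by
      apply dec3
      have h1 : w ∈ M * ⊤ := hN ▸ hwN
      rw [← hA, ← mul_assoc] at h1
      exact c_ml hMZM h1
    obtain ⟨z0, h0, z1, h1, z2, h2, hwz⟩ := hwM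
    have hcen : w ∈ Z → False := by
      intro hwZ
      have hwM : w ∈ M := hZJ w hwZ hwJ
      have hK2 : cK k A ≤ Submodule.span k (Set.range ![w, t]) := by
        rw [cK, Submodule.span_le]
        rintro _ ⟨a, b, rfl⟩
        obtain ⟨a0, ha0, a1, ha1, a2, ha2, ea⟩ := dec3 Z a (by rw [hA]; trivial)
        obtain ⟨b0, hb0, b1, hb1, b2, hb2, eb⟩ := dec3 Z b (by rw [hA]; trivial)
        have e : a * b - b * a = (a1 * b2 - a2 * b1) * w := by
          rw [ea, eb, hw]
          simp only [mul_add, add_mul, sub_mul, mul_sub]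
          have ca0 := (memZ _).mp ha0
          have ca1 := (memZ _).mp ha1
          have ca2 := (memZ _).mp ha2
          have cb0 := (memZ _).mp hb0
          have cb1 := (memZ _).mp hb1
          have cb2 := (memZ _).mp hb2
          have key : ∀ p q r s : A, p ∈ Z → r ∈ Z → p * q * (r * s) = p * r * (q * s) := by
            intro p q r s hp hr
            rw [mul_assoc, ← mul_assoc q, (memZ r).mp hr q, mul_assoc r, ← mul_assoc p]
          rw [key a1 x b1 x ha1 hb1, key a1 x b2 y ha1 hb2, key a2 y b1 x ha2 hb1,
            key a2 y b2 y ha2 hb2, key b1 x a1 x hb1 ha1, key b1 x a2 y hb1 ha2,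
            key b2 y a1 x hb2 ha1, key b2 y a2 y hb2 ha2]
          rw [ca1 b1, ca2 b2, ca2 b1, ca1 b2, ca0 b0]
          have f1 : b0 * (a1 * x) = a1 * x * b0 := (cb0 _).symm
          have f2 : b0 * (a2 * y) = a2 * y * b0 := (cb0 _).symm
          have f3 : b1 * x * a0 = a0 * (b1 * x) := ca0 _
          have f4 : b2 * y * a0 = a0 * (b2 * y) := ca0 _
          rw [f1, f2, f3, f4]
          abel
        rw [e]
        obtain ⟨c, hc⟩ := hZM (a1 * b2 - a2 * b1)
          (sub_mem (hZZ (Submodule.mul_mem_mul ha1 hb2)) (hZZ (Submodule.mul_mem_mul ha2 hb1)))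
        have h3 := hM2 (Submodule.mul_mem_mul hc hwM)
        obtain ⟨d, hd⟩ := Submodule.mem_span_singleton.mp h3
        have : (a1 * b2 - a2 * b1) * w = c • w + d • t := by
          rw [hd, sub_mul _ (algebraMap k A c), ← Algebra.smul_def]; abel
        rw [this]
        exact add_mem (Submodule.smul_mem _ _ (Submodule.subset_span ⟨0, rfl⟩))
          (Submodule.smul_mem _ _ (Submodule.subset_span ⟨1, rfl⟩))
      have h3 := Submodule.finrank_mono hK2
      have h4 := finrank_range_le_card (R := k) ![w, t]
      rw [hKdim] at h3
      simp only [Set.finrank, Fintype.card_fin] at h4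
      omega
    have hNw : ∀ a ∈ N, ∃ c : k, a - c • w ∈ Z := by
      have hle : Submodule.span k {w} ⊔ Z ≤ Z ⊔ N := by
        refine sup_le ?_ le_sup_left
        rw [Submodule.span_singleton_le_iff_mem]; exact Submodule.mem_sup_right hwN
      have hlt : Z < Submodule.span k {w} ⊔ Z := by
        refine lt_of_le_of_ne le_sup_right ?_
        intro he
        apply hcen
        rw [he]; exact Submodule.mem_sup_left (Submodule.mem_span_singleton_self w)
      have h3 := Submodule.finrank_lt_finrank_of_lt hlt
      have h4 := Submodule.eq_of_le_of_finrank_le hle (by omega)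
      intro a ha
      refine c_dec_one Z w a ?_
      rw [h4]; exact Submodule.mem_sup_right ha
    have c0 := hMc z0 h0
    have c1 := hMc z1 h1
    have c2 := hMc z2 h2
    have hyw : y * w = w * y := by
      by_contra hne
      obtain ⟨c, hc⟩ := hNw (z1 * y) (by rw [hN]; exact Submodule.mul_mem_mul h1 trivial)
      have h3 := (memZ _).mp hc y
      have h4 : c • (y * w - w * y) = 0 := by
        simp only [mul_sub, sub_mul, mul_smul_comm, smul_mul_assoc] at h3
        rw [← mul_assoc, ← c1 y] at h3
        rw [smul_sub, sub_right_injective h3, sub_self]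
      have hc0 : c = 0 := (smul_eq_zero.mp h4).resolve_right (sub_ne_zero.mpr hne)
      have h5 : z1 * w = 0 := by
        have h6 := (memZ _).mp hc x
        rw [hc0, zero_smul, sub_zero, ← mul_assoc, ← c1 x] at h6
        rw [hw, mul_sub, ← mul_assoc, ← mul_assoc, h6]
        simp
      apply hne
      have e : y * w - w * y = - (z1 * w) := by
        have q : y * (z0 + z1 * x + z2 * y) - (z0 + z1 * x + z2 * y) * y
            = - (z1 * (x * y - y * x)) := by
          simp only [mul_add, add_mul, mul_sub, ← mul_assoc, ← c0 y, ← c1 y, ← c2 y]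
          abel
        rwa [← hwz, ← hw] at q
      rw [h5, neg_zero] at e
      exact sub_eq_zero.mp e
    have hxw : x * w = w * x := by
      by_contra hne
      obtain ⟨c, hc⟩ := hNw (z2 * x) (by rw [hN]; exact Submodule.mul_mem_mul h2 trivial)
      have h3 := (memZ _).mp hc x
      have h4 : c • (x * w - w * x) = 0 := by
        simp only [mul_sub, sub_mul, mul_smul_comm, smul_mul_assoc] at h3
        rw [← mul_assoc, ← c2 x] at h3
        rw [smul_sub, sub_right_injective h3, sub_self]
      have hc0 : c = 0 := (smul_eq_zero.mp h4).resolve_right (sub_ne_zero.mpr hne)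
      have h5 : z2 * w = 0 := by
        have h6 := (memZ _).mp hc y
        rw [hc0, zero_smul, sub_zero, ← mul_assoc, ← c2 y] at h6
        rw [hw, mul_sub, ← mul_assoc, ← mul_assoc, h6]
        simp
      apply hne
      have e : x * w - w * x = z2 * w := by
        have q : x * (z0 + z1 * x + z2 * y) - (z0 + z1 * x + z2 * y) * x
            = z2 * (x * y - y * x) := by
          simp only [mul_add, add_mul, mul_sub, ← mul_assoc, ← c0 x, ← c1 x, ← c2 x]
          abel
        rwa [← hwz, ← hw] at q
      rw [h5] at e
      exact sub_eq_zero.mp e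
    apply hcen
    rw [memZ]
    intro a
    obtain ⟨a0, ha0, a1, ha1, a2, ha2, ea⟩ := dec3 Z a (by rw [hA]; trivial)
    rw [ea]
    simp only [add_mul, mul_add]
    rw [← (memZ _).mp ha0 w, mul_assoc, mul_assoc, hxw, hyw, ← mul_assoc, ← mul_assoc,
      ← mul_assoc, ← mul_assoc, (memZ _).mp ha1 w, (memZ _).mp ha2 w]
end core


/-- first shift operator -/
def bX (k : Type) [Field k] : Module.End k (ℕ → ℕ → k) where
  toFun f := fun i j => if i < 2 then f (i + 1) j else 0
  map_add' f g := by
    funext i j; simp only [Pi.add_apply]; split_ifs <;> simp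
  map_smul' c f := by
    funext i j; simp only [Pi.smul_apply, RingHom.id_apply]; split_ifs <;> simp

/-- second shift operator -/
def bY (k : Type) [Field k] : Module.End k (ℕ → ℕ → k) where
  toFun f := fun i j => if j < 2 then (-1) ^ i * f i (j + 1) else 0
  map_add' f g := by
    funext i j; simp only [Pi.add_apply]; split_ifs <;> simp [mul_add]
  map_smul' c f := by
    funext i j; simp only [Pi.smul_apply, RingHom.id_apply]; split_ifs <;> simp [mul_left_comm]

theorem bX_apply (k : Type) [Field k] (f : ℕ → ℕ → k) (i j : ℕ) :
    bX k f i j = if i < 2 then f (i + 1) j else 0 := rfl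

theorem bY_apply (k : Type) [Field k] (f : ℕ → ℕ → k) (i j : ℕ) :
    bY k f i j = if j < 2 then (-1) ^ i * f i (j + 1) else 0 := rfl

def bRep (k : Type) [Field k] : Balg k →ₐ[k] Module.End k (ℕ → ℕ → k) :=
  RingQuot.liftAlgHom k ⟨FreeAlgebra.lift k ![bX k, bY k], by
    rintro a b ⟨rfl, h | h | h⟩
    · rw [h, map_zero, map_pow, FreeAlgebra.lift_ι_apply]
      refine LinearMap.ext fun f => ?_
      funext i j
      simp only [pow_succ, pow_zero, one_mul,
        Module.End.mul_apply, Matrix.cons_val_zero, bX_apply, LinearMap.zero_apply, Pi.zero_apply]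
      split_ifs <;> first | rfl | omega
    · rw [h, map_zero, map_pow, FreeAlgebra.lift_ι_apply]
      refine LinearMap.ext fun f => ?_
      funext i j
      simp only [pow_succ, pow_zero, one_mul,
        Module.End.mul_apply, Matrix.cons_val_one, Matrix.cons_val_zero, bY_apply, LinearMap.zero_apply, Pi.zero_apply]
      split_ifs <;> first | omega | simp
    · rw [h, map_zero]
      refine LinearMap.ext fun f => ?_
      funext i j
      simp only [map_add, map_mul, FreeAlgebra.lift_ι_apply,
        Module.End.mul_apply, Matrix.cons_val_one, Matrix.cons_val_zero, bY_apply, bX_apply,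
        LinearMap.zero_apply, LinearMap.add_apply, Pi.zero_apply, Pi.add_apply]
      split_ifs <;> simp [pow_succ]⟩

theorem bRep_x (k : Type) [Field k] : bRep k (xB k) = bX k := by
  simp [bRep, xB]

theorem bRep_y (k : Type) [Field k] : bRep k (yB k) = bY k := by
  simp [bRep, yB]

theorem bRel1 (k : Type) [Field k] : xB k * (xB k * xB k) = 0 := by
  have := RingQuot.mkAlgHom_rel k (s := Brel k) (x := ι k (0 : Fin 2) ^ 3) (y := 0)
    ⟨rfl, Or.inl rfl⟩
  simpa [xB, pow_succ, mul_assoc] using this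

theorem bRel2 (k : Type) [Field k] : yB k * (yB k * yB k) = 0 := by
  have := RingQuot.mkAlgHom_rel k (s := Brel k) (x := ι k (1 : Fin 2) ^ 3) (y := 0)
    ⟨rfl, Or.inr (Or.inl rfl)⟩
  simpa [yB, pow_succ, mul_assoc] using this

theorem bRel3 (k : Type) [Field k] : yB k * xB k = - (xB k * yB k) := by
  have := RingQuot.mkAlgHom_rel k (s := Brel k)
    (x := ι k (0 : Fin 2) * ι k (1 : Fin 2) + ι k (1 : Fin 2) * ι k (0 : Fin 2)) (y := 0)
    ⟨rfl, Or.inr (Or.inr rfl)⟩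
  have h2 : xB k * yB k + yB k * xB k = 0 := by simpa [xB, yB] using this
  rw [eq_neg_iff_add_eq_zero, add_comm]; exact h2

/-- general element of B in normal form -/
def bEl {k : Type} [Field k] {R : Type} [Ring R] [Algebra k R] (X Y : R)
    (a b c d e f g h i : k) : R :=
  a • (1 : R) + b • X + c • Y + d • (X * X) + e • (X * Y) + f • (Y * Y)
    + g • (X * (X * Y)) + h • (X * (Y * Y)) + i • (X * (X * (Y * Y)))

theorem bEl_zero {k : Type} [Field k] (a b c d e f g h i : k)
    (H : bEl (xB k) (yB k) a b c d e f g h i = 0) :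
    a = 0 ∧ b = 0 ∧ c = 0 ∧ d = 0 ∧ e = 0 ∧ f = 0 ∧ g = 0 ∧ h = 0 ∧ i = 0 := by
  have H1 : ∀ F : ℕ → ℕ → k, a * F 0 0 + b * F 1 0 + c * F 0 1 + d * F 2 0 + e * (- F 1 1)
      + f * F 0 2 + g * F 2 1 + h * F 1 2 + i * F 2 2 = 0 := by
    intro F
    have := congrArg (fun z => bRep k z F 0 0) H
    simpa [bEl, bRep_x, bRep_y, bX_apply, bY_apply] using this
  refine ⟨?_, ?_, ?_, ?_, ?_, ?_, ?_, ?_, ?_⟩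
  · simpa using H1 fun p q => if p = 0 ∧ q = 0 then 1 else 0
  · simpa using H1 fun p q => if p = 1 ∧ q = 0 then 1 else 0
  · simpa using H1 fun p q => if p = 0 ∧ q = 1 then 1 else 0
  · simpa using H1 fun p q => if p = 2 ∧ q = 0 then 1 else 0
  · simpa using H1 fun p q => if p = 1 ∧ q = 1 then 1 else 0
  · simpa using H1 fun p q => if p = 0 ∧ q = 2 then 1 else 0
  · simpa using H1 fun p q => if p = 2 ∧ q = 1 then 1 else 0
  · simpa using H1 fun p q => if p = 1 ∧ q = 2 then 1 else 0
  · simpa using H1 fun p q => if p = 2 ∧ q = 2 then 1 else 0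

section rules
variable {k : Type} [Field k] {R : Type} [Ring R] [Algebra k R] (X Y : R)

theorem bEl_mulX (h1 : X * (X * X) = 0) (a b c d e f g h i : k) :
    X * bEl X Y a b c d e f g h i = bEl X Y 0 a 0 b c 0 e f h := by
  have h1' : ∀ r, X * (X * (X * r)) = 0 := by
    intro r
    rw [← mul_assoc X X, ← mul_assoc (X * X), mul_assoc X X X, h1, zero_mul]
  simp only [bEl, mul_add, mul_smul_comm, h1, h1', mul_one, smul_zero, zero_smul]
  abel

theorem bEl_mulY (h2 : Y * (Y * Y) = 0) (h3 : Y * X = - (X * Y))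
    (a b c d e f g h i : k) :
    Y * bEl X Y a b c d e f g h i = bEl X Y 0 0 a 0 (-b) c d (-e) g := by
  have h3' : ∀ r, Y * (X * r) = - (X * (Y * r)) := by
    intro r
    rw [← mul_assoc, h3, neg_mul, mul_assoc]
  simp only [bEl, mul_add, mul_smul_comm, h2, h3, h3', mul_one, smul_zero, zero_smul, mul_neg,
    smul_neg, neg_neg, mul_zero, neg_zero, neg_smul]
  abel

theorem bEl_Xmul (h1 : X * (X * X) = 0) (h3 : Y * X = - (X * Y)) (a b c d e f g h i : k) :
    bEl X Y a b c d e f g h i * X = bEl X Y 0 a 0 b (-c) 0 (-e) f h := by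
  have h1' : ∀ r, X * (X * (X * r)) = 0 := by
    intro r
    rw [← mul_assoc X X, ← mul_assoc (X * X), mul_assoc X X X, h1, zero_mul]
  have h3' : ∀ r, Y * (X * r) = - (X * (Y * r)) := by
    intro r
    rw [← mul_assoc, h3, neg_mul, mul_assoc]
  simp only [bEl, add_mul, smul_mul_assoc, mul_assoc, h1, h1', h3, h3', one_mul, smul_zero,
    zero_smul, mul_neg, smul_neg, neg_neg, mul_zero, neg_zero, neg_smul]
  abel

theorem bEl_Ymul (h2 : Y * (Y * Y) = 0) (a b c d e f g h i : k) :
    bEl X Y a b c d e f g h i * Y = bEl X Y 0 0 a 0 b c d e g := by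
  simp only [bEl, add_mul, smul_mul_assoc, mul_assoc, h2, one_mul, smul_zero,
    zero_smul, mul_zero]
  abel

theorem bEl_add (a b c d e f g h i a' b' c' d' e' f' g' h' i' : k) :
    bEl X Y a b c d e f g h i + bEl X Y a' b' c' d' e' f' g' h' i' =
    bEl X Y (a + a') (b + b') (c + c') (d + d') (e + e') (f + f') (g + g') (h + h') (i + i') := by
  simp only [bEl]; module

theorem bEl_sub (a b c d e f g h i a' b' c' d' e' f' g' h' i' : k) :
    bEl X Y a b c d e f g h i - bEl X Y a' b' c' d' e' f' g' h' i' =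
    bEl X Y (a - a') (b - b') (c - c') (d - d') (e - e') (f - f') (g - g') (h - h') (i - i') := by
  simp only [bEl]; module

theorem bEl_smul (r a b c d e f g h i : k) :
    r • bEl X Y a b c d e f g h i =
    bEl X Y (r * a) (r * b) (r * c) (r * d) (r * e) (r * f) (r * g) (r * h) (r * i) := by
  simp only [bEl]; module
theorem bEl_mul (h1 : X * (X * X) = 0) (h2 : Y * (Y * Y) = 0) (h3 : Y * X = - (X * Y))
    (a d f g h i a' d' f' g' h' i' : k) :
    bEl X Y a 0 0 d 0 f g h i * bEl X Y a' 0 0 d' 0 f' g' h' i' =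
    bEl X Y (a * a') 0 0 (a * d' + d * a') 0 (a * f' + f * a') (a * g' + g * a')
      (a * h' + h * a') (a * i' + i * a' + d * f' + f * d') := by
  have e : bEl X Y a 0 0 d 0 f g h i = algebraMap k R a + (d • (X * X) + f • (Y * Y)
      + g • (X * (X * Y)) + h • (X * (Y * Y)) + i • (X * (X * (Y * Y)))) := by
    simp only [bEl, zero_smul, Algebra.algebraMap_eq_smul_one]; abel
  rw [e]
  simp only [add_mul, smul_mul_assoc, mul_assoc, bEl_mulX X Y h1, bEl_mulY X Y h2 h3]
  rw [← Algebra.smul_def]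
  simp only [bEl_smul, bEl_add]
  congr 1 <;> ring

theorem bEl_eq_zero (a b c d e f g h i : k) (ha : a = 0) (hb : b = 0) (hc : c = 0) (hd : d = 0)
    (he : e = 0) (hf : f = 0) (hg : g = 0) (hh : h = 0) (hi : i = 0) :
    bEl X Y a b c d e f g h i = 0 := by
  subst ha hb hc hd he hf hg hh hi
  simp [bEl]
end rules

theorem bEl_surj {k : Type} [Field k] (z : Balg k) :
    ∃ a b c d e f g h i : k, z = bEl (xB k) (yB k) a b c d e f g h i := by
  obtain ⟨u, rfl⟩ := RingQuot.mkAlgHom_surjective k (Brel k) z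
  suffices H : ∀ p : Balg k, (∃ a b c d e f g h i : k, p = bEl (xB k) (yB k) a b c d e f g h i) →
      ∃ a b c d e f g h i : k,
        RingQuot.mkAlgHom k (Brel k) u * p = bEl (xB k) (yB k) a b c d e f g h i by
    have := H 1 ⟨1, 0, 0, 0, 0, 0, 0, 0, 0, by simp [bEl]⟩
    simpa using this
  induction u using FreeAlgebra.induction with
  | grade0 r =>
    rintro _ ⟨a, b, c, d, e, f, g, h, i, rfl⟩
    rw [AlgHom.commutes, ← Algebra.smul_def, bEl_smul]
    exact ⟨_, _, _, _, _, _, _, _, _, rfl⟩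
  | grade1 x =>
    rintro _ ⟨a, b, c, d, e, f, g, h, i, rfl⟩
    fin_cases x
    · exact ⟨_, _, _, _, _, _, _, _, _, bEl_mulX _ _ (bRel1 k) a b c d e f g h i⟩
    · exact ⟨_, _, _, _, _, _, _, _, _, bEl_mulY _ _ (bRel2 k) (bRel3 k) a b c d e f g h i⟩
  | mul u v hu hv =>
    intro p hp
    rw [map_mul, mul_assoc]
    exact hu _ (hv _ hp)
  | add u v hu hv =>
    intro p hp
    rw [map_add, add_mul]
    obtain ⟨a, b, c, d, e, f, g, h, i, h1⟩ := hu p hp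
    obtain ⟨a', b', c', d', e', f', g', h', i', h2⟩ := hv p hp
    rw [h1, h2, bEl_add]
    exact ⟨_, _, _, _, _, _, _, _, _, rfl⟩

theorem bEl_center {k : Type} [Field k] (a d f g h i : k) :
    bEl (xB k) (yB k) a 0 0 d 0 f g h i ∈ Subalgebra.center k (Balg k) := by
  rw [Subalgebra.mem_center_iff]
  have hX : xB k * bEl (xB k) (yB k) a 0 0 d 0 f g h i =
      bEl (xB k) (yB k) a 0 0 d 0 f g h i * xB k := by
    rw [bEl_mulX _ _ (bRel1 k), bEl_Xmul _ _ (bRel1 k) (bRel3 k)]; simp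
  have hY : yB k * bEl (xB k) (yB k) a 0 0 d 0 f g h i =
      bEl (xB k) (yB k) a 0 0 d 0 f g h i * yB k := by
    rw [bEl_mulY _ _ (bRel2 k) (bRel3 k), bEl_Ymul _ _ (bRel2 k)]; simp
  intro b
  generalize bEl (xB k) (yB k) a 0 0 d 0 f g h i = z at *
  obtain ⟨u, rfl⟩ := RingQuot.mkAlgHom_surjective k (Brel k) b
  induction u using FreeAlgebra.induction with
  | grade0 r => rw [AlgHom.commutes]; exact Algebra.commutes _ _
  | grade1 x =>
    fin_cases x
    · exact hX
    · exact hY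
  | mul u v hu hv => rw [map_mul, mul_assoc, hv, ← mul_assoc, hu, mul_assoc]
  | add u v hu hv => rw [map_add, add_mul, mul_add, hu, hv]

theorem b_center {k : Type} [Field k] [CharP k 3] (z : Balg k)
    (hz : z ∈ Subalgebra.center k (Balg k)) :
    ∃ a d f g h i : k, z = bEl (xB k) (yB k) a 0 0 d 0 f g h i := by
  obtain ⟨a, b, c, d, e, f, g, h, i, rfl⟩ := bEl_surj z
  rw [Subalgebra.mem_center_iff] at hz
  have hX := hz (xB k)
  have hY := hz (yB k)
  rw [bEl_mulX _ _ (bRel1 k), bEl_Xmul _ _ (bRel1 k) (bRel3 k), ← sub_eq_zero, bEl_sub] at hX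
  rw [bEl_mulY _ _ (bRel2 k) (bRel3 k), bEl_Ymul _ _ (bRel2 k), ← sub_eq_zero, bEl_sub] at hY
  have h1 := bEl_zero _ _ _ _ _ _ _ _ _ hX
  have h2 := bEl_zero _ _ _ _ _ _ _ _ _ hY
  have two : (2 : k) ≠ 0 := by
    intro h2
    have := (CharP.cast_eq_zero_iff k 3 2).mp (by exact_mod_cast h2)
    omega
  have hc : c = 0 := by
    have : 2 * c = 0 := by linear_combination h1.2.2.2.2.1
    exact (mul_eq_zero.mp this).resolve_left two
  have he : e = 0 := by
    have : 2 * e = 0 := by linear_combination h1.2.2.2.2.2.2.1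
    exact (mul_eq_zero.mp this).resolve_left two
  have hb : b = 0 := by
    have : 2 * b = 0 := by linear_combination -h2.2.2.2.2.1
    exact (mul_eq_zero.mp this).resolve_left two
  subst hb hc he
  exact ⟨a, d, f, g, h, i, rfl⟩

theorem b_gen {k : Type} [Field k] {R : Type} [Ring R] [Algebra k R] (X Y : R)
    (h1 : X * (X * X) = 0) (h2 : Y * (Y * Y) = 0) (h3 : Y * X = - (X * Y))
    (hz : ∀ a b c d e f g h i : k, bEl X Y a b c d e f g h i = 0 →
      a = 0 ∧ b = 0 ∧ c = 0 ∧ d = 0 ∧ e = 0 ∧ f = 0 ∧ g = 0 ∧ h = 0 ∧ i = 0)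
    (hc : ∀ a d f g h i : k, bEl X Y a 0 0 d 0 f g h i ∈ Subalgebra.center k R)
    (hs : ∀ z ∈ Subalgebra.center k R, ∃ a d f g h i : k, z = bEl X Y a 0 0 d 0 f g h i) :
    ∃ v : Basis (Fin 6) k (Subalgebra.center k R), v 0 = 1 ∧ v 1 * v 2 = v 5 ∧
      ∀ i j : Fin 6, i ≠ 0 → j ≠ 0 → ¬ (i = 1 ∧ j = 2) → ¬ (i = 2 ∧ j = 1) → v i * v j = 0 := by
  let φ : (Fin 6 → k) →ₗ[k] Subalgebra.center k R :=
    { toFun := fun c => ⟨bEl X Y (c 0) 0 0 (c 1) 0 (c 2) (c 3) (c 4) (c 5), hc _ _ _ _ _ _⟩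
      map_add' := by
        intro c d
        apply Subtype.ext
        refine Eq.trans ?_ (bEl_add X Y _ _ _ _ _ _ _ _ _ _ _ _ _ _ _ _ _ _).symm
        simp
      map_smul' := by
        intro r c
        apply Subtype.ext
        refine Eq.trans ?_ (bEl_smul X Y _ _ _ _ _ _ _ _ _ _).symm
        simp }
  have hφ : ∀ c, (φ c : R) = bEl X Y (c 0) 0 0 (c 1) 0 (c 2) (c 3) (c 4) (c 5) := fun _ => rfl
  have hinj : Function.Injective φ := by
    rw [injective_iff_map_eq_zero]
    intro c h0
    have h4 := hφ c
    rw [h0] at h4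
    obtain ⟨e0, -, -, e1, -, e2, e3, e4, e5⟩ := hz _ _ _ _ _ _ _ _ _ h4.symm
    funext i
    fin_cases i <;> assumption
  have hsur : Function.Surjective φ := by
    rintro ⟨z, hz'⟩
    obtain ⟨a, d, f, g, h, i, rfl⟩ := hs z hz'
    exact ⟨![a, d, f, g, h, i], Subtype.ext rfl⟩
  let e := LinearEquiv.ofBijective φ ⟨hinj, hsur⟩
  have hv : ∀ i, Basis.ofEquivFun e.symm i = φ (Pi.single i 1) := by
    intro i
    rw [Basis.coe_ofEquivFun]; rfl
  refine ⟨Basis.ofEquivFun e.symm, ?_, ?_, ?_⟩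
  · rw [hv]; apply Subtype.ext; rw [hφ]; simp [bEl]
  · rw [hv, hv, hv]; apply Subtype.ext
    rw [MulMemClass.coe_mul, hφ, hφ, hφ, bEl_mul X Y h1 h2 h3]; simp
  · intro i j hi hj hij hji
    rw [hv, hv]; apply Subtype.ext
    rw [MulMemClass.coe_mul, hφ, hφ, bEl_mul X Y h1 h2 h3]
    have ei : (Pi.single i 1 : Fin 6 → k) 0 = 0 := Pi.single_eq_of_ne hi.symm _
    have ej : (Pi.single j 1 : Fin 6 → k) 0 = 0 := Pi.single_eq_of_ne hj.symm _
    rw [ei, ej]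
    have e1 : (Pi.single i 1 : Fin 6 → k) 1 * (Pi.single j 1 : Fin 6 → k) 2 = 0 := by
      by_cases h : i = 1
      · rw [Pi.single_eq_of_ne (i := j) (fun hh => hij ⟨h, hh.symm⟩), mul_zero]
      · rw [Pi.single_eq_of_ne (i := i) (fun hh => h hh.symm), zero_mul]
    have e2 : (Pi.single i 1 : Fin 6 → k) 2 * (Pi.single j 1 : Fin 6 → k) 1 = 0 := by
      by_cases h : i = 2
      · rw [Pi.single_eq_of_ne (i := j) (fun hh => hji ⟨h, hh.symm⟩), mul_zero]
      · rw [Pi.single_eq_of_ne (i := i) (fun hh => h hh.symm), zero_mul]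
    rw [e1, e2]
    apply bEl_eq_zero <;> simp

theorem b_basis (k : Type) [Field k] [CharP k 3] :
    ∃ v : Basis (Fin 6) k (Subalgebra.center k (Balg k)), v 0 = 1 ∧ v 1 * v 2 = v 5 ∧
      ∀ i j : Fin 6, i ≠ 0 → j ≠ 0 → ¬ (i = 1 ∧ j = 2) → ¬ (i = 2 ∧ j = 1) → v i * v j = 0 :=
  b_gen (xB k) (yB k) (bRel1 k) (bRel2 k) (bRel3 k) bEl_zero bEl_center b_center

section fin
variable {k : Type} [Field k] {A : Type} [Ring A] [Algebra k A]

theorem e_mul_right [FiniteDimensional k A] (a b : A) (h : IsUnit (a * b)) : IsUnit a := by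
  have : IsArtinianRing A := IsArtinianRing.of_finite k A
  obtain ⟨u, hu⟩ := h
  have h1 : a * (b * ((u⁻¹ : Aˣ) : A)) = 1 := by
    rw [← mul_assoc, ← hu, Units.mul_inv]
  exact IsUnit.of_mul_eq_one _ h1

theorem e_mul_left [FiniteDimensional k A] (a b : A) (h : IsUnit (a * b)) : IsUnit b := by
  have : IsArtinianRing A := IsArtinianRing.of_finite k A
  obtain ⟨u, hu⟩ := h
  have h1 : (((u⁻¹ : Aˣ) : A) * a) * b = 1 := by
    rw [mul_assoc, ← hu, Units.inv_mul]
  exact IsUnit.of_mul_eq_one _ (mul_eq_one_symm h1)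

/-- the radical as a submodule -/
def eJ (k : Type) [Field k] (A : Type) [Ring A] [Algebra k A] [FiniteDimensional k A]
    [IsLocalRing A] : Submodule k A where
  carrier := {a | ¬ IsUnit a}
  zero_mem' := not_isUnit_zero
  add_mem' := by
    intro a b ha hb h
    obtain ⟨u, hu⟩ := h
    have h1 : ((u⁻¹ : Aˣ) : A) * a + ((u⁻¹ : Aˣ) : A) * b = 1 := by
      rw [← mul_add, ← hu, Units.inv_mul]
    rcases IsLocalRing.isUnit_or_isUnit_of_add_one h1 with h | h
    · exact ha (e_mul_left (k := k) _ _ h)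
    · exact hb (e_mul_left (k := k) _ _ h)
  smul_mem' := by
    intro c a ha h
    rw [Algebra.smul_def] at h
    exact ha (e_mul_left (k := k) _ _ h)

theorem e_mem [FiniteDimensional k A] [IsLocalRing A] (a : A) : a ∈ eJ k A ↔ ¬ IsUnit a := Iff.rfl

theorem e_nil [FiniteDimensional k A] [IsLocalRing A] : ∃ n, eJ k A ^ n = ⊥ := by
  have : IsArtinianRing A := IsArtinianRing.of_finite k A
  obtain ⟨n, hn⟩ := IsSemiprimaryRing.isNilpotent (R := A)
  have hJ : ∀ x ∈ eJ k A, x ∈ Ring.jacobson A := by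
    intro x hx
    rw [← Ideal.jacobson_bot, Ideal.mem_jacobson_iff]
    intro y
    have h1 : ¬ IsUnit (- (y * x)) := by
      intro h
      rw [IsUnit.neg_iff] at h
      exact hx (e_mul_left (k := k) _ _ h)
    have h2 : IsUnit (y * x + 1) :=
      (IsLocalRing.isUnit_or_isUnit_of_add_one (a := y * x + 1) (b := - (y * x))
        (by abel)).resolve_right h1
    obtain ⟨u, hu⟩ := h2
    refine ⟨((u⁻¹ : Aˣ) : A), ?_⟩
    have : ((u⁻¹ : Aˣ) : A) * y * x + ((u⁻¹ : Aˣ) : A) - 1 = 0 := by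
      have := Units.inv_mul u
      rw [hu, mul_add, mul_one] at this
      rw [mul_assoc, this, sub_self]
    rw [this]; exact Ideal.zero_mem _
  have hp : ∀ m, ∀ x ∈ eJ k A ^ m, x ∈ Ring.jacobson A ^ m := by
    intro m
    induction m with
    | zero => intro x _; rw [Submodule.pow_zero, Ideal.one_eq_top]; trivial
    | succ m ih =>
      intro x hx
      rw [pow_succ] at hx
      rw [Submodule.pow_succ]
      induction hx using Submodule.mul_induction_on' with
      | mem_mul_mem a ha b hb => exact Ideal.mul_mem_mul (ih a ha) (hJ b hb)
      | add a _ b _ h1 h2 => exact Ideal.add_mem _ h1 h2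
  refine ⟨n, ?_⟩
  rw [eq_bot_iff]
  intro x hx
  have := hp n x hx
  rw [hn] at this
  simpa using this

theorem e_sep (s : A →ₗ[k] k) (hs2 : ∀ I : Ideal A, (∀ x ∈ I, s x = 0) → I = ⊥) (a : A)
    (h : ∀ x, s (x * a) = 0) : a = 0 := by
  have := hs2 (Ideal.span {a}) (by
    intro x hx
    obtain ⟨y, rfl⟩ := Ideal.mem_span_singleton'.mp hx
    exact h y)
  exact Ideal.span_singleton_eq_bot.mp this

theorem e_nondeg (s : A →ₗ[k] k) (hs1 : ∀ x y : A, s (x * y) = s (y * x))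
    (hs2 : ∀ I : Ideal A, (∀ x ∈ I, s x = 0) → I = ⊥) :
    LinearMap.BilinForm.Nondegenerate ((LinearMap.mul k A).compr₂ s) := by
  constructor
  · intro x hx
    refine e_sep s hs2 x fun y => ?_
    rw [hs1]; exact hx y
  · intro x hx
    exact e_sep s hs2 x hx

theorem e_orthK (s : A →ₗ[k] k) (hs1 : ∀ x y : A, s (x * y) = s (y * x))
    (hs2 : ∀ I : Ideal A, (∀ x ∈ I, s x = 0) → I = ⊥) :
    LinearMap.BilinForm.orthogonal ((LinearMap.mul k A).compr₂ s) (cK k A) =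
      Subalgebra.toSubmodule (Subalgebra.center k A) := by
  have key : ∀ a b z, s ((a * b - b * a) * z) = s (a * (b * z - z * b)) := by
    intro a b z
    rw [sub_mul, mul_sub, map_sub, map_sub, mul_assoc, mul_assoc, hs1 b, mul_assoc]
  ext z
  rw [LinearMap.BilinForm.mem_orthogonal_iff, Subalgebra.mem_toSubmodule,
    Subalgebra.mem_center_iff]
  constructor
  · intro h b
    rw [← sub_eq_zero]
    refine e_sep s hs2 _ fun a => ?_
    rw [← key]
    exact h _ (Submodule.subset_span ⟨a, b, rfl⟩)
  · intro h c hc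
    change s (c * z) = 0
    induction hc using Submodule.span_induction with
    | mem x hx =>
      obtain ⟨a, b, rfl⟩ := hx
      rw [key, h b, sub_self, mul_zero, map_zero]
    | zero => simp
    | add x y _ _ hx hy => rw [add_mul, map_add, hx, hy, add_zero]
    | smul r x _ hx => rw [smul_mul_assoc, map_smul, hx, smul_zero]

open scoped Pointwise in
theorem e_final [IsAlgClosed k] [FiniteDimensional k A] [IsLocalRing A] (hsym : IsSymmAlg k A)
    (hdim : finrank k A = 9) (v : Basis (Fin 6) k (Subalgebra.center k A)) (hv0 : v 0 = 1)
    (hv12 : v 1 * v 2 = v 5) (hv : ∀ i j : Fin 6, i ≠ 0 → j ≠ 0 → ¬ (i = 1 ∧ j = 2) →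
      ¬ (i = 2 ∧ j = 1) → v i * v j = 0) :
    ∀ u ∈ eJ k A, u * u ∈ Subalgebra.center k A := by
  obtain ⟨s, hs1, hs2⟩ := hsym
  obtain ⟨n, hn⟩ := e_nil (k := k) (A := A)
  have hnd := e_nondeg s hs1 hs2
  have hZdim : finrank k (Subalgebra.toSubmodule (Subalgebra.center k A)) = 6 := by
    have := Module.finrank_eq_card_basis v
    simpa using this
  have hv21 : v 2 * v 1 = v 5 := by rw [mul_comm, hv12]
  have hor : ∀ i j : Fin 6, i ≠ 0 → j ≠ 0 → v i * v j = 0 ∨ v i * v j = v 5 := by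
    intro i j hi hj
    by_cases h1 : i = 1 ∧ j = 2
    · rw [h1.1, h1.2]; exact Or.inr hv12
    by_cases h2 : i = 2 ∧ j = 1
    · rw [h2.1, h2.2]; exact Or.inr hv21
    exact Or.inl (hv i j hi hj h1 h2)
  have h5 : ∀ i : Fin 6, i ≠ 0 → v 5 * v i = 0 := by
    intro i hi
    exact hv 5 i (by decide) hi (fun h => absurd h.1 (by decide)) (fun h => absurd h.1 (by decide))
  let S : Set A := {x | ∃ i : Fin 6, i ≠ 0 ∧ x = (v i : A)}
  let M : Submodule k A := Submodule.span k S
  have hSM : ∀ i : Fin 6, i ≠ 0 → (v i : A) ∈ M := fun i hi => Submodule.subset_span ⟨i, hi, rfl⟩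
  have hMMs : ∀ x ∈ S * S, x = 0 ∨ x = (v 5 : A) := by
    rintro _ ⟨_, ⟨i, hi, rfl⟩, _, ⟨j, hj, rfl⟩, rfl⟩
    rcases hor i j hi hj with h | h
    · left
      have := congrArg (Subtype.val) h
      simpa using this
    · right
      have := congrArg (Subtype.val) h
      simpa using this
  have hKdim : finrank k (cK k A) = 3 := by
    have h1 := LinearMap.BilinForm.finrank_orthogonal hnd (cK k A)
    rw [e_orthK s hs1 hs2, hZdim, hdim] at h1
    omega
  have hUdim : 6 ≤ finrank k (cK k A ⊔ M * ⊤ : Submodule k A) := by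
    have h1 := LinearMap.BilinForm.finrank_orthogonal hnd (cK k A ⊔ M * ⊤)
    have h2 : LinearMap.BilinForm.orthogonal ((LinearMap.mul k A).compr₂ s) (cK k A ⊔ M * ⊤) ≤
        Submodule.span k (Set.range ![(v 3 : A), (v 4 : A), (v 5 : A)]) := by
      intro z hz
      have hzZ : z ∈ Subalgebra.center k A := by
        rw [← Subalgebra.mem_toSubmodule, ← e_orthK s hs1 hs2]
        exact LinearMap.BilinForm.orthogonal_le le_sup_left hz
      have hzm : ∀ i : Fin 6, i ≠ 0 → (⟨z, hzZ⟩ : Subalgebra.center k A) * v i = 0 := by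
        intro i hi
        apply Subtype.ext
        change z * (v i : A) = 0
        refine e_sep s hs2 _ fun a => ?_
        have h3 : s ((v i : A) * a * z) = 0 :=
          (LinearMap.BilinForm.mem_orthogonal_iff.mp hz) _
            (Submodule.mem_sup_right (Submodule.mul_mem_mul (hSM i hi) trivial))
        rwa [mul_assoc, hs1, mul_assoc] at h3
      have hz' := v.sum_repr ⟨z, hzZ⟩
      generalize v.repr ⟨z, hzZ⟩ = c at hz'
      rw [Fin.sum_univ_six] at hz'
      have m1 := hzm 1 (by decide)
      have m2 := hzm 2 (by decide)
      rw [← hz', hv0] at m1 m2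
      simp only [add_mul, smul_mul_assoc, one_mul, hv12, hv21, h5 1 (by decide), h5 2 (by decide),
        hv 1 1 (by decide) (by decide) (by decide) (by decide),
        hv 2 2 (by decide) (by decide) (by decide) (by decide),
        hv 3 1 (by decide) (by decide) (by decide) (by decide),
        hv 4 1 (by decide) (by decide) (by decide) (by decide),
        hv 3 2 (by decide) (by decide) (by decide) (by decide),
        hv 4 2 (by decide) (by decide) (by decide) (by decide), smul_zero, add_zero] at m1 m2
      have c0 : c 0 = 0 := by
        have := congrArg (fun x => v.repr x 1) m1
        simpa using this
      have c2 : c 2 = 0 := by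
        have := congrArg (fun x => v.repr x 5) m1
        simpa using this
      have c1 : c 1 = 0 := by
        have := congrArg (fun x => v.repr x 5) m2
        simpa using this
      rw [c0, c1, c2] at hz'
      have hz2 := congrArg Subtype.val hz'
      simp only [zero_smul, zero_add] at hz2
      rw [← hz2]
      refine Submodule.add_mem _ (Submodule.add_mem _ ?_ ?_) ?_
      · exact Submodule.smul_mem _ _ (Submodule.subset_span ⟨0, rfl⟩)
      · exact Submodule.smul_mem _ _ (Submodule.subset_span ⟨1, rfl⟩)
      · exact Submodule.smul_mem _ _ (Submodule.subset_span ⟨2, rfl⟩)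
    have h3 := (Submodule.finrank_mono h2).trans (finrank_range_le_card _)
    rw [h1, hdim, Fintype.card_fin] at h3
    omega
  refine c_core (eJ k A) M (Subalgebra.toSubmodule (Subalgebra.center k A)) n hn ?_ ?_ ?_ ?_ ?_ rfl
    ?_ ?_ ?_ (v 5 : A) ?_ hdim hZdim hKdim hUdim
  · intro a b hb h
    exact hb (e_mul_left (k := k) _ _ h)
  · intro a b hb h
    exact hb (e_mul_right (k := k) _ _ h)
  · intro a
    obtain ⟨c, hc⟩ := spectrum.nonempty_of_isAlgClosed_of_finiteDimensional k a
    refine ⟨c, ?_⟩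
    rw [spectrum.mem_iff] at hc
    have := (eJ k A).neg_mem ((e_mem _).mpr hc)
    rwa [neg_sub] at this
  · intro h; exact h isUnit_one
  · refine Submodule.span_le.mpr ?_
    rintro _ ⟨i, hi, rfl⟩ h
    have h1 : v i * v i = 0 := hv i i hi hi
      (by rintro ⟨rfl, h⟩; exact absurd h (by decide))
      (by rintro ⟨rfl, h⟩; exact absurd h (by decide))
    have h2 : (v i : A) * (v i : A) = 0 := by
      have := congrArg Subtype.val h1
      simpa using this
    have h3 := h.mul h
    rw [h2] at h3
    exact not_isUnit_zero h3
  · refine Submodule.span_le.mpr ?_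
    rintro _ ⟨i, hi, rfl⟩
    exact (v i).2
  · intro z hz
    have hz' := v.sum_repr ⟨z, hz⟩
    generalize v.repr ⟨z, hz⟩ = c at hz'
    rw [Fin.sum_univ_succ, hv0] at hz'
    have hz2 := congrArg Subtype.val hz'
    refine ⟨c 0, ?_⟩
    have : z - algebraMap k A (c 0) = ∑ i : Fin 5, c i.succ • (v i.succ : A) := by
      have hz3 : z = c 0 • (1 : A) + ∑ i : Fin 5, c i.succ • (v i.succ : A) := by
        rw [← show _ = z from hz2]
        simp
      rw [hz3, Algebra.algebraMap_eq_smul_one, add_sub_cancel_left]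
    rw [this]
    exact Submodule.sum_mem _ fun i _ => Submodule.smul_mem _ _ (hSM _ (Fin.succ_ne_zero i))
  · change Submodule.span k S * Submodule.span k S * Submodule.span k S = ⊥
    rw [Submodule.span_mul_span, Submodule.span_mul_span, eq_bot_iff, Submodule.span_le]
    rintro _ ⟨x, hx, _, ⟨l, hl, rfl⟩, rfl⟩
    rcases hMMs x hx with rfl | rfl
    · simp
    · have := congrArg Subtype.val (h5 l hl)
      simpa using this
  · change Submodule.span k S * Submodule.span k S ≤ _
    rw [Submodule.span_mul_span, Submodule.span_le]
    intro x hx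
    rcases hMMs x hx with rfl | rfl
    · exact Submodule.zero_mem _
    · exact Submodule.mem_span_singleton_self _
end fin

/-- For all u, v ∈ J(A), uv + vu ∈ Z(A) ∩ J(A)². -/
theorem stmt15 (k : Type) [Field k] [CharP k 3] [IsAlgClosed k]
    (A : Type) [Ring A] [Algebra k A] [FiniteDimensional k A]
    [IsLocalRing A] (hsym : IsSymmAlg k A) (hdim : finrank k A = 9)
    (hcen : Nonempty (Subalgebra.center k A ≃ₐ[k] Subalgebra.center k (Balg k))) :
    ∀ u v : A, ¬ IsUnit u → ¬ IsUnit v →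
      (u * v + v * u ∈ Subalgebra.center k A ∧ u * v + v * u ∈ radSub k A ^ 2) := by
  obtain ⟨e⟩ := hcen
  obtain ⟨v, h0, h12, hv⟩ := b_basis k
  have key : ∀ u ∈ eJ k A, u * u ∈ Subalgebra.center k A := by
    refine e_final hsym hdim (v.map e.symm.toLinearEquiv) ?_ ?_ ?_
    · rw [Basis.map_apply, h0]
      exact map_one e.symm
    · rw [Basis.map_apply, Basis.map_apply, Basis.map_apply, ← h12]
      exact (map_mul e.symm _ _).symm
    · intro i j hi hj hij hji
      rw [Basis.map_apply, Basis.map_apply]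
      refine (map_mul e.symm _ _).symm.trans ?_
      rw [hv i j hi hj hij hji, map_zero]
  intro x y hx hy
  constructor
  · have h1 := key (x + y) ((eJ k A).add_mem hx hy)
    have h2 := key x hx
    have h3 := key y hy
    have h4 : x * y + y * x = (x + y) * (x + y) - x * x - y * y := by noncomm_ring
    rw [h4]
    exact Subalgebra.sub_mem _ (Subalgebra.sub_mem _ h1 h2) h3
  · rw [pow_two]
    have hx' : x ∈ radSub k A := Submodule.subset_span hx
    have hy' : y ∈ radSub k A := Submodule.subset_span hy
    exact Submodule.add_mem _ (Submodule.mul_mem_mul hx' hy') (Submodule.mul_mem_mul hy' hx')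
end
end

section
/- Let A be a finite-dimensional local symmetric algebra over an algebraically closed field k of characteristic 3 with dim_k A = 9 and Z(A) ≅ Z(B) where B = k⟨X,Y⟩/⟨X³,Y³,XY+YX⟩. Then J(A)³ ⊆ Z(A), J(A)⁵ = 0 and J(A)⁴ = Soc(A) = (Z(A)∩J(A))². -/
open Module FreeAlgebra

noncomputable section

lemma gB_rel (k : Type) [Field k] : xB k ^ 3 = 0 ∧ yB k ^ 3 = 0 ∧ xB k * yB k + yB k * xB k = 0 := by
  have h : ∀ a, Brel k a 0 → RingQuot.mkAlgHom k (Brel k) a = 0 := fun a ha => by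
    rw [RingQuot.mkAlgHom_rel k ha, map_zero]
  refine ⟨?_, ?_, ?_⟩
  · have := h _ ⟨rfl, Or.inl rfl⟩
    rwa [map_pow] at this
  · have := h _ ⟨rfl, Or.inr (Or.inl rfl)⟩
    rwa [map_pow] at this
  · have := h _ ⟨rfl, Or.inr (Or.inr rfl)⟩
    rw [map_add, map_mul, map_mul] at this
    exact this

def gX (k : Type) [Field k] : (Fin 3 → Fin 3 → k) →ₗ[k] (Fin 3 → Fin 3 → k) where
  toFun f := ![0, f 0, f 1]
  map_add' f g := by ext i j; fin_cases i <;> simp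
  map_smul' c f := by ext i j; fin_cases i <;> simp

def gY (k : Type) [Field k] : (Fin 3 → Fin 3 → k) →ₗ[k] (Fin 3 → Fin 3 → k) where
  toFun f := ![![0, f 0 0, f 0 1], ![0, -f 1 0, -f 1 1], ![0, f 2 0, f 2 1]]
  map_add' f g := by ext i j; fin_cases i <;> fin_cases j <;> simp <;> ring
  map_smul' c f := by ext i j; fin_cases i <;> fin_cases j <;> simp

lemma gX_apply (k : Type) [Field k] (f : Fin 3 → Fin 3 → k) : gX k f = ![0, f 0, f 1] := rfl
lemma gY_apply (k : Type) [Field k] (f : Fin 3 → Fin 3 → k) : gY k f =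
  ![![0, f 0 0, f 0 1], ![0, -f 1 0, -f 1 1], ![0, f 2 0, f 2 1]] := rfl

def gFree (k : Type) [Field k] : FreeAlgebra k (Fin 2) →ₐ[k] Module.End k (Fin 3 → Fin 3 → k) :=
  FreeAlgebra.lift k ![gX k, gY k]

def gRho (k : Type) [Field k] : Balg k →ₐ[k] Module.End k (Fin 3 → Fin 3 → k) :=
  RingQuot.liftAlgHom k ⟨gFree k, by
    rintro a b ⟨rfl, h | h | h⟩ <;> subst h <;> apply LinearMap.ext <;> intro f <;> ext i j <;>
    fin_cases i <;> fin_cases j <;>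
    simp [gFree, pow_succ, gX_apply, gY_apply]⟩

lemma gRho_x (k : Type) [Field k] : gRho k (xB k) = gX k := by
  simp [gRho, xB, gFree]
lemma gRho_y (k : Type) [Field k] : gRho k (yB k) = gY k := by
  simp [gRho, yB, gFree]

/-- normal form -/
def gN {k R : Type} [Field k] [Ring R] [Algebra k R] (x y : R) (f : Fin 3 → Fin 3 → k) : R :=
  ∑ i : Fin 3, ∑ j : Fin 3, f i j • (x ^ (i : ℕ) * y ^ (j : ℕ))

lemma gN_apply (k : Type) [Field k] (f : Fin 3 → Fin 3 → k) :
    gRho k (gN (xB k) (yB k) f) ![![1,0,0],0,0] = f := by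
  ext i j
  fin_cases i <;> fin_cases j <;>
  simp [gN, Fin.sum_univ_three, gRho_x, gRho_y, pow_succ, gX_apply, gY_apply]

section gen
variable {k R : Type} [Field k] [Ring R] [Algebra k R] (x y : R)
  (hx : x ^ 3 = 0) (hy : y ^ 3 = 0) (hxy : x * y + y * x = 0)

lemma gN_x (hx : x ^ 3 = 0) (f : Fin 3 → Fin 3 → k) : x * gN x y f = gN x y (gX k f) := by
  have h3' : x * x ^ 2 = 0 := by rw [← hx]; rw [pow_succ' _ 2]
  simp [gN, Fin.sum_univ_three, gX_apply, mul_add, ← mul_assoc, h3']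
  simp [pow_two]

lemma gN_y (hy : y ^ 3 = 0) (hxy : x * y + y * x = 0) (f : Fin 3 → Fin 3 → k) :
    y * gN x y f = gN x y (gY k f) := by
  have h := eq_neg_of_add_eq_zero_right hxy
  have h3' : y * y ^ 2 = 0 := by rw [← hy]; rw [pow_succ' _ 2]
  have h2 : y * x ^ 2 = x ^ 2 * y := by
    rw [pow_two, ← mul_assoc, h, neg_mul, mul_assoc, h, mul_neg, neg_neg, mul_assoc]
  have h3'' : y * (y * y) = 0 := by rw [← pow_two, h3']
  simp [gN, Fin.sum_univ_three, gY_apply, mul_add, ← mul_assoc, h3', h, h2]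
  simp [pow_two, mul_assoc, h3'']

lemma gcommx (hx : x ^ 3 = 0) (hxy : x * y + y * x = 0) (f : Fin 3 → Fin 3 → k) : gN x y f * x =
    gN x y ![0, ![f 0 0, - f 0 1, f 0 2], ![f 1 0, -f 1 1, f 1 2]] := by
  have h := eq_neg_of_add_eq_zero_right hxy
  have h3' : x * (x * x) = 0 := by rw [← hx]; simp [pow_succ, mul_assoc]
  have h3'' : ∀ t, x * (x * (x * t)) = 0 := fun t => by
    rw [← mul_assoc x x t, ← mul_assoc, h3', zero_mul]
  have e : ∀ t, y * (x * t) = - (x * (y * t)) := fun t => by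
    rw [← mul_assoc, h, neg_mul, mul_assoc]
  simp [gN, Fin.sum_univ_three, pow_two, add_mul, mul_assoc, h, e, h3', h3'']
  try abel

lemma gcommy (hy : y ^ 3 = 0) (f : Fin 3 → Fin 3 → k) : gN x y f * y =
    gN x y ![![0, f 0 0, f 0 1], ![0, f 1 0, f 1 1], ![0, f 2 0, f 2 1]] := by
  have h3' : y * (y * y) = 0 := by rw [← hy]; simp [pow_succ, mul_assoc]
  simp [gN, Fin.sum_univ_three, pow_two, add_mul, mul_assoc, h3']
end gen

lemma gN_surj (k : Type) [Field k] (b : Balg k) : ∃ f : Fin 3 → Fin 3 → k, b = gN (xB k) (yB k) f := by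
  have hadd : ∀ f g : Fin 3 → Fin 3 → k, gN (xB k) (yB k) f + gN (xB k) (yB k) g = gN (xB k) (yB k) (f + g) := fun f g => by
    simp [gN, Fin.sum_univ_three, add_smul]; abel
  have smul : ∀ (c : k) (f : Fin 3 → Fin 3 → k), c • gN (xB k) (yB k) f = gN (xB k) (yB k) (c • f) := fun c f => by
    simp [gN, Fin.sum_univ_three, smul_smul]
  have key : ∀ p : FreeAlgebra k (Fin 2), ∀ f : Fin 3 → Fin 3 → k, ∃ g : Fin 3 → Fin 3 → k, RingQuot.mkAlgHom k (Brel k) p * gN (xB k) (yB k) f = gN (xB k) (yB k) g := by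
    intro p
    induction p using FreeAlgebra.induction with
    | grade0 c => intro f; exact ⟨c • f, by rw [AlgHom.commutes, ← Algebra.smul_def, smul]⟩
    | grade1 i =>
      intro f
      fin_cases i
      · exact ⟨_, gN_x (xB k) (yB k) (gB_rel k).1 f⟩
      · exact ⟨_, gN_y (xB k) (yB k) (gB_rel k).2.1 (gB_rel k).2.2 f⟩
    | mul a b ha hb =>
      intro f
      obtain ⟨g, hg⟩ := hb f
      obtain ⟨g', hg'⟩ := ha g
      exact ⟨g', by rw [map_mul, mul_assoc, hg, hg']⟩
    | add a b ha hb =>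
      intro f
      obtain ⟨g, hg⟩ := hb f
      obtain ⟨g', hg'⟩ := ha f
      exact ⟨g' + g, by rw [map_add, add_mul, hg, hg', hadd]⟩
  obtain ⟨p, rfl⟩ := RingQuot.mkAlgHom_surjective k (Brel k) b
  obtain ⟨g, hg⟩ := key p ![![1,0,0],0,0]
  refine ⟨g, ?_⟩
  rw [← hg]
  simp [gN, Fin.sum_univ_three]

lemma gN_inj (k : Type) [Field k] (f g : Fin 3 → Fin 3 → k)
    (h : gN (xB k) (yB k) f = gN (xB k) (yB k) g) : f = g := by
  rw [← gN_apply k f, h, gN_apply]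

lemma gB_center_iff (k : Type) [Field k] [CharP k 3] (f : Fin 3 → Fin 3 → k) :
    gN (xB k) (yB k) f ∈ Subalgebra.center k (Balg k) ↔ f 0 1 = 0 ∧ f 1 0 = 0 ∧ f 1 1 = 0 := by
  obtain ⟨hx, hy, hxy⟩ := gB_rel k
  have h2 : (2 : k) ≠ 0 := by
    intro h
    have h3 : ((3 : ℕ) : k) = 0 := CharP.cast_eq_zero k 3
    push_cast at h3
    exact one_ne_zero (α := k) (by linear_combination h3 - h)
  have hneg : ∀ t : k, t = -t → t = 0 := fun t ht => by
    have : 2 * t = 0 := by linear_combination ht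
    exact (mul_eq_zero.mp this).resolve_left h2
  rw [Subalgebra.mem_center_iff]
  constructor
  · intro h
    have h1 := gN_inj k _ _ ((gN_x _ _ hx f).symm.trans ((h (xB k)).trans (gcommx _ _ hx hxy f)))
    have h2 := gN_inj k _ _ ((gN_y _ _ hy hxy f).symm.trans ((h (yB k)).trans (gcommy _ _ hy f)))
    have e1 := congrFun (congrFun h1 1) 1
    have e2 := congrFun (congrFun h1 2) 1
    have e3 := congrFun (congrFun h2 1) 1
    simp [gX_apply, gY_apply] at e1 e2 e3
    exact ⟨hneg _ e1, hneg _ e3.symm, hneg _ e2⟩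
  · rintro ⟨h1, h2, h3⟩ b
    have cx : xB k * gN (xB k) (yB k) f = gN (xB k) (yB k) f * xB k := by
      rw [gN_x _ _ hx, gcommx _ _ hx hxy]
      congr 1; ext i j; fin_cases i <;> fin_cases j <;> simp [gX_apply, h1, h2, h3]
    have cy : yB k * gN (xB k) (yB k) f = gN (xB k) (yB k) f * yB k := by
      rw [gN_y _ _ hy hxy, gcommy _ _ hy]
      congr 1; ext i j; fin_cases i <;> fin_cases j <;> simp [gY_apply, h1, h2, h3]
    obtain ⟨p, rfl⟩ := RingQuot.mkAlgHom_surjective k (Brel k) b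
    induction p using FreeAlgebra.induction with
    | grade0 c => rw [AlgHom.commutes]; exact Algebra.commutes _ _
    | grade1 i =>
      fin_cases i
      · exact cx
      · exact cy
    | mul a b ha hb => rw [map_mul, mul_assoc, hb, ← mul_assoc, ha, mul_assoc]
    | add a b ha hb => rw [map_add, add_mul, mul_add, ha, hb]

lemma gB_center_ex (k : Type) [Field k] [CharP k 3] :
    ∃ a b c d : Subalgebra.center k (Balg k),
      a * a = 0 ∧ b * b = 0 ∧ a * c = 0 ∧ a * d = 0 ∧ b * c = 0 ∧ b * d = 0 ∧ c * c = 0 ∧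
      c * d = 0 ∧ d * d = 0 ∧
      (∀ z, ∃ v : Fin 6 → k, z = v 0 • 1 + v 1 • a + v 2 • b + v 3 • c + v 4 • d + v 5 • (a * b)) ∧
      (∀ v : Fin 6 → k, v 0 • 1 + v 1 • a + v 2 • b + v 3 • c + v 4 • d + v 5 • (a * b) = 0 → v = 0) := by
  obtain ⟨hx, hy, hxy⟩ := gB_rel k
  let m : (Fin 3 → Fin 3 → k) → Balg k := gN (xB k) (yB k)
  have memZ : ∀ f : Fin 3 → Fin 3 → k, f 0 1 = 0 ∧ f 1 0 = 0 ∧ f 1 1 = 0 →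
    m f ∈ Subalgebra.center k (Balg k) := fun f => (gB_center_iff k f).2
  have m1 : m ![![0,0,0],![0,0,0],![1,0,0]] = xB k ^ 2 := by simp [m, gN, Fin.sum_univ_three]
  have m2 : m ![![0,0,1],![0,0,0],![0,0,0]] = yB k ^ 2 := by simp [m, gN, Fin.sum_univ_three]
  have m3 : m ![![0,0,0],![0,0,0],![0,1,0]] = xB k ^ 2 * yB k := by simp [m, gN, Fin.sum_univ_three]
  have m4 : m ![![0,0,0],![0,0,1],![0,0,0]] = xB k * yB k ^ 2 := by simp [m, gN, Fin.sum_univ_three]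
  have z1 : xB k ^ 2 ∈ Subalgebra.center k (Balg k) := m1 ▸ memZ _ (by simp)
  have z2 : yB k ^ 2 ∈ Subalgebra.center k (Balg k) := m2 ▸ memZ _ (by simp)
  have z3 : xB k ^ 2 * yB k ∈ Subalgebra.center k (Balg k) := m3 ▸ memZ _ (by simp)
  have z4 : xB k * yB k ^ 2 ∈ Subalgebra.center k (Balg k) := m4 ▸ memZ _ (by simp)
  have hx4 : xB k ^ 2 * xB k ^ 2 = 0 := by rw [← pow_add, pow_succ, hx, zero_mul]
  have hy4 : yB k ^ 2 * yB k ^ 2 = 0 := by rw [← pow_add, pow_succ, hy, zero_mul]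
  have hx3 : xB k ^ 2 * xB k = 0 := by rw [← pow_succ, hx]
  have hy3 : yB k * yB k ^ 2 = 0 := by rw [← pow_succ', hy]
  have c1 := Subalgebra.mem_center_iff.1 z1
  have c2 := Subalgebra.mem_center_iff.1 z2
  have key : ∀ v : Fin 6 → k, v 0 • (1 : Balg k) + v 1 • xB k ^ 2 + v 2 • yB k ^ 2 +
      v 3 • (xB k ^ 2 * yB k) + v 4 • (xB k * yB k ^ 2) + v 5 • (xB k ^ 2 * yB k ^ 2) =
      m ![![v 0, 0, v 2], ![0, 0, v 4], ![v 1, v 3, v 5]] := by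
    intro v
    simp [m, gN, Fin.sum_univ_three]
    abel
  refine ⟨⟨_, z1⟩, ⟨_, z2⟩, ⟨_, z3⟩, ⟨_, z4⟩, ?_, ?_, ?_, ?_, ?_, ?_, ?_, ?_, ?_, ?_, ?_⟩
  · exact Subtype.ext hx4
  · exact Subtype.ext hy4
  · exact Subtype.ext (by simp [← mul_assoc, hx4])
  · exact Subtype.ext (by simp [← mul_assoc, hx3])
  · exact Subtype.ext (by
      change yB k ^ 2 * (xB k ^ 2 * yB k) = 0
      rw [← c2, mul_assoc, hy3, mul_zero])
  · exact Subtype.ext (by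
      change yB k ^ 2 * (xB k * yB k ^ 2) = 0
      rw [← c2, mul_assoc, hy4, mul_zero])
  · exact Subtype.ext (by
      change xB k ^ 2 * yB k * (xB k ^ 2 * yB k) = 0
      rw [mul_assoc, ← mul_assoc (yB k), c1 (yB k), mul_assoc, ← mul_assoc, hx4, zero_mul])
  · exact Subtype.ext (by
      change xB k ^ 2 * yB k * (xB k * yB k ^ 2) = 0
      rw [c2 (xB k), mul_assoc, ← mul_assoc (yB k), hy3, zero_mul, mul_zero])
  · exact Subtype.ext (by
      change xB k * yB k ^ 2 * (xB k * yB k ^ 2) = 0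
      rw [mul_assoc, ← c2 (xB k * yB k ^ 2), mul_assoc, hy4, mul_zero, mul_zero])
  · rintro ⟨z, hz⟩
    obtain ⟨f, rfl⟩ := gN_surj k z
    obtain ⟨h1, h2, h3⟩ := (gB_center_iff k f).1 hz
    refine ⟨![f 0 0, f 2 0, f 0 2, f 2 1, f 1 2, f 2 2], Subtype.ext ?_⟩
    refine Eq.trans ?_ (key _).symm
    change m f = m _
    congr 1
    ext i j
    fin_cases i <;> fin_cases j <;> simp [h1, h2, h3]
  · intro v hv
    have h0 : m ![![v 0, 0, v 2], ![0, 0, v 4], ![v 1, v 3, v 5]] = m 0 := by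
      rw [← key]
      refine (congrArg Subtype.val hv).trans ?_
      simp [m, gN]
    have h := gN_inj k _ _ h0
    ext i
    fin_cases i
    · exact congrFun (congrFun h 0) 0
    · exact congrFun (congrFun h 2) 0
    · exact congrFun (congrFun h 0) 2
    · exact congrFun (congrFun h 2) 1
    · exact congrFun (congrFun h 1) 2
    · exact congrFun (congrFun h 2) 2

/-- Abstract data of a local symmetric algebra. -/
structure gSD (k A : Type) [Field k] [Ring A] [Algebra k A] (J : Submodule k A)
    (s : A →ₗ[k] k) : Prop where
  tr : ∀ x y : A, s (x * y) = s (y * x)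
  nd : ∀ a : A, (∀ b, s (b * a) = 0) → a = 0
  dec : ∀ a : A, ∃ c : k, ∃ j ∈ J, a = algebraMap k A c + j
  left : ∀ a j : A, j ∈ J → a * j ∈ J
  right : ∀ a j : A, j ∈ J → j * a ∈ J
  nil : ∃ n, J ^ n = ⊥

section abs
variable {k A : Type} [Field k] [Ring A] [Algebra k A] {J : Submodule k A} {s : A →ₗ[k] k}

lemma gSD.soc_s (h : gSD k A J s) {p : A} (hp : ∀ j ∈ J, j * p = 0) (hs : s p = 0) : p = 0 := by
  refine h.nd p fun b => ?_
  obtain ⟨c, j, hj, rfl⟩ := h.dec b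
  rw [add_mul, hp j hj, add_zero, ← Algebra.smul_def, map_smul, hs, smul_zero]

lemma gSD.soc_right (h : gSD k A J s) {p : A} (hp : ∀ j ∈ J, j * p = 0) :
    ∀ j ∈ J, p * j = 0 := by
  intro j hj
  refine h.nd _ fun b => ?_
  rw [← mul_assoc, h.tr, ← mul_assoc, hp _ (h.right b j hj), map_zero]

lemma gSD.comm_eq (h : gSD k A J s) (a b : A) : ∃ j ∈ J, ∃ j' ∈ J, a * b - b * a = j * j' - j' * j := by
  obtain ⟨c, j, hj, rfl⟩ := h.dec a
  obtain ⟨c', j', hj', rfl⟩ := h.dec b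
  refine ⟨j, hj, j', hj', ?_⟩
  have h1 := Algebra.commutes c j'
  have h2 := Algebra.commutes c' j
  have h3 := Algebra.commutes c (algebraMap k A c')
  simp only [add_mul, mul_add, h1, h2, h3]
  abel

lemma gSD.comm_mem (h : gSD k A J s) (a b : A) : a * b - b * a ∈ J ^ 2 := by
  obtain ⟨j, hj, j', hj', e⟩ := h.comm_eq a b
  rw [e, pow_two]
  exact Submodule.sub_mem _ (Submodule.mul_mem_mul hj hj') (Submodule.mul_mem_mul hj' hj)

lemma gSD.pow_left (h : gSD k A J s) (n : ℕ) (a j : A) (hj : j ∈ J ^ (n+1)) : a * j ∈ J ^ (n+1) := by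
  rw [pow_succ'] at hj ⊢
  induction hj using Submodule.mul_induction_on' with
  | mem_mul_mem m hm n hn => rw [← mul_assoc]; exact Submodule.mul_mem_mul (h.left a m hm) hn
  | add x _ y _ hx hy => rw [mul_add]; exact Submodule.add_mem _ hx hy

lemma gSD.pow_anti (h : gSD k A J s) (n : ℕ) : J ^ (n+2) ≤ J ^ (n+1) := by
  rw [pow_succ' J (n+1), Submodule.mul_le]
  intro a _ b hb
  exact h.pow_left n a b hb

lemma gSD.exists_soc (h : gSD k A J s) (P : Submodule k A) (hP : P ≠ ⊥)
    (hl : ∀ a p : A, p ∈ P → a * p ∈ P) : ∃ p ∈ P, p ≠ 0 ∧ ∀ j ∈ J, j * p = 0 := by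
  have key : ∀ n : ℕ, ∀ p ∈ P, p ≠ 0 → (∀ q ∈ J ^ n, q * p = 0) →
      ∃ p ∈ P, p ≠ 0 ∧ ∀ j ∈ J, j * p = 0 := by
    intro n
    induction n with
    | zero =>
      intro p _ hp0 hq
      exact absurd (by simpa using hq 1 (by rw [pow_zero]; exact Submodule.one_le.mp le_rfl)) hp0
    | succ n ih =>
      intro p hp hp0 hq
      by_cases hj : ∀ j ∈ J, j * p = 0
      · exact ⟨p, hp, hp0, hj⟩
      · push Not at hj
        obtain ⟨j, hj, hjp⟩ := hj
        refine ih (j * p) (hl _ _ hp) hjp fun q hqn => ?_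
        rw [← mul_assoc]
        exact hq _ (by rw [pow_succ]; exact Submodule.mul_mem_mul hqn hj)
  obtain ⟨n, hn⟩ := h.nil
  obtain ⟨p, hp, hp0⟩ := Submodule.exists_mem_ne_zero_of_ne_bot hP
  refine key n p hp hp0 fun q hq => ?_
  rw [hn, Submodule.mem_bot] at hq
  rw [hq, zero_mul]

lemma gSD.gen (h : gSD k A J s) (I : Submodule k A) (hl : ∀ a i : A, i ∈ I → a * i ∈ I)
    (hr : ∀ a i : A, i ∈ I → i * a ∈ I) (x : A) (hx : x ∈ J)
    (hJ : ∀ j ∈ J, ∃ c : k, ∃ q ∈ J ^ 2, ∃ i ∈ I, j = c • x + q + i) (a : A) :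
    ∃ t ∈ Algebra.adjoin k {x}, ∃ i ∈ I, a = t + i := by
  have step : ∀ n : ℕ, ∀ p ∈ J ^ (n+1), ∃ c : k, ∃ q ∈ J ^ (n+2), ∃ i ∈ I,
      p = c • x ^ (n+1) + q + i := by
    intro n
    induction n with
    | zero => intro p hp; simpa using hJ p (by simpa using hp)
    | succ n ih =>
      intro p hp
      rw [pow_succ] at hp
      induction hp using Submodule.mul_induction_on' with
      | mem_mul_mem m hm r hr' =>
        obtain ⟨c, q, hq, i, hi, rfl⟩ := ih m hm
        obtain ⟨c', q', hq', i', hi', rfl⟩ := hJ r hr'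
        refine ⟨c * c', c • x ^ (n+1) * q' + q * (c' • x + q' + i'), ?_,
          c • x ^ (n+1) * i' + i * (c' • x + q' + i'), ?_, ?_⟩
        · refine Submodule.add_mem _ ?_ ?_
          · rw [show n + 1 + 2 = (n + 1) + 2 from rfl, pow_add J (n+1) 2]
            exact Submodule.mul_mem_mul (Submodule.smul_mem _ _ (Submodule.pow_mem_pow J hx _)) hq'
          · rw [show n + 1 + 2 = (n + 2) + 1 from rfl, pow_succ J (n+2)]
            exact Submodule.mul_mem_mul hq hr'
        · exact Submodule.add_mem _ (hl _ _ hi') (hr _ _ hi)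
        · simp only [add_mul, mul_add, smul_mul_assoc, mul_smul_comm, smul_add, smul_smul, pow_succ x (n+1), mul_comm c' c]
          abel
      | add u _ v _ hu hv =>
        obtain ⟨c, q, hq, i, hi, rfl⟩ := hu
        obtain ⟨c', q', hq', i', hi', rfl⟩ := hv
        refine ⟨c + c', q + q', Submodule.add_mem _ hq hq', i + i', Submodule.add_mem _ hi hi', ?_⟩
        rw [add_smul]; abel
  obtain ⟨N, hN⟩ := h.nil
  have down : ∀ d n : ℕ, N ≤ n + 1 + d → ∀ p ∈ J ^ (n+1), ∃ t ∈ Algebra.adjoin k {x}, ∃ i ∈ I, p = t + i := by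
    intro d
    induction d with
    | zero =>
      intro n hn p hp
      have : J ^ (n+1) = ⊥ := by
        obtain ⟨m, hm⟩ := Nat.exists_eq_add_of_le hn
        rw [show n + 1 = N + m by omega, pow_add, hN]; exact Submodule.bot_mul _
      rw [this, Submodule.mem_bot] at hp
      exact ⟨0, zero_mem _, 0, zero_mem _, by simp [hp]⟩
    | succ d ih =>
      intro n hn p hp
      obtain ⟨c, q, hq, i, hi, rfl⟩ := step n p hp
      obtain ⟨t, ht, i', hi', rfl⟩ := ih (n+1) (by omega) q hq
      refine ⟨c • x ^ (n+1) + t, add_mem (Subalgebra.smul_mem _ (pow_mem (Algebra.self_mem_adjoin_singleton k x) _) _) ht,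
        i' + i, add_mem hi' hi, by abel⟩
  obtain ⟨c, j, hj, rfl⟩ := h.dec a
  obtain ⟨t, ht, i, hi, rfl⟩ := down N 0 (by omega) j (by simpa using hj)
  exact ⟨algebraMap k A c + t, add_mem (Subalgebra.algebraMap_mem _ _) ht, i, hi, by abel⟩

lemma g_span_one [FiniteDimensional k A] (U V : Submodule k A) (hUV : U ≤ V)
    (hd : finrank k V ≤ finrank k U + 1) : ∃ x ∈ V, V ≤ Submodule.span k {x} ⊔ U := by
  by_cases hV : V ≤ U
  · exact ⟨0, zero_mem _, hV.trans le_sup_right⟩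
  · obtain ⟨x, hx, hxU⟩ := Set.not_subset.1 hV
    refine ⟨x, hx, ?_⟩
    have h1 : Submodule.span k {x} ⊔ U ≤ V := sup_le (by simpa using hx) hUV
    have h2 : U < Submodule.span k {x} ⊔ U := lt_of_le_of_ne le_sup_right fun e =>
      hxU (e ▸ Submodule.mem_sup_left (Submodule.mem_span_singleton_self x))
    have h3 := Submodule.finrank_lt_finrank_of_lt h2
    exact (Submodule.eq_of_le_of_finrank_le h1 (by omega)).ge

lemma gSD.gen_dim [FiniteDimensional k A] (h : gSD k A J s) (I : Submodule k A) (hIJ : I ≤ J)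
    (hl : ∀ a i : A, i ∈ I → a * i ∈ I)
    (hr : ∀ a i : A, i ∈ I → i * a ∈ I) (z : A) 
    (hI : ∀ a i : A, i ∈ I → z * (a * i - i * a) = 0)
    (hc : ∃ a b : A, z * (a * b - b * a) ≠ 0) :
    finrank k (J ^ 2 ⊔ I : Submodule k A) + 2 ≤ finrank k J := by
  by_contra hlt
  have hJ2 : J ^ 2 ≤ J := by simpa using h.pow_anti 0
  obtain ⟨x, hx, hxV⟩ := g_span_one (J ^ 2 ⊔ I) J (sup_le hJ2 hIJ) (by omega)
  have hg := h.gen I hl hr x hx (fun j hj => by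
    obtain ⟨u, hu, v, hv, rfl⟩ := Submodule.mem_sup.1 (hxV hj)
    obtain ⟨c, rfl⟩ := Submodule.mem_span_singleton.1 hu
    obtain ⟨q, hq, i, hi, rfl⟩ := Submodule.mem_sup.1 hv
    exact ⟨c, q, hq, i, hi, by abel⟩)
  obtain ⟨a, b, hab⟩ := hc
  apply hab
  obtain ⟨t, ht, i, hi, rfl⟩ := hg a
  obtain ⟨t', ht', i', hi', rfl⟩ := hg b
  have e : t * t' = t' * t := by
    have := Algebra.adjoin_singleton_eq_range_aeval k x
    rw [this] at ht ht'
    obtain ⟨p, rfl⟩ := ht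
    obtain ⟨p', rfl⟩ := ht'
    change Polynomial.aeval x p * Polynomial.aeval x p' = Polynomial.aeval x p' * Polynomial.aeval x p
    rw [← map_mul, mul_comm, map_mul]
  have e1 := hI (t + i) i' hi'
  have e2 := hI t' i hi
  have : (t + i) * (t' + i') - (t' + i') * (t + i) =
    ((t + i) * i' - i' * (t + i)) - (t' * i - i * t') + (t * t' - t' * t) := by noncomm_ring
  rw [this, mul_add, mul_sub, e1, e2, e]; simp

/-- commutators times `z` -/
def gK (k : Type) {A : Type} [Field k] [Ring A] [Algebra k A] (z : A) : Submodule k A :=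
  Submodule.span k {w | ∃ a b : A, w = z * (a * b - b * a)}

/-- elements whose multiple by z commutes with everything -/
def gW (k : Type) {A : Type} [Field k] [Ring A] [Algebra k A] (z : A) : Submodule k A where
  carrier := {a | ∀ b, z * (a * b - b * a) = 0}
  add_mem' := by
    intro a b ha hb c
    have : (a + b) * c - c * (a + b) = (a * c - c * a) + (b * c - c * b) := by noncomm_ring
    rw [this, mul_add, ha c, hb c, add_zero]
  zero_mem' := by intro b; simp
  smul_mem' := by
    intro c a ha b
    rw [smul_mul_assoc, mul_smul_comm, ← smul_sub, mul_smul_comm, ha b, smul_zero]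

lemma gSD.dual [FiniteDimensional k A] (h : gSD k A J s) (z : A) (hz : ∀ a, z * a = a * z) :
    finrank k A ≤ finrank k (gW k z) + finrank k (gK k z) := by
  let f : A →ₗ[k] Module.Dual k (gK k z) :=
    (LinearMap.lcomp k k (gK k z).subtype) ∘ₗ (LinearMap.llcomp k A A k s) ∘ₗ (LinearMap.mul k A)
  have hf : ∀ a (w : gK k z), f a w = s (a * w) := fun a w => rfl
  have hker : LinearMap.ker f ≤ gW k z := by
    intro a ha b
    refine h.nd _ fun c => ?_
    have h1 := hf a ⟨z * (b * c - c * b), Submodule.subset_span ⟨b, c, rfl⟩⟩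
    rw [LinearMap.mem_ker.1 ha] at h1
    have h2 : s (a * (z * (b * c - c * b))) = 0 := h1.symm
    rw [← h2]
    have e1 : c * (z * (a * b - b * a)) = (c * (z * a * b)) - (z * c * b) * a := by
      rw [hz c]; noncomm_ring
    have e2 : a * (z * (b * c - c * b)) = (z * a * b) * c - a * (z * c * b) := by
      rw [hz a]; noncomm_ring
    rw [e1, e2, map_sub, map_sub, h.tr c, h.tr _ a]
  have h1 := f.finrank_range_add_finrank_ker
  have h2 := Submodule.finrank_mono hker
  have h3 := Submodule.finrank_le (LinearMap.range f)
  rw [Subspace.dual_finrank_eq] at h3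
  omega

lemma gSD.s_K (h : gSD k A J s) (z : A) (hz : ∀ a, z * a = a * z) : ∀ w ∈ gK k z, s w = 0 := by
  intro w hw
  induction hw using Submodule.span_induction with
  | mem x hx =>
    obtain ⟨a, b, rfl⟩ := hx
    have : z * (a * b - b * a) = (z * a) * b - b * (z * a) := by
      rw [← mul_assoc b z, ← hz b]; noncomm_ring
    rw [this, map_sub, h.tr, sub_self]
  | zero => simp
  | add x y _ _ hx hy => rw [map_add, hx, hy, add_zero]
  | smul c x _ hx => rw [map_smul, hx, smul_zero]

lemma gSD.small [FiniteDimensional k A] (h : gSD k A J s) (z : A) (hz : ∀ a, z * a = a * z)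
    (hd : finrank k J ≤ 8) (hA : finrank k A = 9)
    (hker : 4 ≤ finrank k (LinearMap.ker (LinearMap.mulLeft k z))) (a b : A) :
    z * (a * b - b * a) = 0 := by
  by_contra hab
  have hz0 : z ≠ 0 := by rintro rfl; simp at hab
  set I := LinearMap.ker (LinearMap.mulLeft k z) with hI
  have memI : ∀ i, i ∈ I ↔ z * i = 0 := fun i => by simp [hI]
  have hl : ∀ a i : A, i ∈ I → a * i ∈ I := fun a i hi => by
    rw [memI] at *; rw [← mul_assoc, hz, mul_assoc, hi, mul_zero]
  have hr : ∀ a i : A, i ∈ I → i * a ∈ I := fun a i hi => by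
    rw [memI] at *; rw [← mul_assoc, hi, zero_mul]
  have hIJ : I ≤ J := by
    intro i hi
    obtain ⟨c, j, hj, rfl⟩ := h.dec i
    by_cases hc : c = 0
    · simpa [hc] using hj
    · exfalso
      obtain ⟨n, hn⟩ := h.nil
      rw [memI, mul_add, ← Algebra.commutes, ← Algebra.smul_def] at hi
      have hzj : z * j = (-c) • z := by rw [neg_smul]; exact eq_neg_of_add_eq_zero_right hi
      have : ∀ m : ℕ, z * j ^ m = (-c) ^ m • z := by
        intro m
        induction m with
        | zero => simp
        | succ m ih => rw [pow_succ, ← mul_assoc, ih, smul_mul_assoc, hzj, smul_smul, ← pow_succ]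
      have h1 := this n
      have h2 : j ^ n ∈ J ^ n := Submodule.pow_mem_pow J hj n
      rw [hn, Submodule.mem_bot] at h2
      rw [h2, mul_zero] at h1
      rcases smul_eq_zero.1 h1.symm with h3 | h3
      · exact hc (by simpa using eq_zero_of_pow_eq_zero h3)
      · exact hz0 h3
  have g := h.gen_dim I hIJ hl hr z (fun a i hi => by
    rw [mul_sub, (memI _).1 (hl a i hi), (memI _).1 (hr a i hi), sub_zero]) ⟨a, b, hab⟩
  -- P = z J^2
  let P : Submodule k A := (J ^ 2).map (LinearMap.mulLeft k z)
  have hPU : P = (J ^ 2 ⊔ I).map (LinearMap.mulLeft k z) := by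
    rw [Submodule.map_sup]
    have : I.map (LinearMap.mulLeft k z) = ⊥ := by
      rw [eq_bot_iff]; rintro _ ⟨i, hi, rfl⟩; exact hi
    rw [this, sup_bot_eq]
  have hPdim : finrank k P + finrank k I = finrank k (J ^ 2 ⊔ I : Submodule k A) := by
    have := ((LinearMap.mulLeft k z).domRestrict (J ^ 2 ⊔ I)).finrank_range_add_finrank_ker
    rw [LinearMap.range_domRestrict, ← hPU, LinearMap.ker_domRestrict] at this
    rw [← this]
    congr 1
    exact (Submodule.comapSubtypeEquivOfLe (le_sup_right : I ≤ J ^ 2 ⊔ I)).finrank_eq.symm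
  have hKP : gK k z ≤ P := by
    rw [gK, Submodule.span_le]
    rintro _ ⟨a, b, rfl⟩
    exact ⟨_, h.comm_mem a b, rfl⟩
  have hK0 : z * (a * b - b * a) ∈ gK k z := Submodule.subset_span ⟨a, b, rfl⟩
  obtain ⟨p, hp, hp0, hpJ⟩ := h.exists_soc P (fun e => hab (by simpa [e] using hKP hK0)) (by
    rintro a _ ⟨j, hj, rfl⟩
    exact ⟨a * j, h.pow_left 1 a j hj, by
      simp only [LinearMap.mulLeft_apply]; rw [← mul_assoc, hz, mul_assoc]⟩)
  have hpK : p ∉ gK k z := fun hpK => hp0 (h.soc_s hpJ (h.s_K z hz p hpK))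
  have hK2 : 2 ≤ finrank k (gK k z) := by
    by_contra hlt
    have hd := h.dual z hz
    obtain ⟨x, -, hx⟩ := g_span_one (gW k z) ⊤ le_top (by rw [finrank_top]; omega)
    have : ∀ u, ∃ c : k, ∃ w ∈ gW k z, u = c • x + w := fun u => by
      obtain ⟨u', hu', v, hv, rfl⟩ := Submodule.mem_sup.1 (hx (Submodule.mem_top : u ∈ ⊤))
      obtain ⟨c, rfl⟩ := Submodule.mem_span_singleton.1 hu'
      exact ⟨c, v, hv, rfl⟩
    obtain ⟨c, w, hw, rfl⟩ := this a
    obtain ⟨c', w', hw', rfl⟩ := this b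
    apply hab
    have e : (c • x + w) * (c' • x + w') - (c' • x + w') * (c • x + w) =
       (w * (c' • x + w') - (c' • x + w') * w) - c • (w' * x - x * w') := by
      simp only [add_mul, mul_add, smul_mul_assoc, mul_smul_comm, smul_sub, smul_add, smul_smul, mul_comm c c']
      abel
    rw [e, mul_sub, hw, mul_smul_comm, hw' x]; simp
  have hlt : gK k z < gK k z ⊔ Submodule.span k {p} := lt_of_le_of_ne le_sup_left fun e =>
    hpK (e ▸ Submodule.mem_sup_right (Submodule.mem_span_singleton_self p))
  have h1 := Submodule.finrank_lt_finrank_of_lt hlt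
  have h2 := Submodule.finrank_mono (sup_le hKP (by simpa using hp) : gK k z ⊔ Submodule.span k {p} ≤ P)
  omega

lemma gSD.main [FiniteDimensional k A] (h : gSD k A J s)
    (hd : finrank k J = 8) (hA : finrank k A = 9) (N : Submodule k A)
    (hNc : ∀ z ∈ N, ∀ a, z * a = a * z) (hNJ : N ≤ J)
    (hNmax : ∀ z ∈ J, (∀ a, z * a = a * z) → z ∈ N) (hN5 : finrank k N = 5)
    (hW : finrank k (gW k (1 : A)) ≤ 6)
    (e : A) (he0 : e ≠ 0) (heN : e ∈ N * N) (hNN : ∀ z ∈ N, ∀ z' ∈ N, ∃ c : k, z * z' = c • e)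
    (hT : ∀ T : Submodule k A, (∀ t ∈ T, t ∈ N ∧ ∀ n ∈ N, t * n = 0) → finrank k T ≤ 3) :
    J ^ 3 ≤ N ∧ J ^ 5 = ⊥ ∧ J ^ 4 = Submodule.span k {e} ∧ N ^ 2 = Submodule.span k {e} ∧
      ∀ p, (∀ j ∈ J, j * p = 0 ∧ p * j = 0) ↔ p ∈ Submodule.span k {e} := by
  -- N kills commutators
  have hNK : ∀ z ∈ N, ∀ a b, z * (a * b - b * a) = 0 := by
    intro z hz
    refine h.small z (hNc z hz) hd.le hA ?_
    let f : N →ₗ[k] A := (LinearMap.mulLeft k z).domRestrict N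
    have hr : LinearMap.range f ≤ Submodule.span k {e} := by
      rintro _ ⟨n, rfl⟩
      obtain ⟨c, hc⟩ := hNN z hz n n.2
      exact Submodule.mem_span_singleton.2 ⟨c, hc.symm⟩
    have h1 := f.finrank_range_add_finrank_ker
    have h2 := Submodule.finrank_mono hr
    rw [finrank_span_singleton he0] at h2
    have h3 : finrank k (LinearMap.ker f) ≤ finrank k (LinearMap.ker (LinearMap.mulLeft k z)) := by
      rw [← LinearMap.finrank_range_of_inj
        (f := N.subtype ∘ₗ (LinearMap.ker f).subtype)
        (Subtype.val_injective.comp Subtype.val_injective)]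
      refine Submodule.finrank_mono ?_
      rintro _ ⟨n, rfl⟩
      exact n.2
    omega
  have hNl : ∀ a z : A, z ∈ N → a * z ∈ N := by
    intro a z hz
    refine hNmax _ (h.left a z (hNJ hz)) fun b => ?_
    have := hNK z hz a b
    have e1 : a * z * b = z * (a * b) := by rw [← hNc z hz a, mul_assoc]
    have e2 : b * (a * z) = z * (b * a) := by rw [← mul_assoc, ← hNc z hz]
    rw [e1, e2, ← sub_eq_zero, ← mul_sub, this]
  have hNr : ∀ a z : A, z ∈ N → z * a ∈ N := fun a z hz => by rw [hNc z hz]; exact hNl a z hz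
  have hKN : ∀ z ∈ N, ∀ a b, (a * b - b * a) * z = 0 := fun z hz a b => by
    rw [← hNc z hz, hNK z hz]
  -- N^2
  have hN2 : N ^ 2 = Submodule.span k {e} := by
    rw [pow_two]
    apply le_antisymm
    · rw [Submodule.mul_le]
      intro m hm n hn
      obtain ⟨c, hc⟩ := hNN m hm n hn
      exact Submodule.mem_span_singleton.2 ⟨c, hc.symm⟩
    · simpa using heN
  have hlN2 : ∀ a p, p ∈ N * N → a * p ∈ N * N := by
    intro a p hp
    induction hp using Submodule.mul_induction_on' with
    | mem_mul_mem m hm n hn => rw [← mul_assoc]; exact Submodule.mul_mem_mul (hNl a m hm) hn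
    | add x _ y _ hx hy => rw [mul_add]; exact Submodule.add_mem _ hx hy
  have hN2' : N * N = Submodule.span k {e} := by rw [← hN2, pow_two]
  have hesoc : ∀ j ∈ J, j * e = 0 := by
    obtain ⟨p, hp, hp0, hpJ⟩ := h.exists_soc (N * N) (fun e0 => he0 (by simpa [e0] using heN)) hlN2
    rw [hN2'] at hp
    obtain ⟨c, rfl⟩ := Submodule.mem_span_singleton.1 hp
    intro j hj
    have := hpJ j hj
    rw [mul_smul_comm] at this
    exact (smul_eq_zero.1 this).resolve_left (fun hc => hp0 (by simp [hc]))
  have hse : s e ≠ 0 := fun h0 => he0 (h.soc_s hesoc h0)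
  have soc_iff : ∀ p, (∀ j ∈ J, j * p = 0) → p ∈ Submodule.span k {e} := by
    intro p hp
    refine Submodule.mem_span_singleton.2 ⟨s p / s e, ?_⟩
    rw [← sub_eq_zero]
    refine h.soc_s (fun j hj => ?_) ?_
    · rw [mul_sub, mul_smul_comm, hesoc j hj, hp j hj]; simp
    · rw [map_sub, map_smul, smul_eq_mul, div_mul_cancel₀ _ hse, sub_self]
  have soc_span : ∀ p ∈ Submodule.span k {e}, ∀ j ∈ J, j * p = 0 := by
    intro p hp j hj
    obtain ⟨c, rfl⟩ := Submodule.mem_span_singleton.1 hp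
    rw [mul_smul_comm, hesoc j hj, smul_zero]
  have heNmem : e ∈ N := by
    have : N * N ≤ N := Submodule.mul_le.2 fun m _ n hn => hNl m n hn
    exact this heN
  -- noncommutativity modulo N
  have hnot : ∃ x ∈ J, ∃ y ∈ J, x * y - y * x ∉ N := by
    by_contra hall
    push Not at hall
    have hK : gK k (1 : A) ≤ N := by
      rw [gK, Submodule.span_le]
      rintro _ ⟨a, b, rfl⟩
      obtain ⟨j, hj, j', hj', e1⟩ := h.comm_eq a b
      rw [one_mul, e1]
      exact hall j hj j' hj'
    have hKann : ∀ w ∈ gK k (1 : A), ∀ n ∈ N, w * n = 0 := by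
      intro w hw n hn
      induction hw using Submodule.span_induction with
      | mem x hx => obtain ⟨a, b, rfl⟩ := hx; rw [one_mul, hKN n hn]
      | zero => simp
      | add x y _ _ hx hy => rw [add_mul, hx, hy, add_zero]
      | smul c x _ hx => rw [smul_mul_assoc, hx, smul_zero]
    have h1 := h.dual 1 (by simp)
    have hlt : gK k (1 : A) < gK k (1 : A) ⊔ Submodule.span k {e} :=
      lt_of_le_of_ne le_sup_left fun e1 => hse (h.s_K 1 (by simp) e
        (e1 ▸ Submodule.mem_sup_right (Submodule.mem_span_singleton_self e)))
    have h2 := Submodule.finrank_lt_finrank_of_lt hlt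
    have h3 := hT (gK k (1 : A) ⊔ Submodule.span k {e}) (by
      intro t ht
      obtain ⟨u, hu, v, hv, rfl⟩ := Submodule.mem_sup.1 ht
      have hvN : v ∈ N := by
        obtain ⟨c, rfl⟩ := Submodule.mem_span_singleton.1 hv
        exact Submodule.smul_mem _ _ heNmem
      refine ⟨add_mem (hK hu) hvN, fun n hn => ?_⟩
      rw [add_mul, hKann u hu n hn, hNc v hvN, soc_span v hv n (hNJ hn), add_zero])
    omega
  obtain ⟨x, hx, y, hy, hw⟩ := hnot
  have hg := h.gen_dim N hNJ hNl hNr 1 (fun a i hi => by rw [hNc i hi, sub_self, mul_zero])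
    ⟨x, y, fun h0 => hw (by rw [one_mul] at h0; rw [h0]; exact zero_mem _)⟩
  obtain ⟨w, hwdef⟩ : ∃ w, w = x * y - y * x := ⟨_, rfl⟩
  rw [← hwdef] at hw
  have hwJ2 : w ∈ J ^ 2 := hwdef ▸ h.comm_mem x y
  have hJ2 : J ^ 2 ≤ J := by simpa using h.pow_anti 0
  have hlt : N < N ⊔ Submodule.span k {w} := lt_of_le_of_ne le_sup_left fun e1 =>
    hw (e1 ▸ Submodule.mem_sup_right (Submodule.mem_span_singleton_self w))
  have hle : N ⊔ Submodule.span k {w} ≤ J ^ 2 ⊔ N :=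
    sup_le le_sup_right (by simpa using Submodule.mem_sup_left hwJ2)
  have hd1 := Submodule.finrank_lt_finrank_of_lt hlt
  have hJ2eq : N ⊔ Submodule.span k {w} = J ^ 2 ⊔ N :=
    Submodule.eq_of_le_of_finrank_le hle (by omega)
  have hJ2w : ∀ p ∈ J ^ 2, ∃ c : k, ∃ n ∈ N, p = c • w + n := by
    intro p hp
    have : p ∈ N ⊔ Submodule.span k {w} := hJ2eq ▸ Submodule.mem_sup_left hp
    obtain ⟨n, hn, v, hv, rfl⟩ := Submodule.mem_sup.1 this
    obtain ⟨c, rfl⟩ := Submodule.mem_span_singleton.1 hv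
    exact ⟨c, n, hn, add_comm _ _⟩
  -- J^3 in N
  have hJ3 : J ^ 3 ≤ N := by
    by_contra hn
    obtain ⟨q, hq, hqN⟩ := Set.not_subset.1 hn
    have hq2 := hJ2w q (h.pow_anti 1 hq)
    obtain ⟨c, n, hnN, hqe⟩ := hq2
    have hc : c ≠ 0 := fun hc => hqN (by rw [hqe, hc, zero_smul, zero_add]; exact hnN)
    have hwq : ∃ q' ∈ J ^ 3, ∃ n' ∈ N, w = q' + n' := by
      refine ⟨c⁻¹ • q, Submodule.smul_mem _ _ hq, -(c⁻¹ • n), neg_mem (Submodule.smul_mem _ _ hnN), ?_⟩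
      rw [hqe, smul_add, smul_smul, inv_mul_cancel₀ hc, one_smul]; abel
    have step : ∀ m : ℕ, ∃ q' ∈ J ^ (m + 2), ∃ n' ∈ N, w = q' + n' := by
      intro m
      induction m with
      | zero => exact ⟨w, hwJ2, 0, zero_mem _, by simp⟩
      | succ m ih =>
        obtain ⟨q', hq', n', hn', e1⟩ := ih
        have : ∀ r ∈ J ^ (m + 2), ∃ q' ∈ J ^ (m + 3), ∃ n' ∈ N, r = q' + n' := by
          intro r hr
          rw [pow_add] at hr
          induction hr using Submodule.mul_induction_on' with
          | mem_mul_mem a ha b hb =>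
            obtain ⟨c, n, hn, rfl⟩ := hJ2w b hb
            obtain ⟨q3, hq3, n3, hn3, e3⟩ := hwq
            refine ⟨c • (a * q3), ?_, a * (c • n3 + n), hNl _ _ (add_mem (Submodule.smul_mem _ _ hn3) hn), ?_⟩
            · rw [pow_add]
              exact Submodule.smul_mem _ _ (Submodule.mul_mem_mul ha hq3)
            · rw [e3, smul_add, mul_add, mul_add, mul_add, mul_smul_comm]; abel
          | add a _ b _ ha hb =>
            obtain ⟨q1, hq1, n1, hn1, rfl⟩ := ha
            obtain ⟨q2, hq2, n2, hn2, rfl⟩ := hb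
            exact ⟨q1 + q2, add_mem hq1 hq2, n1 + n2, add_mem hn1 hn2, by abel⟩
        obtain ⟨q2, hq2, n2, hn2, e2⟩ := this q' hq'
        exact ⟨q2, hq2, n2 + n', add_mem hn2 hn', by rw [e1, e2]; abel⟩
    obtain ⟨M, hM⟩ := h.nil
    obtain ⟨q', hq', n', hn', e1⟩ := step M
    rw [pow_add, hM, Submodule.bot_mul, Submodule.mem_bot] at hq'
    exact hw (by rw [e1, hq', zero_add]; exact hn')
  have mul3 : ∀ p ∈ J ^ 2, ∀ j ∈ J, p * j ∈ N ∧ j * p ∈ N := fun p hp j hj =>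
    ⟨hJ3 (by rw [pow_succ]; exact Submodule.mul_mem_mul hp hj),
      hJ3 (by rw [pow_succ']; exact Submodule.mul_mem_mul hj hp)⟩
  have hwN : ∀ n ∈ N, w * n = 0 := fun n hn => by rw [hwdef, hKN n hn]
  have hNw : ∀ n ∈ N, n * w = 0 := fun n hn => by rw [hwdef, hNK n hn]
  -- x, y, w, N span J
  have hspan : ∀ j ∈ J, ∃ a b c : k, ∃ n ∈ N, j = a • x + b • y + c • w + n := by
    let U := J ^ 2 ⊔ N
    have hUc : ∀ u ∈ U, ∀ j ∈ J, u * j - j * u ∈ N := by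
      intro u hu j hj
      obtain ⟨p, hp, n, hn, rfl⟩ := Submodule.mem_sup.1 hu
      have : (p + n) * j - j * (p + n) = p * j - j * p + (n * j - j * n) := by noncomm_ring
      rw [this, hNc n hn j, sub_self, add_zero]
      exact sub_mem (mul3 p hp j hj).1 (mul3 p hp j hj).2
    have hyU : y ∉ U := fun hyU => hw (by
      rw [hwdef, ← neg_sub]; exact neg_mem (hUc y hyU x hx))
    have hxU : x ∉ U ⊔ Submodule.span k {y} := by
      intro hxU
      obtain ⟨u, hu, v, hv, e1⟩ := Submodule.mem_sup.1 hxU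
      obtain ⟨c, rfl⟩ := Submodule.mem_span_singleton.1 hv
      apply hw
      rw [hwdef, ← e1]
      have : (u + c • y) * y - y * (u + c • y) = u * y - y * u := by
        rw [add_mul, mul_add, smul_mul_assoc, mul_smul_comm]; abel
      rw [this]
      exact hUc u hu y hy
    have l1 : U < U ⊔ Submodule.span k {y} := lt_of_le_of_ne le_sup_left fun e1 =>
      hyU (e1 ▸ Submodule.mem_sup_right (Submodule.mem_span_singleton_self y))
    have l2 : U ⊔ Submodule.span k {y} < U ⊔ Submodule.span k {y} ⊔ Submodule.span k {x} :=
      lt_of_le_of_ne le_sup_left fun e1 =>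
      hxU (e1 ▸ Submodule.mem_sup_right (Submodule.mem_span_singleton_self x))
    have d1 := Submodule.finrank_lt_finrank_of_lt l1
    have d2 := Submodule.finrank_lt_finrank_of_lt l2
    have d3 := Submodule.finrank_mono hle
    have hUJ : U ⊔ Submodule.span k {y} ⊔ Submodule.span k {x} = J := by
      refine Submodule.eq_of_le_of_finrank_le (sup_le (sup_le (sup_le hJ2 hNJ) (by simpa using hy)) (by simpa using hx)) ?_
      change finrank k (N ⊔ Submodule.span k {w} : Submodule k A) ≤ finrank k U at d3
      omega
    intro j hj
    rw [← hUJ] at hj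
    obtain ⟨j1, hj1, v, hv, rfl⟩ := Submodule.mem_sup.1 hj
    obtain ⟨a, rfl⟩ := Submodule.mem_span_singleton.1 hv
    obtain ⟨j2, hj2, v, hv, rfl⟩ := Submodule.mem_sup.1 hj1
    obtain ⟨b, rfl⟩ := Submodule.mem_span_singleton.1 hv
    change j2 ∈ J ^ 2 ⊔ N at hj2
    rw [← hJ2eq] at hj2
    obtain ⟨n, hn, v, hv, rfl⟩ := Submodule.mem_sup.1 hj2
    obtain ⟨c, rfl⟩ := Submodule.mem_span_singleton.1 hv
    exact ⟨a, b, c, n, hn, by abel⟩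
  have hw2 : w * w ∈ Submodule.span k {e} := soc_iff _ fun j hj => by
    rw [← mul_assoc, hNw _ (mul3 w hwJ2 j hj).2]
  have hJ4 : J ^ 4 ≤ Submodule.span k {e} := by
    rw [show 4 = 2 + 2 from rfl, pow_add, Submodule.mul_le]
    intro p hp q hq
    obtain ⟨c, n, hn, rfl⟩ := hJ2w p hp
    obtain ⟨c', n', hn', rfl⟩ := hJ2w q hq
    have : (c • w + n) * (c' • w + n') = (c * c') • (w * w) + n * n' := by
      rw [add_mul, mul_add, mul_add, smul_mul_assoc, smul_mul_assoc, mul_smul_comm, mul_smul_comm,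
        hwN n' hn', hNw n hn, smul_smul]; simp
    rw [this]
    refine add_mem (Submodule.smul_mem _ _ hw2) ?_
    rw [← hN2']
    exact Submodule.mul_mem_mul hn hn'
  have hw2ne : w * w ≠ 0 := by
    intro hw0
    have key : ∀ u ∈ J, s ((u * w - w * u) * x) = 0 → s ((u * w - w * u) * y) = 0 →
        u * w - w * u = 0 := by
      intro u hu hsx hsy
      obtain ⟨c, hc⟩ : ∃ c, c = u * w - w * u := ⟨_, rfl⟩
      rw [← hc] at hsx hsy ⊢
      have hcN : c ∈ N := hc ▸ sub_mem (mul3 w hwJ2 u hu).2 (mul3 w hwJ2 u hu).1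
      have hcn : ∀ n ∈ N, c * n = 0 := fun n hn => by rw [hc, hKN n hn]
      have hcj : ∀ j ∈ J, s (c * j) = 0 → c * j = 0 := by
        intro j hj hsj
        refine h.soc_s (fun i hi => ?_) hsj
        rw [← mul_assoc, ← hNc c hcN, mul_assoc]
        obtain ⟨r, n, hn, e1⟩ := hJ2w (i * j) (by rw [pow_two]; exact Submodule.mul_mem_mul hi hj)
        rw [e1, mul_add, mul_smul_comm, hNw c hcN, hcn n hn]; simp
      have hcx := hcj x hx hsx
      have hcy := hcj y hy hsy
      refine h.soc_s (fun j hj => ?_) (h.s_K 1 (by simp) c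
        (Submodule.subset_span ⟨u, w, by rw [hc, one_mul]⟩))
      rw [← hNc c hcN]
      obtain ⟨r1, r2, r3, n, hn, rfl⟩ := hspan j hj
      simp only [mul_add, mul_smul_comm, hcx, hcy, hNw c hcN, hcn n hn, smul_zero, add_zero]
    have hww : s (w * (x * y)) - s (w * (y * x)) = 0 := by
      rw [← map_sub, ← mul_sub, ← hwdef, hw0, map_zero]
    have hxw := key x hx (by
        rw [sub_mul, map_sub, mul_assoc, h.tr x, sub_eq_zero]) (by
        rw [sub_mul, map_sub, mul_assoc, h.tr x, mul_assoc, mul_assoc, ← neg_sub, hww, neg_zero])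
    have hyw := key y hy (by
        rw [sub_mul, map_sub, mul_assoc, h.tr y, mul_assoc, mul_assoc, hww]) (by
        rw [sub_mul, map_sub, mul_assoc, h.tr y, sub_eq_zero])
    apply hw
    refine hNmax w (hJ2 hwJ2) fun a => ?_
    obtain ⟨c, j, hj, rfl⟩ := h.dec a
    obtain ⟨r1, r2, r3, n, hn, rfl⟩ := hspan j hj
    rw [sub_eq_zero] at hxw hyw
    simp only [mul_add, add_mul, mul_smul_comm, smul_mul_assoc, hxw, hyw, hNw n hn, hwN n hn,
      Algebra.commutes c w]
  have hJ4eq : J ^ 4 = Submodule.span k {e} := by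
    refine le_antisymm hJ4 ?_
    obtain ⟨c, hc⟩ := Submodule.mem_span_singleton.1 hw2
    have hc0 : c ≠ 0 := fun h0 => hw2ne (by rw [← hc, h0, zero_smul])
    rw [Submodule.span_singleton_le_iff_mem]
    have : e = c⁻¹ • (w * w) := by rw [← hc, smul_smul, inv_mul_cancel₀ hc0, one_smul]
    rw [this, show 4 = 2 + 2 from rfl, pow_add]
    exact Submodule.smul_mem _ _ (Submodule.mul_mem_mul hwJ2 hwJ2)
  refine ⟨hJ3, ?_, hJ4eq, hN2, fun p => ⟨fun hp => soc_iff p fun j hj => (hp j hj).1,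
    fun hp j hj => ⟨soc_span p hp j hj, h.soc_right (soc_span p hp) j hj⟩⟩⟩
  rw [pow_succ', hJ4eq, eq_bot_iff, Submodule.mul_le]
  intro j hj p hp
  rw [soc_span p hp j hj]; exact zero_mem _

end abs

section loc
variable (k A : Type) [Field k] [IsAlgClosed k] [Ring A] [Algebra k A] [FiniteDimensional k A]
    [IsLocalRing A]

lemma g_mem_rad (a : A) : a ∈ radSub k A ↔ ¬ IsUnit a := by
  have : IsArtinianRing A := IsArtinianRing.of_finite k A
  constructor
  · intro ha
    induction ha using Submodule.span_induction with
    | mem x hx => exact hx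
    | zero => exact not_isUnit_zero
    | add x y _ _ hx hy =>
      rintro ⟨u, hu⟩
      have h1 : (↑u⁻¹ : A) * x + ↑u⁻¹ * y = 1 := by rw [← mul_add, ← hu]; simp
      rcases IsLocalRing.isUnit_or_isUnit_of_add_one h1 with h | h
      · exact hx (isUnit_of_mul_isUnit_right h)
      · exact hy (isUnit_of_mul_isUnit_right h)
    | smul c x _ hx =>
      intro h
      rw [Algebra.smul_def] at h
      exact hx (isUnit_of_mul_isUnit_right h)
  · intro h
    exact Submodule.subset_span h

lemma g_SD (s : A →ₗ[k] k) (h1 : ∀ x y : A, s (x * y) = s (y * x))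
    (h2 : ∀ I : Ideal A, (∀ x ∈ I, s x = 0) → I = ⊥) : gSD k A (radSub k A) s := by
  have : IsArtinianRing A := IsArtinianRing.of_finite k A
  have hl : ∀ a j : A, j ∈ radSub k A → a * j ∈ radSub k A := fun a j hj => by
    rw [g_mem_rad] at *
    exact fun h => hj (isUnit_of_mul_isUnit_right h)
  have hr : ∀ a j : A, j ∈ radSub k A → j * a ∈ radSub k A := fun a j hj => by
    rw [g_mem_rad] at *
    exact fun h => hj (isUnit_of_mul_isUnit_left h)
  refine ⟨h1, ?_, ?_, hl, hr, ?_⟩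
  · intro a ha
    have := h2 (Ideal.span {a}) (fun x hx => by
      obtain ⟨b, rfl⟩ := Ideal.mem_span_singleton'.1 hx
      exact ha b)
    exact Ideal.span_singleton_eq_bot.1 this
  · intro a
    obtain ⟨c, hc⟩ := spectrum.nonempty_of_isAlgClosed_of_finiteDimensional k a
    refine ⟨c, a - algebraMap k A c, ?_, by abel⟩
    rw [← neg_sub]
    exact neg_mem ((g_mem_rad k A _).2 hc)
  · obtain ⟨n, hn⟩ := (IsSemiprimaryRing.isNilpotent : IsNilpotent (Ring.jacobson A))
    refine ⟨n, ?_⟩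
    have hJ : ∀ j ∈ radSub k A, j ∈ Ring.jacobson A := by
      intro j hj
      rw [← Ideal.jacobson_bot, Ideal.mem_jacobson_iff]
      intro y
      have hy := (g_mem_rad k A _).1 (hl y j hj)
      have hu : IsUnit (y * j + 1) := by
        have h3 : -(y * j) + (y * j + 1) = 1 := by abel
        rcases IsLocalRing.isUnit_or_isUnit_of_add_one h3 with h | h
        · exact absurd (by simpa using h.neg) hy
        · exact h
      obtain ⟨u, hu⟩ := hu
      refine ⟨↑u⁻¹, ?_⟩
      have : (↑u⁻¹ : A) * y * j + ↑u⁻¹ - 1 = ↑u⁻¹ * (y * j + 1) - 1 := by noncomm_ring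
      rw [this, ← hu]; simp
    have hpow : ∀ m : ℕ, ∀ p ∈ radSub k A ^ m, p ∈ Ring.jacobson A ^ m := by
      intro m
      induction m with
      | zero => intro p _; rw [Submodule.pow_zero, Ideal.one_eq_top]; trivial
      | succ m ih =>
        intro p hp
        rw [Submodule.pow_succ] at hp ⊢
        induction hp using Submodule.mul_induction_on' with
        | mem_mul_mem a ha b hb => exact Ideal.mul_mem_mul (ih a ha) (hJ b hb)
        | add x _ y _ hx hy => exact add_mem hx hy
    rw [eq_bot_iff]
    intro p hp
    have := hpow n p hp
    rw [hn] at this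
    simpa using this

lemma g_rad_dim (hdim : finrank k A = 9) : finrank k (radSub k A) = 8 := by
  have h1 : (1 : A) ∉ radSub k A := fun h => (g_mem_rad k A 1).1 h isUnit_one
  have hc : IsCompl (Submodule.span k {(1 : A)}) (radSub k A) := by
    constructor
    · rw [disjoint_comm, Submodule.disjoint_span_singleton' one_ne_zero]; exact h1
    · rw [codisjoint_iff, eq_top_iff]
      intro a _
      obtain ⟨c, hc⟩ := spectrum.nonempty_of_isAlgClosed_of_finiteDimensional k a
      have h2 : a - algebraMap k A c ∈ radSub k A := by
        rw [← neg_sub]; exact neg_mem ((g_mem_rad k A _).2 hc)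
      have : a = c • 1 + (a - algebraMap k A c) := by
        rw [Algebra.algebraMap_eq_smul_one]; abel
      rw [this]
      exact Submodule.add_mem_sup (Submodule.smul_mem _ _ (Submodule.mem_span_singleton_self 1)) h2
  have := Submodule.finrank_add_eq_of_isCompl hc
  rw [finrank_span_singleton one_ne_zero] at this
  omega
end loc

/-- J(A)³ ⊆ Z(A), J(A)⁵ = 0 and J(A)⁴ = Soc(A) = (Z(A) ∩ J(A))². -/
theorem stmt16 (k : Type) [Field k] [CharP k 3] [IsAlgClosed k]
    (A : Type) [Ring A] [Algebra k A] [FiniteDimensional k A]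
    [IsLocalRing A] (hsym : IsSymmAlg k A) (hdim : finrank k A = 9)
    (hcen : Nonempty (Subalgebra.center k A ≃ₐ[k] Subalgebra.center k (Balg k))) :
    (∀ a ∈ radSub k A ^ 3, a ∈ Subalgebra.center k A) ∧
      radSub k A ^ 5 = ⊥ ∧
      radSub k A ^ 4 = socSub k A ∧
      radSub k A ^ 4 =
        (Submodule.span k {z : A | z ∈ Subalgebra.center k A ∧ ¬ IsUnit z}) ^ 2 := by
  obtain ⟨s, hs1, hs2⟩ := hsym
  have h := g_SD k A s hs1 hs2
  have hJ8 := g_rad_dim k A hdim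
  have memJ := g_mem_rad k A
  obtain ⟨φ⟩ := hcen
  obtain ⟨a', b', c', d', haa, hbb, hac, had, hbc, hbd, hcc, hcd, hdd, hsp, hli⟩ := gB_center_ex k
  -- transport to A
  let ψ : Subalgebra.center k (Balg k) →ₐ[k] A := (Subalgebra.center k A).val.comp φ.symm.toAlgHom
  have ψinj : Function.Injective ψ := Subtype.val_injective.comp φ.symm.injective
  have ψc : ∀ z, ψ z ∈ Subalgebra.center k A := fun z => (φ.symm z).2
  have ψsurj : ∀ z ∈ Subalgebra.center k A, ∃ y, ψ y = z := fun z hz =>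
    ⟨φ ⟨z, hz⟩, by simp [ψ]⟩
  have tr : ∀ {u v}, u * v = 0 → ψ u * ψ v = 0 := fun {u v} huv => by rw [← map_mul, huv, map_zero]
  have hab0 : ψ a' * ψ b' = ψ (a' * b') := (map_mul _ _ _).symm
  obtain ⟨a, ha⟩ : ∃ a, a = ψ a' := ⟨_, rfl⟩
  obtain ⟨b, hb⟩ : ∃ a, a = ψ b' := ⟨_, rfl⟩
  obtain ⟨c, hc⟩ : ∃ a, a = ψ c' := ⟨_, rfl⟩
  obtain ⟨d, hd⟩ : ∃ a, a = ψ d' := ⟨_, rfl⟩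
  have lin : ∀ v : Fin 6 → k, ψ (v 0 • 1 + v 1 • a' + v 2 • b' + v 3 • c' + v 4 • d' + v 5 • (a' * b')) =
      v 0 • 1 + v 1 • a + v 2 • b + v 3 • c + v 4 • d + v 5 • (a * b) := by
    intro v
    simp only [map_add, map_smul, map_mul, map_one, ha, hb, hc, hd]
  replace hsp : ∀ z ∈ Subalgebra.center k A, ∃ v : Fin 6 → k,
      z = v 0 • 1 + v 1 • a + v 2 • b + v 3 • c + v 4 • d + v 5 • (a * b) := by
    intro z hz
    obtain ⟨y, rfl⟩ := ψsurj z hz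
    obtain ⟨v, hv⟩ := hsp y
    exact ⟨v, by rw [← lin, ← hv]⟩
  replace hli : ∀ v : Fin 6 → k,
      v 0 • 1 + v 1 • a + v 2 • b + v 3 • c + v 4 • d + v 5 • (a * b) = 0 → v = 0 := by
    intro v hv
    rw [← lin] at hv
    exact hli v (ψinj (hv.trans (map_zero ψ).symm))
  have za : a ∈ Subalgebra.center k A := ha ▸ ψc _
  have zb : b ∈ Subalgebra.center k A := hb ▸ ψc _
  have zc : c ∈ Subalgebra.center k A := hc ▸ ψc _
  have zd : d ∈ Subalgebra.center k A := hd ▸ ψc _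
  replace haa := tr haa
  replace hbb := tr hbb
  replace hac := tr hac
  replace had := tr had
  replace hbc := tr hbc
  replace hbd := tr hbd
  replace hcc := tr hcc
  replace hcd := tr hcd
  replace hdd := tr hdd
  rw [← ha] at haa hac had
  rw [← hb] at hbb hbc hbd
  rw [← hc] at hac hbc hcc hcd
  rw [← hd] at had hbd hcd hdd
  clear lin hab0 tr ψsurj ψc ψinj
  have cen : ∀ z, z ∈ Subalgebra.center k A ↔ ∀ x, z * x = x * z := fun z => by
    rw [Subalgebra.mem_center_iff]
    exact forall_congr' fun x => eq_comm
  have ca := (cen a).1 za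
  have cb := (cen b).1 zb
  have cc := (cen c).1 zc
  have cd := (cen d).1 zd
  have sq : ∀ t : A, t * t = 0 → t ∈ radSub k A := fun t ht => by
    rw [memJ]
    intro hu
    have : t = 0 := hu.mul_left_cancel (by rw [ht, mul_zero])
    rw [this] at hu
    exact not_isUnit_zero hu
  have ja := sq a haa
  have jb := sq b hbb
  have jc := sq c hcc
  have jd := sq d hdd
  have jab : a * b ∈ radSub k A := h.left _ _ jb
  let Z : Submodule k A := Subalgebra.toSubmodule (Subalgebra.center k A)
  let N : Submodule k A := Z ⊓ radSub k A
  have memN : ∀ z, z ∈ N ↔ z ∈ Subalgebra.center k A ∧ z ∈ radSub k A := fun z => Iff.rfl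
  have hNspan : Submodule.span k {z : A | z ∈ Subalgebra.center k A ∧ ¬ IsUnit z} = N := by
    have : {z : A | z ∈ Subalgebra.center k A ∧ ¬ IsUnit z} = (N : Set A) := by
      ext z
      rw [Set.mem_ofPred_eq, SetLike.mem_coe, memN, memJ]
    rw [this, Submodule.span_eq]
  have Na : a ∈ N := ⟨za, ja⟩
  have Nb : b ∈ N := ⟨zb, jb⟩
  have Nc : c ∈ N := ⟨zc, jc⟩
  have Nd : d ∈ N := ⟨zd, jd⟩
  have Nab : a * b ∈ N := ⟨(Subalgebra.center k A).mul_mem za zb, jab⟩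
  have h1J : (1 : A) ∉ radSub k A := fun h => (memJ 1).1 h isUnit_one
  have Nform : ∀ z ∈ N, ∃ v : Fin 5 → k,
      z = v 0 • a + v 1 • b + v 2 • c + v 3 • d + v 4 • (a * b) := by
    intro z hz
    obtain ⟨v, hv⟩ := hsp z hz.1
    by_cases h0 : v 0 = 0
    · exact ⟨![v 1, v 2, v 3, v 4, v 5], by rw [hv, h0]; simp⟩
    · exfalso
      apply h1J
      have hm : v 1 • a + v 2 • b + v 3 • c + v 4 • d + v 5 • (a * b) ∈ radSub k A :=
        add_mem (add_mem (add_mem (add_mem (Submodule.smul_mem _ _ ja) (Submodule.smul_mem _ _ jb))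
          (Submodule.smul_mem _ _ jc)) (Submodule.smul_mem _ _ jd)) (Submodule.smul_mem _ _ jab)
      have h2 : v 0 • (1 : A) ∈ radSub k A := by
        have : v 0 • (1 : A) = z - (v 1 • a + v 2 • b + v 3 • c + v 4 • d + v 5 • (a * b)) := by
          rw [hv]; abel
        rw [this]
        exact sub_mem hz.2 hm
      have h3 := Submodule.smul_mem _ (v 0)⁻¹ h2
      rwa [smul_smul, inv_mul_cancel₀ h0, one_smul] at h3
  have he0 : a * b ≠ 0 := by
    intro h0
    have := congrFun (hli ![0,0,0,0,0,1] (by simp [h0])) 5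
    simp at this
  have hN5 : finrank k N = 5 := by
    have hL : LinearIndependent k ![a, b, c, d, a * b] := by
      rw [Fintype.linearIndependent_iff]
      intro g hg
      have h0 := hli ![0, g 0, g 1, g 2, g 3, g 4] (by
        simp only [Fin.sum_univ_five] at hg
        simpa using hg)
      intro i
      fin_cases i
      · exact congrFun h0 1
      · exact congrFun h0 2
      · exact congrFun h0 3
      · exact congrFun h0 4
      · exact congrFun h0 5
    have hNe : N = Submodule.span k (Set.range ![a, b, c, d, a * b]) := by
      apply le_antisymm
      · intro z hz
        obtain ⟨v, rfl⟩ := Nform z hz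
        rw [Submodule.mem_span_range_iff_exists_fun]
        exact ⟨v, by simp [Fin.sum_univ_five]⟩
      · rw [Submodule.span_le]
        rintro _ ⟨i, rfl⟩
        fin_cases i
        · exact Na
        · exact Nb
        · exact Nc
        · exact Nd
        · exact Nab
    rw [hNe, finrank_span_eq_card hL]
    simp
  have hW : finrank k (gW k (1 : A)) ≤ 6 := by
    have : gW k (1 : A) ≤ Submodule.span k (Set.range ![1, a, b, c, d, a * b]) := by
      intro z hz
      have hzc : z ∈ Subalgebra.center k A := (cen z).2 fun x => by
        have := hz x
        rwa [one_mul, sub_eq_zero] at this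
      obtain ⟨v, rfl⟩ := hsp z hzc
      rw [Submodule.mem_span_range_iff_exists_fun]
      exact ⟨v, by simp [Fin.sum_univ_six]⟩
    refine (Submodule.finrank_mono this).trans ((finrank_range_le_card _).trans ?_)
    simp
  have hba : b * a = a * b := (ca b).symm
  have hca : c * a = 0 := by rw [← ca c, hac]
  have hda : d * a = 0 := by rw [← ca d, had]
  have hcb : c * b = 0 := by rw [← cb c, hbc]
  have hdb : d * b = 0 := by rw [← cb d, hbd]
  have hdc : d * c = 0 := by rw [← cc d, hcd]
  have hprod : ∀ v w : Fin 5 → k,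
      (v 0 • a + v 1 • b + v 2 • c + v 3 • d + v 4 • (a * b)) *
      (w 0 • a + w 1 • b + w 2 • c + w 3 • d + w 4 • (a * b)) =
      (v 0 * w 1 + v 1 * w 0) • (a * b) := by
    intro v w
    have e1 : a * (a * b) = 0 := by rw [← mul_assoc, haa, zero_mul]
    have e2 : b * (a * b) = 0 := by rw [← mul_assoc, hba, mul_assoc, hbb, mul_zero]
    have e3 : c * (a * b) = 0 := by rw [← mul_assoc, hca, zero_mul]
    have e4 : d * (a * b) = 0 := by rw [← mul_assoc, hda, zero_mul]
    have f1 : a * b * a = 0 := by rw [mul_assoc, hba, e1]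
    have f2 : a * b * b = 0 := by rw [mul_assoc, hbb, mul_zero]
    have f3 : a * b * c = 0 := by rw [mul_assoc, hbc, mul_zero]
    have f4 : a * b * d = 0 := by rw [mul_assoc, hbd, mul_zero]
    have f5 : a * b * (a * b) = 0 := by rw [mul_assoc, e2, mul_zero]
    simp only [add_mul, mul_add, smul_mul_assoc, mul_smul_comm, haa, hbb, hac, had, hbc, hbd, hcc,
      hcd, hdd, hba, hca, hda, hcb, hdb, hdc, e1, e2, e3, e4, f1, f2, f3, f4, f5, smul_zero,
      add_zero, zero_add, smul_smul, add_smul]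
    rw [mul_comm (w 1), mul_comm (w 0)]
    abel
  obtain ⟨r1, r2, r3, r4, r5⟩ := h.main hJ8 hdim N (fun z hz => (cen z).1 hz.1) inf_le_right
    (fun z hz hzc => ⟨(cen z).2 hzc, hz⟩) hN5 hW (a * b) he0 (Submodule.mul_mem_mul Na Nb)
    (fun z hz z' hz' => by
      obtain ⟨v, rfl⟩ := Nform z hz
      obtain ⟨w, rfl⟩ := Nform z' hz'
      exact ⟨_, hprod v w⟩)
    (fun T hT => by
      have : T ≤ Submodule.span k (Set.range ![c, d, a * b]) := by
        intro t ht
        obtain ⟨htN, ht0⟩ := hT t ht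
        obtain ⟨v, rfl⟩ := Nform t htN
        have p1 := ht0 a Na
        have p2 := ht0 b Nb
        have q1 := hprod v ![1,0,0,0,0]
        have q2 := hprod v ![0,1,0,0,0]
        simp at q1 q2
        rw [q1] at p1
        rw [q2] at p2
        have v1 := (smul_eq_zero.1 p1).resolve_right he0
        have v0 := (smul_eq_zero.1 p2).resolve_right he0
        rw [Submodule.mem_span_range_iff_exists_fun]
        exact ⟨![v 2, v 3, v 4], by simp [Fin.sum_univ_three, v0, v1]⟩
      refine (Submodule.finrank_mono this).trans ((finrank_range_le_card _).trans ?_)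
      simp)
  refine ⟨fun x hx => (r1 hx).1, r2, ?_, ?_⟩
  · rw [r3]
    ext p
    rw [← r5 p]
    exact ⟨fun hp x hx => hp x ((memJ x).2 hx), fun hp x hx => hp x ((memJ x).1 hx)⟩
  · rw [hNspan, r3, r4]
end
end
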